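/- Let n ≥ 1 be an integer. There exists a constant c = c(n) > 0 such that the following holds for all f, d, B. Let f ∈ ℤ[x_0,…,x_{n+1}] be a primitive homogeneous polynomial of degree d ≥ 1, irreducible over ℚ, and let B ≥ 1 be a real number. Then there exists a homogeneous polynomial g ∈ ℤ[x_0,…,x_{n+1}], not divisible by f, which vanishes at every rational point of ℙ^{n+1}(ℚ) of height at most B lying on the hypersurface f = 0, and whose degree is at most c·B^{(n+1)/(n·d^{1/n})}·d^{4−1/n}·b(f)/‖f‖^{1/(n·d^{1+1/n})} + c·d^{1−1/n}·log B + c·d^{4−1/n}. -/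

import Mathlib

/-- The maximum of the absolute values of the coefficients of `f`, as a real number. -/
noncomputable def normMax {σ : Type*} (f : MvPolynomial σ ℤ) : ℝ :=
  ((f.support.sup fun m => (f.coeff m).natAbs : ℕ) : ℝ)

open Classical in
/-- The badness `b(f)`: `0` if `f` is not absolutely irreducible, and otherwise the
product of `exp(log p / p)` over the primes `p > 27 d^4` (where `d = deg f`) modulo
which `f` is not irreducible over the algebraic closure of `F_p`. -/
noncomputable def badness {σ : Type*} (f : MvPolynomial σ ℤ) : ℝ :=
  if Irreducible (MvPolynomial.map (Int.castRingHom (AlgebraicClosure ℚ)) f) then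
    ∏ᶠ p ∈ {p : ℕ | ∃ hp : Nat.Prime p,
        27 * f.totalDegree ^ 4 < p ∧
        ¬ Irreducible (letI : Fact (Nat.Prime p) := ⟨hp⟩;
          MvPolynomial.map (Int.castRingHom (AlgebraicClosure (ZMod p))) f)},
      Real.exp (Real.log p / p)
  else 0

section WalshHelpers

open MvPolynomial


/-- A matrix over a field with trivial kernel has a nonzero maximal minor. -/
theorem wl_exists_minor {K ι κ : Type*} [Field K] [Fintype κ] [DecidableEq κ]
    (A : Matrix ι κ K) (h : ∀ x : κ → K, (∀ i, ∑ j, A i j * x j = 0) → x = 0) :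
    ∃ e : κ → ι, (A.submatrix e id).det ≠ 0 := by
  have hspan : Submodule.span K (Set.range (fun i => A i)) = ⊤ := by
    by_contra hne
    obtain ⟨φ, hφ, hφ2⟩ := Submodule.exists_le_ker_of_lt_top _ (lt_top_iff_ne_top.mpr hne)
    apply hφ
    have hx := h (fun j => φ (Pi.single j 1)) (fun i => by
      have : A i ∈ LinearMap.ker φ := hφ2 (Submodule.subset_span ⟨i, rfl⟩)
      rw [LinearMap.mem_ker, LinearMap.pi_apply_eq_sum_univ φ (A i)] at this
      rw [← this]
      apply Finset.sum_congr rfl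
      intro j _
      have h2 : (fun j_1 => if j = j_1 then (1:K) else 0) = Pi.single j 1 := by
        ext k; simp [Pi.single_apply, eq_comm]
      rw [h2, smul_eq_mul])
    apply LinearMap.ext
    intro y
    rw [LinearMap.pi_apply_eq_sum_univ φ y]
    apply Finset.sum_eq_zero
    intro j _
    have := congrFun hx j
    simp only [Pi.zero_apply] at this
    have h2 : (fun j_1 => if j = j_1 then (1:K) else 0) = Pi.single j 1 := by
      ext k; simp [Pi.single_apply, eq_comm]
    rw [h2, this, smul_zero]
  obtain ⟨κ', a, ha, hs, hli⟩ := exists_linearIndependent' K (fun i => A i)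
  rw [hspan] at hs
  let b := Module.Basis.mk hli (by rw [hs])
  let b2 := Pi.basisFun K κ
  let e0 := b2.indexEquiv b
  refine ⟨a ∘ e0, ?_⟩
  have : LinearIndependent K (A.submatrix (a ∘ e0) id).row := by
    have := hli.comp e0 e0.injective
    exact this
  rw [Matrix.linearIndependent_rows_iff_isUnit, Matrix.isUnit_iff_isUnit_det] at this
  exact this.ne_zero

/-- A matrix over a domain with trivial kernel has a nonzero maximal minor. -/
theorem wl_exists_minor_domain {R ι κ : Type*} [CommRing R] [IsDomain R] [Fintype κ] [DecidableEq κ]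
    (A : Matrix ι κ R) (h : ∀ x : κ → R, (∀ i, ∑ j, A i j * x j = 0) → x = 0) :
    ∃ e : κ → ι, (A.submatrix e id).det ≠ 0 := by
  obtain ⟨e, he⟩ := wl_exists_minor (A.map (algebraMap R (FractionRing R))) (fun x hx => by
    obtain ⟨b, hb⟩ := IsLocalization.exist_integer_multiples_of_finite (nonZeroDivisors R) x
    choose y hy using hb
    have hy0 : y = 0 := by
      apply h
      intro i
      apply IsFractionRing.injective R (FractionRing R)
      rw [map_sum, map_zero]
      have := hx i
      calc _ = ∑ j, algebraMap R (FractionRing R) (A i j) * (algebraMap R (FractionRing R) b * x j) := by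
              apply Finset.sum_congr rfl
              intro j _
              rw [map_mul, hy j, Algebra.smul_def]
        _ = algebraMap R (FractionRing R) b * ∑ j, (A.map (algebraMap R (FractionRing R))) i j * x j := by
              rw [Finset.mul_sum]
              apply Finset.sum_congr rfl
              intro j _
              simp only [Matrix.map_apply]; ring
        _ = 0 := by rw [this, mul_zero]
    ext j
    have h1 := hy j
    rw [hy0, Pi.zero_apply, map_zero, Algebra.smul_def] at h1
    have h2 : algebraMap R (FractionRing R) b ≠ 0 := by
      simpa using nonZeroDivisors.ne_zero b.2
    rcases mul_eq_zero.mp h1.symm with h3 | h3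
    · exact absurd h3 h2
    · exact h3)
  refine ⟨e, fun h0 => he ?_⟩
  have : ((A.submatrix e id).map (algebraMap R (FractionRing R))).det = 0 := by
    have h3 := (RingHom.map_det (algebraMap R (FractionRing R)) (A.submatrix e id)).symm
    rw [h0, map_zero] at h3
    exact h3
  exact this

/-- Monomials of degree `≤ k`. -/
noncomputable def wlMonLE (m k : ℕ) : Finset (Fin m →₀ ℕ) :=
  (Finset.range (k + 1)).biUnion (fun j => Finset.finsuppAntidiag Finset.univ j)

theorem wl_sum_eq_univ {m : ℕ} (a : Fin m →₀ ℕ) : (a.sum fun _ e => e) = ∑ i, a i := by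
  rw [Finsupp.sum_fintype]; simp

theorem wl_mem_monLE {m k : ℕ} {a : Fin m →₀ ℕ} : a ∈ wlMonLE m k ↔ ∑ i, a i ≤ k := by
  simp [wlMonLE, Finset.mem_finsuppAntidiag, Nat.lt_succ_iff]

theorem wl_card_mon_eq (m k : ℕ) :
    (Finset.finsuppAntidiag (Finset.univ : Finset (Fin (m+1))) k).card = (m + k).choose m := by
  rw [Finset.card_finsuppAntidiag_nat_eq_choose]
  simp only [Finset.card_univ, Fintype.card_fin]
  have : m + 1 + k - 1 = m + k := by omega
  rw [this]
  exact (Nat.choose_symm_add).symm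

theorem wl_card_monLE (m k : ℕ) : (wlMonLE m k).card = (m + k).choose m := by
  rw [wlMonLE, Finset.card_biUnion]
  · cases m with
    | zero =>
      simp only [Nat.choose_zero_right]
      rw [Finset.sum_eq_single 0]
      · simp [Finset.card_finsuppAntidiag_nat_eq_choose]
      · intro b _ hb
        simp only [Finset.card_eq_zero]
        rw [Finset.eq_empty_iff_forall_notMem]
        intro a ha
        rw [Finset.mem_finsuppAntidiag] at ha
        simp at ha
        omega
      · simp
    | succ m =>
      simp only [wl_card_mon_eq]
      induction k with
      | zero => simp
      | succ k ih =>
        rw [Finset.sum_range_succ, ih]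
        have : m + 1 + (k + 1) = (m + (k + 1)) + 1 := by ring
        rw [this, Nat.choose_succ_succ, add_comm]
        congr 2; ring
  · intro i _ j _ hij
    rw [Function.onFun, Finset.disjoint_left]
    intro a ha hb
    rw [Finset.mem_finsuppAntidiag] at ha hb
    exact hij (ha.1.symm.trans hb.1)

theorem wl_finrank_restrictTotalDegree (K : Type*) [Field K] (m L : ℕ) :
    Module.finrank K (restrictTotalDegree (Fin m) K L) = (m + L).choose m := by
  rw [← wl_card_monLE, restrictTotalDegree]
  rw [Module.finrank_eq_nat_card_basis (basisRestrictSupport K _)]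
  have : ({n | (n.sum fun _ e => e) ≤ L} : Set (Fin m →₀ ℕ)) = (wlMonLE m L : Set (Fin m →₀ ℕ)) := by
    ext a
    simp [wl_mem_monLE, wl_sum_eq_univ]
  simp only [this]
  simp


section bezout
variable {K : Type*} [Field K]

/-- The multiples `f·h`, `deg h ≤ L`. -/
noncomputable def wlMul {m : ℕ} (f : MvPolynomial (Fin m) K) (L : ℕ) :
    Submodule K (MvPolynomial (Fin m) K) :=
  (restrictTotalDegree (Fin m) K L).map (LinearMap.mulLeft K f)

instance wl_fd_restrict (m L : ℕ) : FiniteDimensional K (restrictTotalDegree (Fin m) K L) := by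
  unfold restrictTotalDegree
  have : ({n | (n.sum fun _ e => e) ≤ L} : Set (Fin m →₀ ℕ)) = (wlMonLE m L : Set (Fin m →₀ ℕ)) := by
    ext a
    simp [wl_mem_monLE, wl_sum_eq_univ]
  rw [this]
  exact (basisRestrictSupport K (wlMonLE m L : Set (Fin m →₀ ℕ))).finiteDimensional_of_finite

theorem wl_finrank_mul {m : ℕ} {f : MvPolynomial (Fin m) K} (hf : f ≠ 0) (L : ℕ) :
    Module.finrank K (wlMul f L) = (m + L).choose m := by
  rw [← wl_finrank_restrictTotalDegree K m L]
  exact (LinearEquiv.finrank_eq (Submodule.equivMapOfInjective (LinearMap.mulLeft K f)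
    (fun a b h => mul_left_cancel₀ hf h) _)).symm

theorem wl_choose_two (x : ℕ) : 2 * (2 + x).choose 2 = (x + 2) * (x + 1) := by
  induction x with
  | zero => rfl
  | succ x ih =>
    have : 2 + (x + 1) = (2 + x) + 1 := by ring
    rw [this, Nat.choose_succ_succ, mul_add, ih, Nat.choose_one_right]
    ring

theorem wl_mem_mul {m : ℕ} {f : MvPolynomial (Fin m) K} {L : ℕ} {a : MvPolynomial (Fin m) K} :
    a ∈ wlMul f L ↔ ∃ h : MvPolynomial (Fin m) K, h.totalDegree ≤ L ∧ f * h = a := by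
  simp [wlMul, mem_restrictTotalDegree]

theorem wl_mul_le {m : ℕ} {f : MvPolynomial (Fin m) K} {L L' : ℕ} (h : f.totalDegree + L ≤ L') :
    wlMul f L ≤ restrictTotalDegree (Fin m) K L' := by
  intro a ha
  obtain ⟨b, hb, rfl⟩ := wl_mem_mul.mp ha
  rw [mem_restrictTotalDegree]
  exact (totalDegree_mul _ _).trans (by omega)

instance wl_fd_mul {m : ℕ} (f : MvPolynomial (Fin m) K) (L : ℕ) :
    FiniteDimensional K (wlMul f L) := by
  unfold wlMul; infer_instance

/-- A Bezout-type inequality for linear systems of functionals. -/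
theorem wl_bezout {f G : MvPolynomial (Fin 2) K} (hf : Irreducible f) (hG : ¬ f ∣ G)
    {ι : Type*} [Fintype ι] (φ : MvPolynomial (Fin 2) K →ₗ[K] (ι → K))
    (hφ : Function.Surjective φ) (h1 : ∀ h, φ (f * h) = 0) (h2 : ∀ h, φ (G * h) = 0) :
    Fintype.card ι ≤ f.totalDegree * G.totalDegree := by
  classical
  have hG0 : G ≠ 0 := fun h => hG (h ▸ dvd_zero f)
  have hf0 : f ≠ 0 := hf.ne_zero
  choose pre hpre using fun i : ι => hφ (Pi.single i 1)
  set a := Finset.univ.sup (fun i => (pre i).totalDegree) with ha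
  set d := f.totalDegree
  set g := G.totalDegree
  set T := restrictTotalDegree (Fin 2) K (a + d + g)
  set U := wlMul f (a + g)
  set V := wlMul G (a + d)
  have hinf : U ⊓ V ≤ wlMul (f * G) a := by
    rintro x ⟨hx1, hx2⟩
    obtain ⟨b, hb, hb2⟩ := wl_mem_mul.mp hx1
    obtain ⟨c, hc, hc2⟩ := wl_mem_mul.mp hx2
    rw [wl_mem_mul]
    have hdvd : f ∣ G * c := ⟨b, by rw [hb2, hc2]⟩
    obtain ⟨e, rfl⟩ := (hf.prime.dvd_or_dvd hdvd).resolve_left hG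
    refine ⟨e, ?_, by rw [← hc2]; ring⟩
    by_cases he : e = 0
    · simp [he]
    · rw [totalDegree_mul_of_isDomain hf0 he] at hc
      omega
  have hsum := Submodule.finrank_sup_add_finrank_inf_eq U V
  have hinf2 := (Submodule.finrank_mono hinf).trans_eq (wl_finrank_mul (mul_ne_zero hf0 hG0) a)
  rw [wl_finrank_mul hf0, wl_finrank_mul hG0] at hsum
  have hWT : U ⊔ V ≤ T := sup_le (wl_mul_le (by omega)) (wl_mul_le (by omega))
  let ψ := φ.domRestrict T
  have hψ : LinearMap.range ψ = ⊤ := by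
    rw [LinearMap.range_eq_top]
    intro y
    have hm : ∑ i, y i • pre i ∈ T := by
      apply Submodule.sum_mem
      intro i _
      apply Submodule.smul_mem
      rw [mem_restrictTotalDegree]
      have : (pre i).totalDegree ≤ a := Finset.le_sup (f := fun i => (pre i).totalDegree) (Finset.mem_univ i)
      omega
    refine ⟨⟨_, hm⟩, ?_⟩
    change φ (∑ i, y i • pre i) = y
    simp only [map_sum, map_smul, hpre]
    ext j
    simp [Pi.single_apply]
  have hker := LinearMap.finrank_range_add_finrank_ker ψ
  rw [hψ, finrank_top, Module.finrank_fintype_fun_eq_card, wl_finrank_restrictTotalDegree] at hker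
  have hle : (U ⊔ V).comap T.subtype ≤ LinearMap.ker ψ := by
    intro x hx
    obtain ⟨u, hu, v, hv, huv⟩ := Submodule.mem_sup.mp hx
    obtain ⟨b, hb, rfl⟩ := wl_mem_mul.mp hu
    obtain ⟨c, hc, rfl⟩ := wl_mem_mul.mp hv
    rw [LinearMap.mem_ker]
    change φ (T.subtype x) = 0
    rw [← huv, map_add, h1, h2, add_zero]
  have hle2 := Submodule.finrank_mono hle
  rw [(Submodule.comapSubtypeEquivOfLe hWT).finrank_eq] at hle2
  have e1 := wl_choose_two (a + g)
  have e2 := wl_choose_two (a + d)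
  have e3 := wl_choose_two a
  have e4 := wl_choose_two (a + d + g)
  zify at *
  nlinarith

end bezout


section ord
variable {K A : Type*} [Field K] [CommRing A] [Algebra K A]

/-- `h` vanishes to order at least `M` along `D` at the point `ε`. -/
def wlOrd (D : Derivation K A A) (ε : A →ₐ[K] K) (M : ℕ) (h : A) : Prop :=
  ∀ j < M, ε (D^[j] h) = 0

variable {D : Derivation K A A} {ε : A →ₐ[K] K}

theorem wlOrd_zero (h : A) : wlOrd D ε 0 h := by intro j hj; omega

theorem wlOrd_succ {M : ℕ} {h : A} : wlOrd D ε (M + 1) h ↔ ε h = 0 ∧ wlOrd D ε M (D h) := by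
  constructor
  · intro H
    refine ⟨H 0 (by omega), fun j hj => ?_⟩
    have := H (j + 1) (by omega)
    rwa [Function.iterate_succ_apply] at this
  · rintro ⟨h0, H⟩ j hj
    cases j with
    | zero => exact h0
    | succ j => rw [Function.iterate_succ_apply]; exact H j (by omega)

theorem wlOrd.mono {M N : ℕ} {h : A} (H : wlOrd D ε M h) (hN : N ≤ M) : wlOrd D ε N h :=
  fun j hj => H j (by omega)

theorem wl_iter_eq (D : Derivation K A A) (j : ℕ) (h : A) :
    D^[j] h = ((D : A →ₗ[K] A) ^ j) h := by
  rw [Module.End.pow_apply]; rfl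

theorem wl_iter_add (D : Derivation K A A) (j : ℕ) (a b : A) :
    D^[j] (a + b) = D^[j] a + D^[j] b := by simp only [wl_iter_eq, map_add]

theorem wl_iter_smul (D : Derivation K A A) (j : ℕ) (c : K) (b : A) :
    D^[j] (c • b) = c • D^[j] b := by simp only [wl_iter_eq, map_smul]

theorem wl_iter_sum (D : Derivation K A A) (j : ℕ) {ι : Type*} (s : Finset ι) (f : ι → A) :
    D^[j] (∑ i ∈ s, f i) = ∑ i ∈ s, D^[j] (f i) := by simp only [wl_iter_eq, map_sum]

theorem wl_iter_zero (D : Derivation K A A) (j : ℕ) : D^[j] (0 : A) = 0 := by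
  simp only [wl_iter_eq, map_zero]

theorem wlOrd.add {M : ℕ} {a b : A} (ha : wlOrd D ε M a) (hb : wlOrd D ε M b) :
    wlOrd D ε M (a + b) := fun j hj => by
  rw [wl_iter_add, map_add, ha j hj, hb j hj, add_zero]

theorem wlOrd.zero_mem (M : ℕ) : wlOrd D ε M 0 := fun j hj => by
  rw [wl_iter_zero, map_zero]

theorem wlOrd.neg {M : ℕ} {a : A} (ha : wlOrd D ε M a) : wlOrd D ε M (-a) := fun j hj => by
  have : -a = (-1 : K) • a := by simp
  rw [this, wl_iter_smul, map_smul, ha j hj, smul_zero]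

theorem wlOrd.sum {M : ℕ} {ι : Type*} {s : Finset ι} {f : ι → A} (h : ∀ i ∈ s, wlOrd D ε M (f i)) :
    wlOrd D ε M (∑ i ∈ s, f i) := fun j hj => by
  rw [wl_iter_sum, map_sum]
  exact Finset.sum_eq_zero fun i hi => h i hi j hj

theorem wlOrd.mul {M N : ℕ} {a b : A} (ha : wlOrd D ε M a) (hb : wlOrd D ε N b) :
    wlOrd D ε (M + N) (a * b) := by
  induction hk : M + N generalizing M N a b with
  | zero => exact wlOrd_zero _
  | succ k ih =>
    rw [wlOrd_succ, Derivation.leibniz, smul_eq_mul, smul_eq_mul]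
    refine ⟨?_, ?_⟩
    · rw [map_mul]
      rcases Nat.eq_zero_or_pos M with h | h
      · rw [hb 0 (by omega) |> (fun h => (h : ε b = 0)), mul_zero]
      · rw [ha 0 (by omega) |> (fun h => (h : ε a = 0)), zero_mul]
    · apply wlOrd.add
      · cases N with
        | zero => exact ih (ha.mono (N := k) (by omega)) (wlOrd_zero (D b)) (by omega)
        | succ N => exact ih ha (wlOrd_succ.mp hb).2 (by omega)
      · cases M with
        | zero => exact ih (hb.mono (N := k) (by omega)) (wlOrd_zero (D a)) (by omega)
        | succ M => exact ih hb (wlOrd_succ.mp ha).2 (by omega)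

theorem wlOrd.mul_left {M : ℕ} {b : A} (a : A) (hb : wlOrd D ε M b) : wlOrd D ε M (a * b) := by
  simpa using (wlOrd_zero (D := D) (ε := ε) a).mul hb

theorem wlOrd.mul_right {M : ℕ} {b : A} (a : A) (hb : wlOrd D ε M b) : wlOrd D ε M (b * a) := by
  simpa using hb.mul (wlOrd_zero (D := D) (ε := ε) a)

theorem wlOrd.pow {a : A} (ha : ε a = 0) (M : ℕ) : wlOrd D ε M (a ^ M) := by
  induction M with
  | zero => exact wlOrd_zero _
  | succ M ih =>
    rw [pow_succ]
    exact ih.mul (N := 1) (fun j hj => by obtain rfl : j = 0 := (by omega); exact ha)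

theorem wlOrd.cancel {M : ℕ} {c a : A} (hc : ε c ≠ 0) (h : wlOrd D ε M (c * a)) :
    wlOrd D ε M a := by
  induction M generalizing a with
  | zero => exact wlOrd_zero _
  | succ M ih =>
    have ha := ih (h.mono (Nat.le_succ M))
    rw [wlOrd_succ] at h ⊢
    refine ⟨?_, ?_⟩
    · have := h.1
      rw [map_mul] at this
      exact (mul_eq_zero.mp this).resolve_left hc
    · apply ih
      have h2 := h.2
      rw [Derivation.leibniz, smul_eq_mul, smul_eq_mul] at h2
      have := h2.add (ha.mul_right (D c)).neg
      simpa using this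

theorem wlOrd_of_const {f : A} (hD : D f = 0) (h0 : ε f = 0) (M : ℕ) : wlOrd D ε M f := by
  cases M with
  | zero => exact wlOrd_zero _
  | succ M => rw [wlOrd_succ, hD]; exact ⟨h0, wlOrd.zero_mem _⟩

theorem wlOrd_iter {M j : ℕ} {h : A} (H : wlOrd D ε (M + j) h) : wlOrd D ε M (D^[j] h) := by
  intro i hi
  rw [← Function.iterate_add_apply]
  exact H _ (by omega)

theorem wlOrd_of_iter {M j : ℕ} {h : A} (H0 : wlOrd D ε j h) (H : wlOrd D ε M (D^[j] h)) :
    wlOrd D ε (j + M) h := by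
  intro i hi
  rcases lt_or_ge i j with h1 | h1
  · exact H0 i h1
  · have := H (i - j) (by omega)
    rwa [← Function.iterate_add_apply, Nat.sub_add_cancel h1] at this

theorem wl_iter_pow_mul {u : A} (hu : ε u = 0) (i : ℕ) (h : A) :
    ε (D^[i] (u ^ i * h)) = (i.factorial : K) * ε (D u) ^ i * ε h := by
  induction i generalizing h with
  | zero => simp
  | succ i ih =>
    have e : D (u ^ (i + 1) * h) = u ^ i * (((i + 1 : ℕ) : A) * D u * h + u * D h) := by
      rw [Derivation.leibniz, Derivation.leibniz_pow]
      simp only [smul_eq_mul, nsmul_eq_mul, Nat.add_sub_cancel]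
      ring
    rw [Function.iterate_succ_apply, e, ih]
    simp only [map_add, map_mul, hu, map_natCast, Nat.factorial_succ]
    push_cast
    ring

/-- Jets at finitely many points are independent. -/
theorem wl_jets_surjective (D : Derivation K A A) {ι : Type*} [Fintype ι] [DecidableEq ι]
    (ε : ι → A →ₐ[K] K) (M : ℕ)
    (hM : ∀ j < M, (j.factorial : K) ≠ 0)
    (hsep : ∀ i i', i ≠ i' → ∃ h : A, ε i h ≠ 0 ∧ ε i' h = 0)
    (hu : ∀ i, ∃ u : A, ε i u = 0 ∧ (1 < M → ε i (D u) ≠ 0)) :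
    Function.Surjective (LinearMap.pi (fun q : ι × Fin M =>
      (ε q.1).toLinearMap ∘ₗ ((D : A →ₗ[K] A) ^ (q.2 : ℕ))) : A →ₗ[K] (ι × Fin M → K)) := by
  classical
  set φ := (LinearMap.pi (fun q : ι × Fin M =>
      (ε q.1).toLinearMap ∘ₗ ((D : A →ₗ[K] A) ^ (q.2 : ℕ))) : A →ₗ[K] (ι × Fin M → K)) with hφ
  have hφa : ∀ h q, φ h q = ε q.1 (D^[(q.2 : ℕ)] h) := by
    intro h q
    rw [wl_iter_eq]
    rfl
  rw [← LinearMap.range_eq_top]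
  by_contra hne
  obtain ⟨L, hL, hL2⟩ := Submodule.exists_le_ker_of_lt_top _ (lt_top_iff_ne_top.mpr hne)
  set c : ι × Fin M → K := fun q => L (Pi.single q 1) with hc
  have hLs : ∀ y, L y = ∑ q, y q * c q := by
    intro y
    rw [LinearMap.pi_apply_eq_sum_univ L y]
    apply Finset.sum_congr rfl
    intro j _
    have h2 : (fun j_1 => if j = j_1 then (1:K) else 0) = Pi.single j 1 := by
      ext k; simp [Pi.single_apply, eq_comm]
    rw [h2, smul_eq_mul]
  have hrel : ∀ h, ∑ q, φ h q * c q = 0 := by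
    intro h
    rw [← hLs]
    exact hL2 ⟨h, rfl⟩
  have hc0 : ∀ i (j : Fin M), c (i, j) = 0 := by
    intro i
    -- separating polynomial
    choose s hs1 hs2 using fun i' : {i' // i ≠ i'} => hsep i i' i'.2
    obtain ⟨u, hu0, hu1⟩ := hu i
    set h := ∏ i', s i' with hh
    have hh1 : ε i h ≠ 0 := by
      rw [hh, map_prod]; exact Finset.prod_ne_zero_iff.mpr fun a _ => hs1 a
    have hh2 : ∀ i', i ≠ i' → ε i' h = 0 := by
      intro i' hi'
      rw [hh, map_prod]
      exact Finset.prod_eq_zero (Finset.mem_univ ⟨i', hi'⟩) (hs2 ⟨i', hi'⟩)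
    by_contra hcon
    push Not at hcon
    obtain ⟨j0, hj0⟩ := hcon
    obtain ⟨j, hj, hmax⟩ := (Finset.univ.filter (fun j : Fin M => c (i, j) ≠ 0)).exists_max_image id
      ⟨j0, by simpa using hj0⟩
    have hr := hrel (u ^ (j : ℕ) * h ^ M)
    rw [Finset.sum_eq_single (i, j)] at hr
    · rw [hφa] at hr
      simp only [] at hr
      rw [wl_iter_pow_mul hu0, map_pow] at hr
      have hcj : c (i, j) ≠ 0 := by simpa using hj
      have := hM j j.2
      have hu2 : ε i (D u) ^ (j : ℕ) ≠ 0 := by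
        rcases Nat.eq_zero_or_pos (j : ℕ) with h0 | h0
        · rw [h0, pow_zero]; exact one_ne_zero
        · exact pow_ne_zero _ (hu1 (by omega))
      have h3 := mul_ne_zero (mul_ne_zero (mul_ne_zero this hu2) (pow_ne_zero M hh1)) hcj
      exact h3 hr
    · rintro ⟨i', j'⟩ _ hne
      rw [hφa]
      by_cases hi : i = i'
      · subst hi
        have hjj : j' ≠ j := fun h => hne (by rw [h])
        rcases lt_or_gt_of_ne hjj with hlt | hgt
        · have := ((wlOrd.pow (D := D) hu0 (j : ℕ)).mul_right (h ^ M)) j' hlt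
          rw [this, zero_mul]
        · have : c (i, j') = 0 := by
            by_contra h0
            have := hmax j' (by simpa using h0)
            exact absurd this (not_le.mpr hgt)
          rw [this, mul_zero]
      · have := ((wlOrd.pow (D := D) (hh2 i' hi) M).mul_left (u ^ (j : ℕ))) j' j'.2
        rw [this, zero_mul]
    · intro h; exact absurd (Finset.mem_univ _) h
  apply hL
  apply LinearMap.ext
  intro y
  rw [hLs]
  exact Finset.sum_eq_zero fun q _ => by rw [show q = (q.1, q.2) from rfl, hc0, mul_zero]

end ord

section curve
variable {K : Type*} [Field K]

/-- The derivation `f_y ∂_x - f_x ∂_y`, with `y` the variable `0` and `x` the variable `1`. -/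
noncomputable def wlD {R : Type*} [CommRing R] (f : MvPolynomial (Fin 2) R) :
    Derivation R (MvPolynomial (Fin 2) R) (MvPolynomial (Fin 2) R) :=
  (pderiv 0 f) • pderiv 1 - (pderiv 1 f) • pderiv 0

theorem wlD_apply {R : Type*} [CommRing R] (f h : MvPolynomial (Fin 2) R) :
    wlD f h = pderiv 0 f * pderiv 1 h - pderiv 1 f * pderiv 0 h := by
  simp [wlD]

theorem wlD_self {R : Type*} [CommRing R] (f : MvPolynomial (Fin 2) R) : wlD f f = 0 := by
  rw [wlD_apply]; ring

theorem wl_sep (P Q : Fin 2 → K) (h : P ≠ Q) :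
    ∃ h : MvPolynomial (Fin 2) K, aeval P h ≠ 0 ∧ aeval Q h = 0 := by
  obtain ⟨i, hi⟩ := Function.ne_iff.mp h
  refine ⟨X i - C (Q i), ?_, ?_⟩
  · simpa [sub_eq_zero] using hi
  · simp

theorem wl_curve_bound_aux {f G : MvPolynomial (Fin 2) K} (hf : Irreducible f) (hG : ¬ f ∣ G)
    {ι : Type*} [Fintype ι] (P : ι → Fin 2 → K) (hP : Function.Injective P)
    (hfP : ∀ i, aeval (P i) f = 0) (M : ℕ) (hM : ∀ j < M, (j.factorial : K) ≠ 0)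
    (hs : 1 < M → ∀ i, aeval (P i) (pderiv 0 f) ≠ 0)
    (hGP : ∀ i, wlOrd (wlD f) (aeval (P i)) M G) :
    M * Fintype.card ι ≤ f.totalDegree * G.totalDegree := by
  classical
  have hsur := wl_jets_surjective (wlD f) (fun i => (aeval (P i) : MvPolynomial (Fin 2) K →ₐ[K] K)) M hM
    (fun i i' h => wl_sep _ _ (fun h' => h (hP h')))
    (fun i => ⟨X 1 - C (P i 1), by simp, fun h => by
      rw [wlD_apply]
      simpa using hs h i⟩)
  have := wl_bezout hf hG _ hsur (fun h => by
      funext q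
      have := ((wlOrd_of_const (wlD_self f) (hfP q.1) M).mul_right h) q.2 q.2.2
      rw [wl_iter_eq] at this
      exact this) (fun h => by
      funext q
      have := ((hGP q.1).mul_right h) q.2 q.2.2
      rw [wl_iter_eq] at this
      exact this)
  rw [Fintype.card_prod, Fintype.card_fin] at this
  rwa [mul_comm]

theorem wl_common_zeros {f G : MvPolynomial (Fin 2) K} (hf : Irreducible f) (hG : ¬ f ∣ G)
    {ι : Type*} [Fintype ι] (P : ι → Fin 2 → K) (hP : Function.Injective P)
    (hfP : ∀ i, aeval (P i) f = 0) (hGP : ∀ i, aeval (P i) G = 0) :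
    Fintype.card ι ≤ f.totalDegree * G.totalDegree := by
  have := wl_curve_bound_aux hf hG P hP hfP 1 (fun j hj => by
    obtain rfl : j = 0 := (by omega)
    simp) (fun h => absurd h (by omega)) (fun i j hj => by
    obtain rfl : j = 0 := (by omega)
    exact hGP i)
  simpa using this

end curve


theorem wl_factorial_ne {K : Type*} [Field K] (p : ℕ) [hp : Fact p.Prime] [CharP K p] (j : ℕ) (hj : j < p) :
    (j.factorial : K) ≠ 0 := by
  rw [Ne, CharP.cast_eq_zero_iff K p, hp.out.dvd_factorial]
  omega

section stepanov
variable {K : Type*} [Field K]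

theorem wl_exists_point [IsAlgClosed K] {m : ℕ} {f q : MvPolynomial (Fin m) K} (hf : Irreducible f) (hq : ¬ f ∣ q) :
    ∃ P : Fin m → K, aeval P f = 0 ∧ aeval P q ≠ 0 := by
  by_contra hcon
  push Not at hcon
  apply hq
  have hp : (Ideal.span {f}).IsPrime := (Ideal.span_singleton_prime hf.ne_zero).mpr hf.prime
  have := IsPrime.vanishingIdeal_zeroLocus (K := K) (Ideal.span {f})
  rw [← Ideal.mem_span_singleton, ← this, mem_vanishingIdeal_iff]
  intro x hx
  apply hcon
  rw [mem_zeroLocus_iff] at hx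
  exact hx f (Ideal.mem_span_singleton_self f)

theorem wlD_dvd {f c : MvPolynomial (Fin 2) K} (h : f ∣ c) : f ∣ wlD f c := by
  obtain ⟨e, rfl⟩ := h
  rw [Derivation.leibniz, wlD_self]
  simp

theorem wlD_iter_dvd {f c : MvPolynomial (Fin 2) K} (h : f ∣ c) (j : ℕ) : f ∣ (wlD f)^[j] c := by
  induction j with
  | zero => exact h
  | succ j ih => rw [Function.iterate_succ_apply']; exact wlD_dvd ih

theorem wl_no_relation [IsAlgClosed K] (p : ℕ) [Fact p.Prime] [CharP K p]
    {f : MvPolynomial (Fin 2) K} (hf : Irreducible f) (hfy : ¬ f ∣ pderiv 0 f)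
    (k N : ℕ) (h : Fin (N + 1) → MvPolynomial (Fin 2) K)
    (hlin : ∀ c : Fin (N + 1) → K, c ≠ 0 → ¬ f ∣ ∑ i, c i • h i)
    (hdeg : ∀ i, (h i).totalDegree ≤ k) (hk : f.totalDegree * k < p)
    (c : ℕ → MvPolynomial (Fin 2) K) (hc : ∃ j ≤ N, ¬ f ∣ c j)
    (hrel : ∀ i, f ∣ ∑ j ∈ Finset.range (N + 1), c j * (wlD f)^[j] (h i)) : False := by
  classical
  obtain ⟨j0, hj0, hj1⟩ := hc
  obtain ⟨r, hr, hmax⟩ := ((Finset.range (N + 1)).filter (fun j => ¬ f ∣ c j)).exists_max_image id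
      ⟨j0, by simp; exact ⟨by omega, hj1⟩⟩
  simp only [Finset.mem_filter, Finset.mem_range, id] at hr hmax
  have hrel2 : ∀ i, f ∣ ∑ j ∈ Finset.range (r + 1), c j * (wlD f)^[j] (h i) := by
    intro i
    have h1 := hrel i
    have hsub : Finset.range (r + 1) ⊆ Finset.range (N + 1) := by
      intro x; simp; omega
    rw [← Finset.sum_sdiff hsub] at h1
    refine (dvd_add_right (Finset.dvd_sum ?_)).mp h1
    intro j hj
    simp only [Finset.mem_sdiff, Finset.mem_range] at hj
    apply Dvd.dvd.mul_right
    by_contra hcon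
    have := hmax j ⟨hj.1, hcon⟩
    omega
  have hq : ¬ f ∣ c r * pderiv 0 f := fun hd => by
    rcases hf.prime.dvd_or_dvd hd with h1 | h1
    · exact hr.2 h1
    · exact hfy h1
  obtain ⟨P, hP1, hP2⟩ := wl_exists_point hf hq
  rw [map_mul] at hP2
  let ψ : (Fin (N + 1) → K) →ₗ[K] (Fin r → K) :=
    { toFun := fun a j => ∑ i, a i * aeval P ((wlD f)^[(j : ℕ)] (h i))
      map_add' := by intro a b; ext j; simp [add_mul, Finset.sum_add_distrib]
      map_smul' := by intro a b; ext j; simp [Finset.mul_sum, mul_assoc] }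
  have hker : LinearMap.ker ψ ≠ ⊥ := LinearMap.ker_ne_bot_of_finrank_lt (by simp; omega)
  obtain ⟨a, ha, ha0⟩ := (Submodule.ne_bot_iff _).mp hker
  set g := ∑ i, a i • h i with hg
  have hg1 := hlin a ha0
  have hgr : wlOrd (wlD f) (aeval P) r g := by
    intro j hj
    have := congrFun (LinearMap.mem_ker.mp ha) ⟨j, hj⟩
    rw [hg, wl_iter_sum, map_sum]
    simp only [wl_iter_smul, map_smul, smul_eq_mul]
    exact this
  have hgrel : f ∣ ∑ j ∈ Finset.range (r + 1), c j * (wlD f)^[j] g := by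
    have : ∑ j ∈ Finset.range (r + 1), c j * (wlD f)^[j] g =
        ∑ i, a i • ∑ j ∈ Finset.range (r + 1), c j * (wlD f)^[j] (h i) := by
      simp only [hg, wl_iter_sum, wl_iter_smul, Finset.mul_sum, Finset.smul_sum]
      rw [Finset.sum_comm]
      simp
    rw [this]
    exact Finset.dvd_sum fun i _ => (hrel2 i).trans (by rw [smul_eq_C_mul]; exact dvd_mul_left _ _)
  have hgall : ∀ M, wlOrd (wlD f) (aeval P) (r + M) g := by
    intro M
    induction M with
    | zero => exact hgr
    | succ M ih =>
      apply wlOrd_of_iter hgr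
      apply wlOrd.cancel (c := c r) (fun h0 => hP2 (by rw [h0, zero_mul]))
      obtain ⟨z, hz⟩ := hgrel
      rw [Finset.sum_range_succ] at hz
      have : c r * (wlD f)^[r] g = f * z + -(∑ j ∈ Finset.range r, c j * (wlD f)^[j] g) := by
        rw [← hz]; ring
      rw [this]
      apply wlOrd.add
      · exact (wlOrd_of_const (wlD_self f) hP1 _).mul_right z
      · apply wlOrd.neg
        apply wlOrd.sum
        intro j hj
        rw [Finset.mem_range] at hj
        apply wlOrd.mul_left
        apply wlOrd_iter
        exact ih.mono (by omega)
  have hb := wl_curve_bound_aux hf hg1 (fun _ : Unit => P) (fun _ _ _ => rfl) (fun _ => hP1) p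
    (fun j hj => wl_factorial_ne p j hj) (fun _ _ h0 => hP2 (by rw [h0, mul_zero]))
    (fun _ => (hgall p).mono (by omega))
  simp only [Fintype.card_unit, mul_one] at hb
  have hgd : g.totalDegree ≤ k := by
    rw [hg]
    apply totalDegree_finsetSum_le
    intro i _
    exact (totalDegree_smul_le _ _).trans (hdeg i)
  exact absurd (hb.trans (Nat.mul_le_mul_left f.totalDegree hgd)) (not_le.mpr hk)

/-- The Stepanov (Stöhr-Voloch) determinant. -/
noncomputable def wlG (f : MvPolynomial (Fin 2) K) {N : ℕ} (v : Fin (N + 1) → MvPolynomial (Fin 2) K)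
    (h : Fin (N + 1) → MvPolynomial (Fin 2) K) : MvPolynomial (Fin 2) K :=
  Matrix.det (Matrix.of (Fin.cons v (fun (j : Fin N) i => (wlD f)^[(j : ℕ)] (h i))) :
    Matrix (Fin (N + 1)) (Fin (N + 1)) (MvPolynomial (Fin 2) K))

theorem wlG_linear (f : MvPolynomial (Fin 2) K) {N : ℕ} (h : Fin (N + 1) → MvPolynomial (Fin 2) K) :
    ∃ w : Fin (N + 1) → MvPolynomial (Fin 2) K, ∀ v, wlG f v h = ∑ i, v i * w i := by
  refine ⟨fun i => (-1) ^ (i : ℕ) * Matrix.det (Matrix.of (fun (j : Fin N) (l : Fin N) =>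
    (wlD f)^[(j : ℕ)] (h (i.succAbove l)))), fun v => ?_⟩
  rw [wlG, Matrix.det_succ_row_zero]
  apply Finset.sum_congr rfl
  intro i _
  simp only [Matrix.of_apply, Fin.cons_zero]
  rw [mul_assoc, mul_left_comm, mul_comm ((-1) ^ (i : ℕ)), ← mul_assoc, mul_assoc, mul_comm ((-1) ^ (i : ℕ))]
  congr 2

theorem wlG_repeat (f : MvPolynomial (Fin 2) K) {N : ℕ} (h : Fin (N + 1) → MvPolynomial (Fin 2) K)
    (j : ℕ) (hj : j < N) : wlG f (fun i => (wlD f)^[j] (h i)) h = 0 := by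
  rw [wlG]
  apply Matrix.det_zero_of_row_eq (i := 0) (j := Fin.succ ⟨j, hj⟩) (Fin.succ_ne_zero _).symm
  funext i
  rw [Matrix.of_apply, Matrix.of_apply, Fin.cons_zero, Fin.cons_succ]

theorem wl_taylor {A : Type*} [CommRing A] [Algebra K A] (D : Derivation K A A) (u h : A) (c : ℕ → K)
    (hc0 : c 0 = 1) (N : ℕ) (hc : ∀ k < N, ((k + 1 : ℕ) : K) * c (k + 1) = - c k) :
    ∃ z, D (∑ j ∈ Finset.range (N + 1), c j • (u ^ j * D^[j] h)) =
      c N • (u ^ N * D^[N + 1] h) + (D u - 1) * z := by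
  induction N with
  | zero => exact ⟨0, by simp [hc0]⟩
  | succ N ih =>
    obtain ⟨z, hz⟩ := ih (fun k hk => hc k (by omega))
    rw [Finset.sum_range_succ, map_add, hz, Derivation.map_smul, Derivation.leibniz, Derivation.leibniz_pow,
      ← Function.iterate_succ_apply' (⇑D)]
    have h1 : algebraMap K A (c N) = - (((N + 1 : ℕ) : A) * algebraMap K A (c (N + 1))) := by
      have := congrArg (algebraMap K A) (hc N (by omega))
      rw [map_mul, map_natCast, map_neg] at this
      rw [this, neg_neg]
    refine ⟨z + c (N + 1) • (((N + 1 : ℕ) : A) * u ^ N * D^[N + 1] h), ?_⟩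
    simp only [smul_eq_mul, nsmul_eq_mul, Nat.add_sub_cancel]
    simp only [Algebra.smul_def, h1]
    change _ + _ * (_ * D^[N + 1 + 1] h + _) = _
    ring

theorem wl_expand_const (p : ℕ) [CharP K p] (f h : MvPolynomial (Fin 2) K) :
    wlD f (expand p h) = 0 := by
  induction h using MvPolynomial.induction_on with
  | C a => rw [expand_C]; exact (wlD f).map_algebraMap a
  | add a b ha hb => rw [map_add, map_add, ha, hb, add_zero]
  | mul_X a i ha =>
    rw [map_mul, Derivation.leibniz, ha, expand_X, Derivation.leibniz_pow]
    have : (p : MvPolynomial (Fin 2) K) = 0 := by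
      rw [← map_natCast (C : K →+* MvPolynomial (Fin 2) K), CharP.cast_eq_zero, map_zero]
    simp [nsmul_eq_mul, this]

theorem wlG_ord (p : ℕ) [Fact p.Prime] [CharP K p]
    {f : MvPolynomial (Fin 2) K} {N : ℕ} (h : Fin (N + 1) → MvPolynomial (Fin 2) K)
    (hN : N + 1 ≤ p) (P : Fin 2 → K) (hfP : aeval P f = 0) (hs : aeval P (pderiv 0 f) ≠ 0)
    (hP : ∀ i, P i ^ p = P i) :
    wlOrd (wlD f) (aeval P) N (wlG f (fun i => expand p (h i)) h) := by
  cases N with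
  | zero => exact wlOrd_zero _
  | succ N =>
  obtain ⟨w, hw⟩ := wlG_linear f h
  -- a local parameter with `D u = 1` to high order
  have hsur := wl_jets_surjective (wlD f) (fun _ : Unit => (aeval P : MvPolynomial (Fin 2) K →ₐ[K] K)) (N + 2)
    (fun j hj => wl_factorial_ne p j (by omega)) (fun i i' h => absurd rfl h)
    (fun i => ⟨X 1 - C (P 1), by simp, fun h => by
      rw [wlD_apply]
      simpa using hs⟩)
  obtain ⟨u, hu⟩ := hsur (fun q => if (q.2 : ℕ) = 1 then 1 else 0)
  have hu' : ∀ j < N + 2, aeval P ((wlD f)^[j] u) = if j = 1 then (1 : K) else 0 := by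
    intro j hj
    have := congrFun hu ((), ⟨j, hj⟩)
    rw [wl_iter_eq]
    exact this
  have hu0 : aeval P u = 0 := by simpa using hu' 0 (by omega)
  have hDu : wlOrd (wlD f) (aeval P) (N + 1) (wlD f u - 1) := by
    rw [sub_eq_add_neg, wlOrd_succ]
    refine ⟨?_, ?_⟩
    · have := hu' 1 (by omega)
      simp at this
      simp [this]
    · intro j hj
      rw [map_add, wl_iter_add, map_neg, Derivation.map_one_eq_zero, neg_zero, wl_iter_zero, add_zero,
        ← Function.iterate_succ_apply, ← Function.iterate_succ_apply, hu' _ (by omega)]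
      simp
  set c : ℕ → K := fun k => (-1) ^ k / (k.factorial : K) with hc
  have hcc : ∀ k < N, ((k + 1 : ℕ) : K) * c (k + 1) = - c k := by
    intro k hk
    have h1 := wl_factorial_ne (K := K) p k (by omega)
    have h2 := wl_factorial_ne (K := K) p (k + 1) (by omega)
    have h3 : ((k + 1 : ℕ) : K) ≠ 0 := by
      intro h0; apply h2; rw [Nat.factorial_succ, Nat.cast_mul, h0, zero_mul]
    simp only [hc, Nat.factorial_succ, Nat.cast_mul]
    field_simp
    ring
  set S : Fin (N + 1 + 1) → MvPolynomial (Fin 2) K :=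
    fun i => ∑ j ∈ Finset.range (N + 1), c j • (u ^ j * (wlD f)^[j] (h i)) with hS
  have hSw : ∑ i, S i * w i = 0 := by
    simp only [hS, Finset.sum_mul]
    rw [Finset.sum_comm]
    apply Finset.sum_eq_zero
    intro j hj
    rw [Finset.mem_range] at hj
    have := wlG_repeat f h j hj
    rw [hw] at this
    have h2 : ∑ i, c j • (u ^ j * (wlD f)^[j] (h i)) * w i =
        (c j • u ^ j) * ∑ i, (wlD f)^[j] (h i) * w i := by
      rw [Finset.mul_sum]
      apply Finset.sum_congr rfl
      intro i _
      simp only [smul_mul_assoc, mul_assoc]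
    rw [h2, this, mul_zero]
  have hG : wlG f (fun i => expand p (h i)) h = ∑ i, (expand p (h i) - S i) * w i := by
    rw [hw]
    simp only [sub_mul, Finset.sum_sub_distrib, hSw, sub_zero]
  rw [hG]
  apply wlOrd.sum
  intro i _
  apply wlOrd.mul_right
  rw [wlOrd_succ]
  refine ⟨?_, ?_⟩
  · have h1 : aeval P (expand p (h i)) = aeval P (h i) := by
      rw [aeval_expand]
      congr 2
      funext j
      simp [hP]
    have h2 : aeval P (S i) = aeval P (h i) := by
      simp only [hS]
      rw [map_sum, Finset.sum_eq_single 0]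
      · simp [hc]
      · intro j _ hj
        rw [map_smul, map_mul, map_pow, hu0, zero_pow hj, zero_mul, smul_zero]
      · simp
    rw [map_sub, h1, h2, sub_self]
  · rw [map_sub, wl_expand_const, zero_sub]
    apply wlOrd.neg
    obtain ⟨z, hz⟩ := wl_taylor (wlD f) u (h i) c (by simp [hc]) N hcc
    simp only [hS]
    rw [hz]
    apply wlOrd.add
    · rw [← smul_mul_assoc]
      apply wlOrd.mul_right
      rw [smul_eq_C_mul]
      exact (wlOrd.pow hu0 N).mul_left _
    · exact (hDu.mono (by omega)).mul_right z

end stepanov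


section stepanov2
variable {K : Type*} [Field K]

theorem wlG_not_dvd [IsAlgClosed K] (p : ℕ) [Fact p.Prime] [CharP K p]
    {f : MvPolynomial (Fin 2) K} (hf : Irreducible f) (hfy : ¬ f ∣ pderiv 0 f)
    (k N : ℕ) (h : Fin (N + 1) → MvPolynomial (Fin 2) K)
    (hlin : ∀ c : Fin (N + 1) → K, c ≠ 0 → ¬ f ∣ ∑ i, c i • h i)
    (hdeg : ∀ i, (h i).totalDegree ≤ k) (hk : f.totalDegree * k < p)
    (h1 : ∃ i, h i = 1) :
    ¬ f ∣ wlG f (fun i => expand p (h i)) h := by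
  classical
  intro hd
  have hp : (Ideal.span {f}).IsPrime := (Ideal.span_singleton_prime hf.ne_zero).mpr hf.prime
  let π := Ideal.Quotient.mk (Ideal.span {f})
  have hπ : ∀ a, π a = 0 ↔ f ∣ a := fun a => by
    rw [Ideal.Quotient.eq_zero_iff_mem, Ideal.mem_span_singleton]
  have hdet : (π.mapMatrix (Matrix.of (Fin.cons (fun i => expand p (h i))
      (fun (j : Fin N) i => (wlD f)^[(j : ℕ)] (h i))))).det = 0 := by
    rw [← RingHom.map_det]; exact (hπ _).mpr hd
  obtain ⟨v, hv0, hv⟩ := Matrix.exists_vecMul_eq_zero_iff.mpr hdet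
  choose c hc using fun i => Ideal.Quotient.mk_surjective (v i)
  have hrel : ∀ i, f ∣ c 0 * expand p (h i) + ∑ j : Fin N, c j.succ * (wlD f)^[(j : ℕ)] (h i) := by
    intro i
    rw [← hπ]
    have := congrFun hv i
    rw [Matrix.vecMul, dotProduct, Fin.sum_univ_succ] at this
    simp only [map_add, map_mul, map_sum]
    simp only [← hc] at this
    exact this
  set c' : ℕ → MvPolynomial (Fin 2) K := fun j => if hj : j < N then c (Fin.succ ⟨j, hj⟩) else 0 with hc'
  have hc'j : ∀ j : Fin N, c' j = c j.succ := fun j => by simp only [hc', j.2, dif_pos]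
  have hc'N : ∀ j, N ≤ j → c' j = 0 := fun j hj => by simp [hc', hj]
  have hrel' : ∀ i, f ∣ c 0 * expand p (h i) + ∑ j ∈ Finset.range (N + 1), c' j * (wlD f)^[j] (h i) := by
    intro i
    have := hrel i
    rw [Finset.sum_range_succ, hc'N N le_rfl, zero_mul, add_zero, Finset.sum_range]
    simpa only [hc'j] using this
  have hnz : ¬ f ∣ c 0 ∨ ∃ j, ¬ f ∣ c' j := by
    by_contra hcon
    push Not at hcon
    apply hv0
    funext i
    rw [← hc, Pi.zero_apply]
    apply (hπ _).mpr
    refine Fin.cases hcon.1 (fun j => ?_) i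
    rw [← hc'j]; exact hcon.2 j
  by_cases h0 : f ∣ c 0
  · obtain ⟨j, hj⟩ := hnz.resolve_left (not_not.mpr h0)
    have hjN : j < N := by
      by_contra hcon
      exact hj (by rw [hc'N j (by omega)]; exact dvd_zero _)
    exact wl_no_relation p hf hfy k N h hlin hdeg hk c' ⟨j, by omega, hj⟩
      (fun i => (dvd_add_right (h0.mul_right _)).mp (hrel' i))
  · by_cases hall : ∀ j, f ∣ c' j
    · obtain ⟨i, hi⟩ := h1
      have h2 := (dvd_add_left (Finset.dvd_sum fun j _ => (hall j).mul_right _)).mp (hrel' i)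
      rw [hi, map_one, mul_one] at h2
      exact h0 h2
    · push Not at hall
      obtain ⟨j0, hj0⟩ := hall
      have hlt : ∀ j, ¬ f ∣ c' j → j < N := fun j hj => by
        by_contra hcon
        exact hj (by rw [hc'N j (by omega)]; exact dvd_zero _)
      obtain ⟨r, hr, hmax⟩ := ((Finset.range N).filter (fun j => ¬ f ∣ c' j)).exists_max_image id
        ⟨j0, by simp; exact ⟨hlt _ hj0, hj0⟩⟩
      simp only [Finset.mem_filter, Finset.mem_range, id] at hr hmax
      have hr1 : f ∣ c' (r + 1) := by
        by_contra hcon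
        have := hmax (r + 1) ⟨hlt _ hcon, hcon⟩
        omega
      set e : ℕ → MvPolynomial (Fin 2) K := fun j =>
        c 0 * wlD f (c' j) - wlD f (c 0) * c' j + c 0 * (if j = 0 then 0 else c' (j - 1)) with he
      apply wl_no_relation p hf hfy k N h hlin hdeg hk e
      · refine ⟨r + 1, by omega, fun hd => ?_⟩
        have h3 : f ∣ c 0 * wlD f (c' (r + 1)) - wlD f (c 0) * c' (r + 1) :=
          dvd_sub ((wlD_dvd hr1).mul_left _) (hr1.mul_left _)
        have h4 := (dvd_add_right h3).mp hd
        simp only [Nat.add_eq_zero_iff, one_ne_zero, and_false, if_false, Nat.add_sub_cancel] at h4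
        rcases hf.prime.dvd_or_dvd h4 with h5 | h5
        · exact h0 h5
        · exact hr.2 h5
      · intro i
        have h5 := dvd_sub ((wlD_dvd (hrel' i)).mul_left (c 0)) ((hrel' i).mul_left (wlD f (c 0)))
        convert h5 using 1
        rw [map_add, Derivation.leibniz, wl_expand_const, map_sum]
        simp only [Derivation.leibniz, smul_eq_mul, ← Function.iterate_succ_apply' (⇑(wlD f))]
        simp only [he, add_mul, sub_mul, mul_add, Finset.sum_add_distrib, Finset.sum_sub_distrib, Finset.mul_sum]
        have hshift : ∑ j ∈ Finset.range (N + 1), c 0 * (if j = 0 then 0 else c' (j - 1)) * (wlD f)^[j] (h i)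
            = ∑ j ∈ Finset.range (N + 1), c 0 * (c' j * (wlD f)^[j.succ] (h i)) := by
          rw [Finset.sum_range_succ', Finset.sum_range_succ (n := N), hc'N N le_rfl]
          simp [mul_assoc]
        rw [hshift]
        have e1 : ∑ j ∈ Finset.range (N + 1), c 0 * (wlD f) (c' j) * (wlD f)^[j] (h i) =
          ∑ j ∈ Finset.range (N + 1), c 0 * ((wlD f)^[j] (h i) * (wlD f) (c' j)) :=
          Finset.sum_congr rfl fun j _ => by ring
        have e2 : ∑ j ∈ Finset.range (N + 1), (wlD f) (c 0) * c' j * (wlD f)^[j] (h i) =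
          ∑ j ∈ Finset.range (N + 1), (wlD f) (c 0) * (c' j * (wlD f)^[j] (h i)) :=
          Finset.sum_congr rfl fun j _ => by ring
        rw [e1, e2]
        ring

theorem wl_totalDegree_pderiv {R : Type*} [CommRing R] {σ : Type*} (i : σ) (h : MvPolynomial σ R) :
    (pderiv i h).totalDegree ≤ h.totalDegree - 1 := by
  classical
  apply Finset.sup_le
  intro m hm
  rw [mem_support_iff, coeff_pderiv] at hm
  have h2 : m + Finsupp.single i 1 ∈ h.support := by
    rw [mem_support_iff]
    intro h0
    apply hm
    rw [h0]; simp
  have h3 := le_totalDegree h2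
  rw [Finsupp.sum_add_index' (by simp) (by simp), Finsupp.sum_single_index rfl] at h3
  omega

theorem wlD_totalDegree {R : Type*} [CommRing R] (f h : MvPolynomial (Fin 2) R) :
    (wlD f h).totalDegree ≤ h.totalDegree + f.totalDegree := by
  rw [wlD_apply]
  refine (totalDegree_sub _ _).trans (max_le ?_ ?_)
  · refine (totalDegree_mul _ _).trans ?_
    have := wl_totalDegree_pderiv 0 f
    have := wl_totalDegree_pderiv 1 h
    omega
  · refine (totalDegree_mul _ _).trans ?_
    have := wl_totalDegree_pderiv 1 f
    have := wl_totalDegree_pderiv 0 h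
    omega

theorem wlD_iter_totalDegree {R : Type*} [CommRing R] (f h : MvPolynomial (Fin 2) R) (j : ℕ) :
    ((wlD f)^[j] h).totalDegree ≤ h.totalDegree + j * f.totalDegree := by
  induction j with
  | zero => simp
  | succ j ih =>
    rw [Function.iterate_succ_apply']
    have := wlD_totalDegree f ((wlD f)^[j] h)
    rw [add_mul]
    omega

theorem wl_totalDegree_det {R σ : Type*} [CommRing R] {n : ℕ}
    (A : Matrix (Fin n) (Fin n) (MvPolynomial σ R)) (b : Fin n → ℕ)
    (hb : ∀ i j, (A i j).totalDegree ≤ b i) : A.det.totalDegree ≤ ∑ i, b i := by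
  rw [← Matrix.det_transpose, Matrix.det_apply]
  apply totalDegree_finsetSum_le
  intro τ _
  rw [Units.smul_def, zsmul_eq_mul]
  refine (totalDegree_mul _ _).trans ?_
  have h0 : ((Equiv.Perm.sign τ : ℤ) : MvPolynomial σ R).totalDegree = 0 := by
    rw [← map_intCast (C : R →+* MvPolynomial σ R)]; exact totalDegree_C _
  rw [h0, zero_add]
  refine (totalDegree_finsetProd _ _).trans ?_
  exact Finset.sum_le_sum fun i _ => hb _ _

theorem wlG_totalDegree (p : ℕ) {f : MvPolynomial (Fin 2) K}
    (k N : ℕ) (h : Fin (N + 1) → MvPolynomial (Fin 2) K) (hdeg : ∀ i, (h i).totalDegree ≤ k) :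
    (wlG f (fun i => expand p (h i)) h).totalDegree ≤ p * k + N * k + N * N * f.totalDegree := by
  refine (wl_totalDegree_det _ (Fin.cons (p * k) (fun j : Fin N => k + N * f.totalDegree)) ?_).trans ?_
  · intro i j
    refine Fin.cases ?_ (fun i => ?_) i
    · simp only [Matrix.of_apply, Fin.cons_zero]
      rw [totalDegree_expand, mul_comm]
      exact Nat.mul_le_mul_left _ (hdeg j)
    · simp only [Matrix.of_apply, Fin.cons_succ]
      refine (wlD_iter_totalDegree f (h j) i).trans ?_
      exact Nat.add_le_add (hdeg j) (Nat.mul_le_mul_right _ i.2.le)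
  · rw [Fin.sum_univ_succ]
    simp
    apply le_of_eq; ring

theorem wl_stepanov [IsAlgClosed K] (p : ℕ) [Fact p.Prime] [CharP K p]
    {f : MvPolynomial (Fin 2) K} (hf : Irreducible f) (hfy : ¬ f ∣ pderiv 0 f)
    (k N : ℕ) (h : Fin (N + 1) → MvPolynomial (Fin 2) K)
    (hlin : ∀ c : Fin (N + 1) → K, c ≠ 0 → ¬ f ∣ ∑ i, c i • h i)
    (hdeg : ∀ i, (h i).totalDegree ≤ k) (hk : f.totalDegree * k < p)
    (h1 : ∃ i, h i = 1) (hN : N + 1 ≤ p)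
    {ι : Type*} [Fintype ι] (P : ι → Fin 2 → K) (hPinj : Function.Injective P)
    (hfP : ∀ i, aeval (P i) f = 0) (hs : ∀ i, aeval (P i) (pderiv 0 f) ≠ 0)
    (hP : ∀ i j, P i j ^ p = P i j) :
    N * Fintype.card ι ≤ f.totalDegree * (p * k + N * k + N * N * f.totalDegree) := by
  refine (wl_curve_bound_aux hf (wlG_not_dvd p hf hfy k N h hlin hdeg hk h1) P hPinj hfP N
    (fun j hj => wl_factorial_ne p j (by omega)) (fun _ => hs)
    (fun i => wlG_ord p h hN (P i) (hfP i) (hs i) (hP i))).trans ?_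
  exact Nat.mul_le_mul_left _ (wlG_totalDegree p k N h hdeg)

theorem wl_not_dvd_of_degreeOf {R : Type*} [CommRing R] [IsDomain R] {σ : Type*} (i : σ) {f q : MvPolynomial σ R}
    (hq : q ≠ 0) (h : q.degreeOf i < f.degreeOf i) : ¬ f ∣ q := by
  rintro ⟨z, rfl⟩
  have hf : f ≠ 0 := left_ne_zero_of_mul hq
  have hz : z ≠ 0 := right_ne_zero_of_mul hq
  rw [degreeOf_mul_eq hf hz] at h
  omega

theorem wl_not_dvd_of_totalDegree {R : Type*} [CommRing R] [IsDomain R] {σ : Type*} {f q : MvPolynomial σ R}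
    (hq : q ≠ 0) (h : q.totalDegree < f.totalDegree) : ¬ f ∣ q := by
  rintro ⟨z, rfl⟩
  have hf : f ≠ 0 := left_ne_zero_of_mul hq
  have hz : z ≠ 0 := right_ne_zero_of_mul hq
  rw [totalDegree_mul_of_isDomain hf hz] at h
  omega

/-- The monomial `y^a x^b`. -/
noncomputable def wlE (a b : ℕ) : Fin 2 →₀ ℕ := Finsupp.single 0 a + Finsupp.single 1 b

theorem wlE_0 (a b : ℕ) : wlE a b 0 = a := by simp [wlE]
theorem wlE_1 (a b : ℕ) : wlE a b 1 = b := by simp [wlE]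

theorem wl_pos_of_irreducible {σ : Type*} {f : MvPolynomial σ K} (hf : Irreducible f) : 1 ≤ f.totalDegree := by
  by_contra h
  have h0 : f.totalDegree = 0 := by omega
  rw [totalDegree_eq_zero_iff_eq_C] at h0
  apply hf.not_isUnit
  rw [h0]
  apply IsUnit.map
  rw [isUnit_iff_ne_zero]
  intro h1
  rw [h1, map_zero] at h0
  exact hf.ne_zero h0

theorem wl_pderiv_ne {σ : Type*} (p : ℕ) [Fact p.Prime] [CharP K p] {f : MvPolynomial σ K} (i : σ) (d : ℕ)
    (hd : 1 ≤ d) (hdp : d < p) (hc : coeff (Finsupp.single i d) f ≠ 0) : pderiv i f ≠ 0 := by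
  intro h0
  have := congrArg (coeff (Finsupp.single i (d - 1))) h0
  rw [coeff_pderiv, coeff_zero, ← Finsupp.single_add, Nat.sub_add_cancel hd] at this
  rcases mul_eq_zero.mp this with h | h
  · exact hc h
  · have h' : ((d : ℕ) : K) = 0 := by
      rw [← h]; simp
      rw [← Nat.cast_succ, Nat.succ_eq_add_one, Nat.sub_add_cancel hd]
    rw [CharP.cast_eq_zero_iff K p] at h'
    exact absurd (Nat.le_of_dvd (by omega) h') (by omega)

theorem wl_plane_arith (p d s N n1 : ℕ) (hd1 : 1 ≤ d) (hsN : s ≤ N) (hN2 : N ≤ 2 * s)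
    (hs2 : p < (s + 1) * (s + 1)) (hs0 : 1 ≤ s)
    (hst : N * n1 ≤ (p + N) * (d ^ 2 + (N + 1)) + d ^ 2 * N * N) : n1 ≤ p + 14 * d ^ 2 * s := by
  have hd2 : 1 ≤ d ^ 2 := Nat.one_le_pow _ _ hd1
  have hp4 : p ≤ 4 * s * N := by nlinarith
  apply Nat.le_of_mul_le_mul_left _ (show 0 < N by omega)
  have a1 : p * (d ^ 2 + 1) ≤ 8 * d ^ 2 * s * N := by
    calc p * (d ^ 2 + 1) ≤ (4 * s * N) * (d ^ 2 + d ^ 2) := Nat.mul_le_mul hp4 (by omega)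
      _ = _ := by ring
  have a2 : d ^ 2 + 1 ≤ 2 * d ^ 2 * s := by nlinarith
  have a3 : N ≤ 2 * d ^ 2 * s := by nlinarith
  have a4 : d ^ 2 * N ≤ 2 * d ^ 2 * s := by nlinarith
  calc N * n1 ≤ _ := hst
    _ = N * p + p * (d ^ 2 + 1) + N * ((d ^ 2 + 1) + N + d ^ 2 * N) := by ring
    _ ≤ N * p + 8 * d ^ 2 * s * N + N * (2 * d ^ 2 * s + 2 * d ^ 2 * s + 2 * d ^ 2 * s) := by
        gcongr
    _ = N * (p + 14 * d ^ 2 * s) := by ring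

/-- The Weil upper bound for plane curves. -/
theorem wl_plane_count [IsAlgClosed K] (p : ℕ) [Fact p.Prime] [CharP K p]
    {f : MvPolynomial (Fin 2) K} (hf : Irreducible f) (d : ℕ) (hd : f.totalDegree = d)
    (hc : coeff (Finsupp.single 0 d) f ≠ 0) (hp : 16 * d ^ 4 ≤ p)
    (S : Finset (Fin 2 → K)) (hS : ∀ P ∈ S, aeval P f = 0 ∧ ∀ j, P j ^ p = P j) :
    S.card ≤ p + 15 * d ^ 2 * Nat.sqrt p := by
  classical
  have hd1 : 1 ≤ d := hd ▸ wl_pos_of_irreducible hf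
  have hd4 : d ≤ d ^ 4 := Nat.le_self_pow (by norm_num) d
  have hfy0 := wl_pderiv_ne p 0 d hd1 (by omega) hc
  have hfydeg := wl_totalDegree_pderiv 0 f
  have hfy : ¬ f ∣ pderiv 0 f := wl_not_dvd_of_totalDegree hfy0 (by omega)
  have hdd : d ≤ f.degreeOf 0 := by
    have := monomial_le_degreeOf (0 : Fin 2) (mem_support_iff.mpr hc)
    simpa using this
  set s := Nat.sqrt p with hs
  have hs1 : s * s ≤ p := Nat.sqrt_le p
  have hs2 : p < (s + 1) * (s + 1) := Nat.lt_succ_sqrt p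
  have hs3 : 4 * d ^ 2 ≤ s := by
    rw [hs, Nat.le_sqrt]; nlinarith
  have hdsq : d ≤ d ^ 2 := Nat.le_self_pow (by norm_num) d
  set l := s / d + 1 with hl
  have hl1 : s < d * l := Nat.lt_mul_div_succ s (by omega)
  have hl2 : d * l ≤ s + d := by
    rw [hl, mul_add, mul_one]
    have := Nat.mul_div_le s d
    omega
  obtain ⟨N, hN⟩ : ∃ N, d * l = N + 1 := ⟨d * l - 1, by omega⟩
  let eqv : Fin (N + 1) ≃ Fin d × Fin l := (finCongr hN.symm).trans finProdFinEquiv.symm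
  let h : Fin (N + 1) → MvPolynomial (Fin 2) K := fun i => monomial (wlE (eqv i).1 (eqv i).2) 1
  have hEinj : Function.Injective (fun i => wlE (eqv i).1 (eqv i).2) := by
    intro i j hij
    apply eqv.injective
    have h0 := DFunLike.congr_fun hij 0
    have h1 := DFunLike.congr_fun hij 1
    simp only [wlE_0, wlE_1] at h0 h1
    ext
    · exact h0
    · exact h1
  have hlin : ∀ c : Fin (N + 1) → K, c ≠ 0 → ¬ f ∣ ∑ i, c i • h i := by
    intro c hc0
    obtain ⟨i0, hi0⟩ := Function.ne_iff.mp hc0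
    have hcoef : ∀ m, coeff m (∑ i, c i • h i) = ∑ i, if wlE (eqv i).1 (eqv i).2 = m then c i else 0 := by
      intro m
      simp only [coeff_sum, coeff_smul, h, coeff_monomial, smul_eq_mul, mul_ite, mul_one, mul_zero]
    apply wl_not_dvd_of_degreeOf 0
    · intro h0
      have := hcoef (wlE (eqv i0).1 (eqv i0).2)
      rw [h0, coeff_zero, Finset.sum_eq_single i0] at this
      · simp at this; exact hi0 this.symm
      · intro j _ hj
        rw [if_neg]
        exact fun h => hj (hEinj h)
      · simp
    · refine lt_of_lt_of_le ?_ hdd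
      rw [degreeOf_lt_iff (by omega)]
      intro m hm
      rw [mem_support_iff, hcoef] at hm
      obtain ⟨i, _, hi⟩ := Finset.exists_ne_zero_of_sum_ne_zero hm
      have : wlE (eqv i).1 (eqv i).2 = m := by
        by_contra h; rw [if_neg h] at hi; exact hi rfl
      rw [← this, wlE_0]
      exact (eqv i).1.2
  have hdeg : ∀ i, (h i).totalDegree ≤ d + l := by
    intro i
    refine (totalDegree_monomial_le _ _).trans ?_
    rw [Finsupp.sum_fintype _ _ (by simp)]
    simp [wlE_0, wlE_1]
    have := (eqv i).1.2
    have := (eqv i).2.2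
    omega
  have h1 : ∃ i, h i = 1 := by
    refine ⟨eqv.symm (⟨0, by omega⟩, ⟨0, Nat.succ_pos _⟩), ?_⟩
    simp [h, wlE]
  have hdk : d * (d + l) = d ^ 2 + (N + 1) := by rw [mul_add, hN]; ring
  have hss : 4 * s ≤ s * s := Nat.mul_le_mul_right s (by nlinarith)
  have hst := wl_stepanov p hf hfy (d + l) N h hlin hdeg (by rw [hd, hdk]; omega) h1 (by omega)
    (ι := {P // P ∈ S.filter (fun P => aeval P (pderiv 0 f) ≠ 0)}) (fun P => P.1) Subtype.val_injective
    (fun P => (hS _ (Finset.mem_filter.mp P.2).1).1) (fun P => (Finset.mem_filter.mp P.2).2)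
    (fun P => (hS _ (Finset.mem_filter.mp P.2).1).2)
  have hcz := wl_common_zeros hf hfy
    (ι := {P // P ∈ S.filter (fun P => ¬ aeval P (pderiv 0 f) ≠ 0)}) (fun P => P.1) Subtype.val_injective
    (fun P => (hS _ (Finset.mem_filter.mp P.2).1).1) (fun P => not_not.mp (Finset.mem_filter.mp P.2).2)
  rw [Fintype.card_coe, hd] at hst hcz
  rw [← Finset.card_filter_add_card_filter_not (s := S) (fun P => aeval P (pderiv 0 f) ≠ 0)]
  set n1 := (S.filter (fun P => aeval P (pderiv 0 f) ≠ 0)).card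
  set n2 := (S.filter (fun P => ¬ aeval P (pderiv 0 f) ≠ 0)).card
  have hn2 : n2 ≤ d ^ 2 := by
    refine hcz.trans ?_
    rw [sq]; exact Nat.mul_le_mul_left _ (by omega)
  have hn1 : n1 ≤ p + 14 * d ^ 2 * s := by
    have e : d * (p * (d + l) + N * (d + l) + N * N * d) = (p + N) * (d * (d + l)) + d ^ 2 * N * N := by ring
    rw [e, hdk] at hst
    exact wl_plane_arith p d s N n1 hd1 (by omega) (by omega) hs2 (by nlinarith) hst
  have hs0 : 1 ≤ s := by nlinarith
  have : d ^ 2 * 1 ≤ d ^ 2 * s := Nat.mul_le_mul_left _ hs0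
  calc n1 + n2 ≤ p + 14 * d ^ 2 * s + d ^ 2 * s := by omega
    _ = _ := by ring

end stepanov2


section slice
variable {K : Type*} [Field K] {M : ℕ}

/-- Restriction of `f(y, x)` to the plane `x = x0 + t w`. -/
noncomputable def wlSlice {S : Type*} [CommRing S] [Algebra K S] (x0 w : Fin M → S)
    (f : MvPolynomial (Fin (M + 1)) K) : MvPolynomial (Fin 2) S :=
  aeval (Fin.cons (X 0) (fun i => C (x0 i) + C (w i) * X 1) : Fin (M + 1) → MvPolynomial (Fin 2) S) f

theorem wlSlice_map {S S' : Type*} [CommRing S] [Algebra K S] [CommRing S'] [Algebra K S']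
    (φ : S →ₐ[K] S') (x0 w : Fin M → S) (f : MvPolynomial (Fin (M + 1)) K) :
    map (φ : S →+* S') (wlSlice x0 w f) = wlSlice (fun i => φ (x0 i)) (fun i => φ (w i)) f := by
  unfold wlSlice
  induction f using MvPolynomial.induction_on with
  | C a =>
    simp only [algHom_C, MvPolynomial.algebraMap_apply, map_C]
    congr 1
    exact φ.commutes a
  | add a b ha hb => simp only [map_add, ha, hb]
  | mul_X a i ha =>
    simp only [map_mul, ha, aeval_X]
    congr 1
    refine Fin.cases ?_ (fun i => ?_) i
    · simp
    · simp

/-- substitution of the base variables -/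
noncomputable def wlTheta {S : Type*} [CommRing S] [Algebra K S] (x0 w : Fin M → S) :
    MvPolynomial (Fin M) K →ₐ[K] MvPolynomial (Fin 1) S :=
  aeval (fun i => C (x0 i) + C (w i) * X 0)

theorem wlSlice_finSucc {S : Type*} [CommRing S] [Algebra K S] (x0 w : Fin M → S)
    (f : MvPolynomial (Fin (M + 1)) K) :
    finSuccEquiv S 1 (wlSlice x0 w f) =
      (finSuccEquiv K M f).map (wlTheta (K := K) x0 w : MvPolynomial (Fin M) K →+* MvPolynomial (Fin 1) S) := by
  unfold wlSlice
  induction f using MvPolynomial.induction_on with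
  | C a =>
    rw [algHom_C, MvPolynomial.algebraMap_apply]
    simp only [finSuccEquiv_comp_C_eq_C, finSuccEquiv_apply, eval₂Hom_C, RingHom.coe_comp, Function.comp_apply, Polynomial.map_C]
    congr 1
    simp [wlTheta]
  | add a b ha hb => simp only [map_add, ha, hb, Polynomial.map_add]
  | mul_X a i ha =>
    simp only [map_mul, ha, aeval_X, Polynomial.map_mul]
    congr 1
    refine Fin.cases ?_ (fun i => ?_) i
    · simp [finSuccEquiv_X_zero]
    · have : (1 : Fin 2) = Fin.succ 0 := rfl
      simp only [Fin.cons_succ, map_add, map_mul, this, finSuccEquiv_X_succ, Polynomial.map_C]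
      simp [wlTheta, finSuccEquiv_apply]

theorem wl_finSucc_coeff_top {d : ℕ} {f : MvPolynomial (Fin (M + 1)) K} (hd : f.totalDegree ≤ d)
    (hc : coeff (Finsupp.single 0 d) f = 1) : (finSuccEquiv K M f).coeff d = 1 := by
  ext m
  rw [finSuccEquiv_coeff_coeff]
  by_cases hm : m = 0
  · subst hm
    have : Finsupp.cons d (0 : Fin M →₀ ℕ) = Finsupp.single 0 d := by
      ext i
      refine Fin.cases ?_ (fun i => ?_) i
      · simp
      · simp
    rw [this, hc]; simp
  · rw [coeff_one, if_neg (Ne.symm hm)]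
    by_contra h0
    have := le_totalDegree (mem_support_iff.mpr h0)
    rw [wl_sum_eq_univ, Fin.sum_univ_succ] at this
    simp only [Finsupp.cons_zero, Finsupp.cons_succ] at this
    apply hm
    ext i
    have h2 : m i ≤ ∑ i, m i := Finset.single_le_sum (f := fun i => m i) (fun _ _ => Nat.zero_le _) (Finset.mem_univ i)
    simp only [Finsupp.coe_zero, Pi.zero_apply]
    omega

theorem wl_finSucc_natDegree {d : ℕ} {f : MvPolynomial (Fin (M + 1)) K} (hd : f.totalDegree ≤ d) :
    (finSuccEquiv K M f).natDegree ≤ d := by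
  rw [natDegree_finSuccEquiv]
  exact (degreeOf_le_totalDegree f 0).trans hd

theorem wl_finSucc_monic {d : ℕ} {f : MvPolynomial (Fin (M + 1)) K} (hd : f.totalDegree ≤ d)
    (hc : coeff (Finsupp.single 0 d) f = 1) : (finSuccEquiv K M f).Monic :=
  Polynomial.monic_of_natDegree_le_of_coeff_eq_one d (wl_finSucc_natDegree hd) (wl_finSucc_coeff_top hd hc)

theorem wlSlice_coeff {S : Type*} [CommRing S] [Algebra K S] (x0 w : Fin M → S)
    {d : ℕ} {f : MvPolynomial (Fin (M + 1)) K} (hd : f.totalDegree ≤ d)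
    (hc : coeff (Finsupp.single 0 d) f = 1) : coeff (Finsupp.single 0 d) (wlSlice x0 w f) = 1 := by
  have : (Finsupp.single 0 d : Fin 2 →₀ ℕ) = Finsupp.cons d (0 : Fin 1 →₀ ℕ) := by
    ext i
    refine Fin.cases ?_ (fun i => ?_) i
    · simp
    · simp
  rw [this, ← finSuccEquiv_coeff_coeff, wlSlice_finSucc, Polynomial.coeff_map, wl_finSucc_coeff_top hd hc]
  simp

theorem wl_totalDegree_aeval_le {σ τ S : Type*} [CommRing S] [Algebra K S] (v : σ → MvPolynomial τ S)
    (hv : ∀ i, (v i).totalDegree ≤ 1) (f : MvPolynomial σ K) : (aeval v f).totalDegree ≤ f.totalDegree := by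
  rw [aeval_def, eval₂_eq]
  apply totalDegree_finsetSum_le
  intro m hm
  refine (totalDegree_mul _ _).trans ?_
  rw [MvPolynomial.algebraMap_apply, totalDegree_C, zero_add]
  refine (totalDegree_finsetProd _ _).trans (le_trans ?_ (le_totalDegree hm))
  apply Finset.sum_le_sum
  intro i _
  refine (totalDegree_pow _ _).trans ?_
  calc m i * (v i).totalDegree ≤ m i * 1 := Nat.mul_le_mul_left _ (hv i)
    _ = m i := mul_one _

theorem wlSlice_totalDegree_le {S : Type*} [CommRing S] [Algebra K S] (x0 w : Fin M → S)
    (f : MvPolynomial (Fin (M + 1)) K) : (wlSlice x0 w f).totalDegree ≤ f.totalDegree := by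
  apply wl_totalDegree_aeval_le
  refine Fin.cases ?_ (fun i => ?_)
  · simp only [Fin.cons_zero]
    exact (totalDegree_monomial_le _ _).trans (by simp)
  · simp only [Fin.cons_succ]
    refine (totalDegree_add _ _).trans (max_le (by simp) ?_)
    refine (totalDegree_mul _ _).trans ?_
    rw [totalDegree_C, zero_add]
    exact (totalDegree_monomial_le _ _).trans (by simp)

theorem wlSlice_totalDegree {S : Type*} [CommRing S] [Nontrivial S] [Algebra K S] (x0 w : Fin M → S)
    {d : ℕ} {f : MvPolynomial (Fin (M + 1)) K} (hd : f.totalDegree = d)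
    (hc : coeff (Finsupp.single 0 d) f = 1) : (wlSlice x0 w f).totalDegree = d := by
  apply le_antisymm ((wlSlice_totalDegree_le x0 w f).trans hd.le)
  have := le_totalDegree (p := wlSlice x0 w f) (s := Finsupp.single 0 d)
    (by rw [mem_support_iff, wlSlice_coeff x0 w hd.le hc]; exact one_ne_zero)
  simpa using this

/-- the generic slice is irreducible -/
theorem wlSlice_generic_irreducible {d : ℕ} {f : MvPolynomial (Fin (M + 1)) K} (hf : Irreducible f)
    (hd : f.totalDegree ≤ d) (hc : coeff (Finsupp.single 0 d) f = 1) (x0 : Fin M → K) :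
    Irreducible (wlSlice (S := MvPolynomial (Fin M) K) (fun i => C (x0 i)) (fun i => X i) f) := by
  rw [← MulEquiv.irreducible_iff (finSuccEquiv (MvPolynomial (Fin M) K) 1), wlSlice_finSucc]
  have hmon := (wl_finSucc_monic hd hc).map (wlTheta (K := K) (S := MvPolynomial (Fin M) K) (fun i => C (x0 i)) (fun i => X i) :
    MvPolynomial (Fin M) K →+* MvPolynomial (Fin 1) (MvPolynomial (Fin M) K))
  let τ : MvPolynomial (Fin 1) (MvPolynomial (Fin M) K) →+* MvPolynomial (Fin M) K :=
    eval₂Hom (aeval (fun i => X i - C (x0 i)) : MvPolynomial (Fin M) K →ₐ[K] MvPolynomial (Fin M) K).toRingHom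
      (fun _ => 1)
  apply hmon.irreducible_of_irreducible_map τ
  rw [Polynomial.map_map]
  have : τ.comp (wlTheta (K := K) (S := MvPolynomial (Fin M) K) (fun i => C (x0 i)) (fun i => X i) :
    MvPolynomial (Fin M) K →+* MvPolynomial (Fin 1) (MvPolynomial (Fin M) K)) = RingHom.id _ := by
    apply MvPolynomial.ringHom_ext
    · intro a
      simp [τ, wlTheta]
    · intro i
      simp [τ, wlTheta]
  rw [this, Polynomial.map_id]
  exact (MulEquiv.irreducible_iff (finSuccEquiv K M)).mpr hf

end slice


theorem wl_totalDegree_map {σ R S : Type*} [CommRing R] [CommRing S] (φ : R →+* S) (h : Function.Injective φ)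
    (p : MvPolynomial σ R) : (map φ p).totalDegree = p.totalDegree := by
  unfold totalDegree
  rw [support_map_of_injective _ h]

theorem wl_irred_frac {σ R E : Type*} [CommRing R] [IsDomain R] [UniqueFactorizationMonoid R]
    [Field E] [Algebra R E] [IsFractionRing R E] {F : MvPolynomial σ R} (hF : Irreducible F)
    (h1 : 1 ≤ F.totalDegree) : Irreducible (map (algebraMap R E) F) := by
  classical
  have hinj : Function.Injective (algebraMap R E) := IsFractionRing.injective R E
  have hclear : ∀ G : MvPolynomial σ E, ∃ a : R, a ≠ 0 ∧ ∃ G' : MvPolynomial σ R,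
      map (algebraMap R E) G' = C (algebraMap R E a) * G := by
    intro G
    obtain ⟨b, hb⟩ := IsLocalization.exist_integer_multiples_of_finset (nonZeroDivisors R) (G.support.image (fun m => coeff m G))
    have hb' : ∀ m, ∃ r : R, algebraMap R E r = algebraMap R E b * coeff m G := by
      intro m
      by_cases hm : coeff m G = 0
      · exact ⟨0, by simp [hm]⟩
      · obtain ⟨r, hr⟩ := hb (coeff m G) (Finset.mem_image_of_mem _ (mem_support_iff.mpr hm))
        exact ⟨r, by rw [hr, Algebra.smul_def]⟩
    choose r hr using hb'
    refine ⟨b, nonZeroDivisors.ne_zero b.2, ∑ m ∈ G.support, monomial m (r m), ?_⟩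
    conv_rhs => rw [G.as_sum, Finset.mul_sum]
    rw [map_sum]
    refine Finset.sum_congr rfl fun m _ => ?_
    rw [map_monomial, hr, C_mul_monomial]
  have key : ∀ (G H : MvPolynomial σ E) (G' : MvPolynomial σ R) (a : R), a ≠ 0 → 
      map (algebraMap R E) G' = C (algebraMap R E a) * G → map (algebraMap R E) F = G * H →
      F ∣ G' → IsUnit H := by
    rintro G H G' a ha hG hFGH ⟨k, rfl⟩
    have ha' : algebraMap R E a ≠ 0 := fun h => ha (hinj (by rw [h, map_zero]))
    rw [map_mul, hFGH] at hG
    have hG0 : G ≠ 0 := by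
      rintro rfl
      rw [zero_mul] at hFGH
      exact hF.ne_zero (map_injective _ hinj (by rw [hFGH, map_zero]))
    rw [mul_assoc, mul_comm (C _) G] at hG
    have := mul_left_cancel₀ hG0 hG
    have hu : IsUnit (C (algebraMap R E a) : MvPolynomial σ E) := (IsUnit.mk0 _ ha').map C
    rw [← this] at hu
    exact isUnit_of_mul_isUnit_left hu
  refine ⟨?_, ?_⟩
  · intro hu
    rw [isUnit_iff_totalDegree_of_isReduced, wl_totalDegree_map _ hinj] at hu
    omega
  · intro G H hGH
    obtain ⟨a, ha, G', hG'⟩ := hclear G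
    obtain ⟨b, hb, H', hH'⟩ := hclear H
    have hprod : C (a * b) * F = G' * H' := by
      apply map_injective _ hinj
      rw [map_mul, map_mul (map (algebraMap R E)) G' H', hG', hH', hGH, map_C, map_mul, C_mul]
      ring
    have hpr := hF.prime
    rcases hpr.dvd_or_dvd (Dvd.intro_left _ hprod) with h | h
    · exact Or.inr (key G H G' a ha hG' hGH h)
    · exact Or.inl (key H G H' b hb hH' (by rw [hGH, mul_comm]) h)

theorem wlD_map {R S : Type*} [CommRing R] [CommRing S] (φ : R →+* S) (f h : MvPolynomial (Fin 2) R) :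
    wlD (map φ f) (map φ h) = map φ (wlD f h) := by
  simp only [wlD_apply, map_sub, map_mul, pderiv_map]

theorem wlD_iter_map {R S : Type*} [CommRing R] [CommRing S] (φ : R →+* S) (f h : MvPolynomial (Fin 2) R) (j : ℕ) :
    (wlD (map φ f))^[j] (map φ h) = map φ ((wlD f)^[j] h) := by
  induction j with
  | zero => rfl
  | succ j ih => rw [Function.iterate_succ_apply', ih, wlD_map, Function.iterate_succ_apply']

section weight
variable {K : Type*} [Field K] {M : ℕ}

def wlWC (c : ℕ) (G : MvPolynomial (Fin 2) (MvPolynomial (Fin M) K)) : Prop :=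
  ∀ α, (coeff α G).totalDegree ≤ α 1 + c

theorem wlWC.add {c : ℕ} {G H : MvPolynomial (Fin 2) (MvPolynomial (Fin M) K)} (hG : wlWC c G) (hH : wlWC c H) :
    wlWC c (G + H) := fun α => by
  rw [coeff_add]
  exact (totalDegree_add _ _).trans (max_le (hG α) (hH α))

theorem wlWC.sub {c : ℕ} {G H : MvPolynomial (Fin 2) (MvPolynomial (Fin M) K)} (hG : wlWC c G) (hH : wlWC c H) :
    wlWC c (G - H) := fun α => by
  rw [coeff_sub]
  exact (totalDegree_sub _ _).trans (max_le (hG α) (hH α))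

theorem wlWC.mul {c c' : ℕ} {G H : MvPolynomial (Fin 2) (MvPolynomial (Fin M) K)} (hG : wlWC c G) (hH : wlWC c' H) :
    wlWC (c + c') (G * H) := fun α => by
  rw [coeff_mul]
  apply totalDegree_finsetSum_le
  rintro ⟨a, b⟩ hab
  rw [Finset.HasAntidiagonal.mem_antidiagonal] at hab
  have h1 := hG a
  have h2 := hH b
  refine (totalDegree_mul _ _).trans ?_
  rw [← hab, Finsupp.add_apply]
  dsimp only
  omega

theorem wlWC.mono {c c' : ℕ} {G : MvPolynomial (Fin 2) (MvPolynomial (Fin M) K)} (hG : wlWC c G) (h : c ≤ c') :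
    wlWC c' G := fun α => (hG α).trans (by omega)

theorem wlWC_C (a : MvPolynomial (Fin M) K) (c : ℕ) (h : a.totalDegree ≤ c) : wlWC c (C a) := fun α => by
  classical
  rw [coeff_C]
  split_ifs
  · omega
  · simp

theorem wlWC_X0 : wlWC 0 (X 0 : MvPolynomial (Fin 2) (MvPolynomial (Fin M) K)) := fun α => by
  classical
  rw [coeff_X]
  split_ifs <;> simp

theorem wlWC_mon (α : Fin 2 →₀ ℕ) : wlWC 0 (monomial α 1 : MvPolynomial (Fin 2) (MvPolynomial (Fin M) K)) := fun β => by
  classical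
  rw [coeff_monomial]
  split_ifs <;> simp

theorem wlWC_pderiv (i : Fin 2) {c : ℕ} {G : MvPolynomial (Fin 2) (MvPolynomial (Fin M) K)} (hG : wlWC c G) :
    wlWC (c + 1) (pderiv i G) := fun α => by
  classical
  rw [coeff_pderiv]
  refine (totalDegree_mul _ _).trans ?_
  have h1 := hG (α + Finsupp.single i 1)
  have h2 : ((α i : MvPolynomial (Fin M) K) + 1).totalDegree = 0 := by
    have : ((α i : MvPolynomial (Fin M) K) + 1) = C ((α i : K) + 1) := by simp
    rw [this, totalDegree_C]
  rw [h2]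
  have : (α + Finsupp.single i 1 : Fin 2 →₀ ℕ) 1 ≤ α 1 + 1 := by
    rw [Finsupp.add_apply, Finsupp.single_apply]
    split_ifs <;> omega
  omega

theorem wlWC_pderiv0 {c : ℕ} {G : MvPolynomial (Fin 2) (MvPolynomial (Fin M) K)} (hG : wlWC c G) :
    wlWC c (pderiv 0 G) := fun α => by
  classical
  rw [coeff_pderiv]
  refine (totalDegree_mul _ _).trans ?_
  have h1 := hG (α + Finsupp.single 0 1)
  have h2 : ((α 0 : MvPolynomial (Fin M) K) + 1).totalDegree = 0 := by
    have : ((α 0 : MvPolynomial (Fin M) K) + 1) = C ((α 0 : K) + 1) := by simp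
    rw [this, totalDegree_C]
  rw [h2]
  have : (α + Finsupp.single 0 1 : Fin 2 →₀ ℕ) 1 = α 1 := by
    rw [Finsupp.add_apply, Finsupp.single_apply]
    simp
  omega

theorem wlWC_D {c : ℕ} {F G : MvPolynomial (Fin 2) (MvPolynomial (Fin M) K)} (hF : wlWC 0 F) (hG : wlWC c G) :
    wlWC (c + 1) (wlD F G) := by
  rw [wlD_apply]
  apply wlWC.sub
  · exact ((wlWC_pderiv0 hF).mul (wlWC_pderiv 1 hG)).mono (by omega)
  · exact ((wlWC_pderiv 1 hF).mul (wlWC_pderiv0 hG)).mono (by omega)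

theorem wlWC_iter {c : ℕ} {F G : MvPolynomial (Fin 2) (MvPolynomial (Fin M) K)} (hF : wlWC 0 F) (hG : wlWC c G) (j : ℕ) :
    wlWC (c + j) ((wlD F)^[j] G) := by
  induction j with
  | zero => exact hG
  | succ j ih => rw [Function.iterate_succ_apply']; exact wlWC_D hF ih

theorem wlWC_slice (f : MvPolynomial (Fin (M + 1)) K) (x0 : Fin M → K) :
    wlWC 0 (wlSlice (S := MvPolynomial (Fin M) K) (fun i => C (x0 i)) (fun i => X i) f) := by
  classical
  unfold wlSlice
  induction f using MvPolynomial.induction_on with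
  | C a =>
    rw [algHom_C, MvPolynomial.algebraMap_apply]
    exact wlWC_C _ _ (by simp [MvPolynomial.algebraMap_eq])
  | add a b ha hb => rw [map_add]; exact ha.add hb
  | mul_X a i ha =>
    rw [map_mul, aeval_X]
    refine ha.mul (c' := 0) ?_
    refine Fin.cases ?_ (fun i => ?_) i
    · exact wlWC_X0
    · simp only [Fin.cons_succ]
      refine (wlWC_C _ _ (by simp)).add ?_
      intro α
      rw [coeff_C_mul, coeff_X]
      split_ifs with h
      · subst h; simp
      · simp

theorem wlWC_eval {c : ℕ} {G : MvPolynomial (Fin 2) (MvPolynomial (Fin M) K)} (hG : wlWC c G) (y0 : K) :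
    (aeval (![C y0, 0] : Fin 2 → MvPolynomial (Fin M) K) G).totalDegree ≤ c := by
  rw [aeval_def, eval₂_eq']
  apply totalDegree_finsetSum_le
  intro α _
  rw [Fin.prod_univ_two]
  simp only [Algebra.algebraMap_self, RingHom.id_apply, Matrix.cons_val_zero, Matrix.cons_val_one]
  by_cases h : α 1 = 0
  · rw [h, pow_zero, mul_one]
    have := hG α
    refine (totalDegree_mul _ _).trans ?_
    rw [← C_pow, totalDegree_C]
    omega
  · rw [zero_pow h]; simp

end weight


section bertini
variable {K : Type*} [Field K] {M : ℕ}

theorem wlSlice_eval {S : Type*} [CommRing S] [Algebra K S] (x0 w : Fin M → S) (y0 : S)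
    (f : MvPolynomial (Fin (M + 1)) K) :
    aeval ![y0, 0] (wlSlice x0 w f) = aeval (Fin.cons y0 x0 : Fin (M+1) → S) f := by
  unfold wlSlice
  induction f using MvPolynomial.induction_on with
  | C a => simp [MvPolynomial.algebraMap_apply]
  | add a b ha hb => simp only [map_add, ha, hb]
  | mul_X a i ha =>
    simp only [map_mul, ha, aeval_X]
    congr 1
    refine Fin.cases ?_ (fun i => ?_) i
    · simp
    · simp

theorem wlSlice_pderiv {S : Type*} [CommRing S] [Algebra K S] (x0 w : Fin M → S)
    (f : MvPolynomial (Fin (M + 1)) K) :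
    pderiv 0 (wlSlice x0 w f) = wlSlice x0 w (pderiv 0 f) := by
  unfold wlSlice
  induction f using MvPolynomial.induction_on with
  | C a => simp [MvPolynomial.algebraMap_apply]
  | add a b ha hb => simp only [map_add, ha, hb]
  | mul_X a i ha =>
    simp only [map_mul, aeval_X, pderiv_mul, ha, map_add]
    congr 2
    refine Fin.cases ?_ (fun i => ?_) i
    · simp
    · simp [pderiv_X_of_ne]

theorem wl_sum_monLE {R : Type*} [CommRing R] {m k : ℕ} (g : MvPolynomial (Fin m) R) (hg : g.totalDegree ≤ k) :
    g = ∑ j : {α // α ∈ wlMonLE m k}, monomial j.1 (coeff j.1 g) := by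
  classical
  rw [Finset.sum_coe_sort (wlMonLE m k) (fun α => monomial α (coeff α g))]
  conv_lhs => rw [g.as_sum]
  apply Finset.sum_subset
  · intro α hα
    rw [wl_mem_monLE]
    have := le_totalDegree hα
    rw [wl_sum_eq_univ] at this
    omega
  · intro α _ hα
    rw [notMem_support_iff.mp hα, monomial_zero]

theorem wl_aeval_pt {R S : Type*} [CommRing R] [CommRing S] (φ : R →+* S) (a : R) (G : MvPolynomial (Fin 2) R) :
    aeval (![φ a, 0] : Fin 2 → S) (map φ G) = φ (aeval (![a, 0] : Fin 2 → R) G) := by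
  have h := map_aeval (![a, 0] : Fin 2 → R) φ G
  rw [h, aeval_def, eval₂_map, coe_eval₂Hom]
  congr 1
  ext i
  fin_cases i <;> simp

theorem wl_bertini {d : ℕ} {f : MvPolynomial (Fin (M + 1)) K} (hf : Irreducible f)
    (hd : f.totalDegree = d) (hc : coeff (Finsupp.single 0 d) f = 1)
    (hfac : ∀ j < d ^ 2, (j.factorial : K) ≠ 0)
    (x0 : Fin M → K) (y0 : K)
    (hf0 : aeval (Fin.cons y0 x0 : Fin (M+1) → K) f = 0)
    (hfy : aeval (Fin.cons y0 x0 : Fin (M+1) → K) (pderiv 0 f) ≠ 0) :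
    ∃ Θ : MvPolynomial (Fin M) K, Θ ≠ 0 ∧ Θ.totalDegree ≤ d ^ 4 ∧
      ∀ w, aeval w Θ ≠ 0 → Irreducible (wlSlice (S := K) x0 w f) := by
  classical
  have hd1 : 1 ≤ d := hd ▸ wl_pos_of_irreducible hf
  set F := wlSlice (S := MvPolynomial (Fin M) K) (fun i => C (x0 i)) (fun i => X i) f with hF
  set κ := {α // α ∈ wlMonLE 2 (d - 1)}
  set E := FractionRing (MvPolynomial (Fin M) K)
  let φE := algebraMap (MvPolynomial (Fin M) K) E
  have hinj : Function.Injective φE := IsFractionRing.injective _ E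
  have hFirr : Irreducible (map φE F) := wl_irred_frac (wlSlice_generic_irreducible hf hd.le hc x0)
    (by rw [wlSlice_totalDegree _ _ hd hc]; exact hd1)
  have hFdeg : (map φE F).totalDegree = d := by
    rw [wl_totalDegree_map _ hinj, hF, wlSlice_totalDegree _ _ hd hc]
  let A : Matrix (Fin (d ^ 2)) κ (MvPolynomial (Fin M) K) := fun i j =>
    aeval (![C y0, 0] : Fin 2 → MvPolynomial (Fin M) K) ((wlD F)^[i] (monomial j.1 1))
  -- transport of the entries
  have hA : ∀ {S : Type _} [CommRing S] (φ : MvPolynomial (Fin M) K →+* S) i j,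
      φ (A i j) = aeval (![φ (C y0), 0] : Fin 2 → S) ((wlD (map φ F))^[i] (monomial j.1 1)) := by
    intro S _ φ i j
    have : (monomial j.1 1 : MvPolynomial (Fin 2) S) = map φ (monomial j.1 1) := by
      rw [map_monomial, RingHom.map_one]
    rw [this, wlD_iter_map, wl_aeval_pt]
  have hfac' : ∀ j < d ^ 2, (j.factorial : E) ≠ 0 := by
    intro j hj h
    apply hfac j hj
    have h2 : φE (C (j.factorial : K)) = 0 := by simpa using h
    have h3 := hinj (h2.trans (map_zero φE).symm)
    exact C_injective _ _ (h3.trans C_0.symm)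
  have hPE : ∀ g : MvPolynomial (Fin (M+1)) K, aeval (![φE (C y0), 0] : Fin 2 → E)
      (map φE (wlSlice (S := MvPolynomial (Fin M) K) (fun i => C (x0 i)) (fun i => X i) g)) =
        φE (C (aeval (Fin.cons y0 x0 : Fin (M+1) → K) g)) := by
    intro g
    have h1 : (aeval (![φE (C y0), 0] : Fin 2 → E)
      (map φE (wlSlice (S := MvPolynomial (Fin M) K) (fun i => C (x0 i)) (fun i => X i) g))) =
      φE (aeval (![C y0, 0] : Fin 2 → MvPolynomial (Fin M) K) (wlSlice (S := MvPolynomial (Fin M) K) (fun i => C (x0 i)) (fun i => X i) g)) := by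
      rw [wl_aeval_pt]
    rw [h1, wlSlice_eval]
    congr 1
    have h2 : (Fin.cons (C y0) (fun i => C (x0 i)) : Fin (M+1) → MvPolynomial (Fin M) K) =
        fun i => C ((Fin.cons y0 x0 : Fin (M+1) → K) i) := by
      ext1 i
      refine Fin.cases ?_ (fun i => ?_) i <;> simp
    rw [h2]
    have := map_aeval (Fin.cons y0 x0 : Fin (M+1) → K) (C : K →+* MvPolynomial (Fin M) K) g
    rw [this, aeval_def, coe_eval₂Hom]
    rfl
  obtain ⟨e, he⟩ := wl_exists_minor_domain A (by
    intro x hx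
    set G : MvPolynomial (Fin 2) E := ∑ j : κ, monomial j.1 (φE (x j)) with hG
    have hGdeg : G.totalDegree ≤ d - 1 := by
      apply totalDegree_finsetSum_le
      intro j _
      refine (totalDegree_monomial_le _ _).trans ?_
      have := (wl_mem_monLE).mp j.2
      refine le_trans (le_of_eq ?_) this
      exact wl_sum_eq_univ _
    have hG0 : G = 0 := by
      by_contra hne
      have hnd : ¬ map φE F ∣ G := wl_not_dvd_of_totalDegree hne (by rw [hFdeg]; omega)
      have := wl_curve_bound_aux hFirr hnd (ι := Unit) (fun _ => ![φE (C y0), 0])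
        (fun _ _ _ => rfl) (fun _ => by rw [hPE, hf0]; simp) (d ^ 2) hfac'
        (fun _ _ => by
          rw [pderiv_map, hF, wlSlice_pderiv, hPE]
          intro h
          have h3 := hinj (h.trans (map_zero φE).symm)
          exact hfy (by simpa using h3))
        (fun _ i hi => by
          have h1 := congrArg φE (hx ⟨i, hi⟩)
          rw [map_sum, map_zero] at h1
          rw [hG, wl_iter_sum, map_sum]
          refine Eq.trans ?_ h1
          refine Finset.sum_congr rfl fun j _ => ?_
          rw [map_mul, hA φE]
          have h2 : (monomial j.1 (φE (x j)) : MvPolynomial (Fin 2) E) = (φE (x j)) • monomial j.1 1 := by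
            rw [smul_monomial, smul_eq_mul, mul_one]
          rw [h2, wl_iter_smul, map_smul, smul_eq_mul, mul_comm])
      rw [hFdeg, Fintype.card_unit, mul_one, pow_two] at this
      have := Nat.le_of_mul_le_mul_left this (by omega)
      omega
    ext1 j
    have h1 : coeff j.1 G = φE (x j) := by
      rw [hG, coeff_sum]
      simp only [coeff_monomial]
      rw [Finset.sum_eq_single j]
      · simp
      · intro b _ hb
        rw [if_neg (fun h => hb (Subtype.ext h))]
      · simp
    rw [hG0, coeff_zero] at h1
    exact hinj (h1.symm.trans (map_zero φE).symm))
  refine ⟨(A.submatrix e id).det, he, ?_, ?_⟩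
  · have hcard : Fintype.card κ ≤ d ^ 2 := by
      rw [Fintype.card_coe, wl_card_monLE]
      have h1 := wl_choose_two (d - 1)
      obtain ⟨k, rfl⟩ : ∃ k, d = k + 1 := ⟨d - 1, by omega⟩
      simp only [Nat.add_sub_cancel] at h1 ⊢
      nlinarith
    let eq := (Fintype.equivFin κ).symm
    rw [← Matrix.det_submatrix_equiv_self eq]
    refine (wl_totalDegree_det _ (fun _ => d ^ 2) ?_).trans ?_
    · intro i j
      simp only [Matrix.submatrix_apply]
      refine (wlWC_eval (wlWC_iter (wlWC_slice f x0) (wlWC_mon _) _) y0).trans ?_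
      have := (e (eq i)).2
      omega
    · rw [Finset.sum_const, Finset.card_univ, Fintype.card_fin, smul_eq_mul]
      calc Fintype.card κ * d ^ 2 ≤ d ^ 2 * d ^ 2 := Nat.mul_le_mul_right _ hcard
        _ = d ^ 4 := by ring
  · intro w hw
    let φ : MvPolynomial (Fin M) K →ₐ[K] K := aeval w
    set fw := wlSlice (S := K) x0 w f with hfw
    have hmap : map (φ : MvPolynomial (Fin M) K →+* K) F = fw := by
      rw [hF, wlSlice_map]
      simp [φ, hfw]
    have hfwdeg : fw.totalDegree = d := wlSlice_totalDegree _ _ hd hc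
    have hfw0 : aeval ![y0, 0] fw = 0 := by rw [hfw, wlSlice_eval, hf0]
    have hfwy : aeval ![y0, 0] (pderiv 0 fw) ≠ 0 := by rw [hfw, wlSlice_pderiv, wlSlice_eval]; exact hfy
    have hfwne : fw ≠ 0 := by rintro h; rw [h, totalDegree_zero] at hfwdeg; omega
    have key : ∀ g h : MvPolynomial (Fin 2) K, fw = g * h → ¬ IsUnit h → aeval ![y0, 0] h ≠ 0 → False := by
      intro g h hgh hh hP
      have hg0 : g ≠ 0 := by rintro rfl; simp at hgh; exact hfwne hgh
      have hh0 : h ≠ 0 := by rintro rfl; simp at hgh; exact hfwne hgh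
      have hgdeg : g.totalDegree ≤ d - 1 := by
        have h1 := totalDegree_mul_of_isDomain hg0 hh0
        rw [← hgh, hfwdeg] at h1
        rw [isUnit_iff_totalDegree_of_isReduced] at hh
        have : h.totalDegree ≠ 0 := fun h0 => hh ⟨by
          have h2 := totalDegree_eq_zero_iff_eq_C.mp h0
          rw [isUnit_iff_ne_zero]
          intro h3
          rw [h3, C_0] at h2
          exact hh0 h2, h0⟩
        omega
      have hord : wlOrd (wlD fw) (aeval ![y0, 0]) (d ^ 2) g := by
        apply wlOrd.cancel (c := h) hP
        rw [mul_comm, ← hgh]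
        exact wlOrd_of_const (wlD_self _) hfw0 _
      apply hw
      change φ _ = 0
      rw [AlgHom.map_det]
      rw [← Matrix.exists_mulVec_eq_zero_iff]
      refine ⟨fun j => coeff j.1 g, ?_, ?_⟩
      · intro h0
        apply hg0
        rw [wl_sum_monLE g hgdeg]
        refine Finset.sum_eq_zero fun j _ => ?_
        have := congrFun h0 j
        simp only [Pi.zero_apply] at this
        rw [this, monomial_zero]
      · ext i
        have h1 := hord (e i) (e i).2
        rw [wl_sum_monLE g hgdeg, wl_iter_sum, map_sum] at h1
        rw [Matrix.mulVec, dotProduct, Pi.zero_apply, ← h1]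
        refine Finset.sum_congr rfl fun j _ => ?_
        have h2 : (monomial j.1 (coeff j.1 g) : MvPolynomial (Fin 2) K) = (coeff j.1 g) • monomial j.1 1 := by
          rw [smul_monomial, smul_eq_mul, mul_one]
        rw [h2, wl_iter_smul, map_smul, smul_eq_mul, mul_comm]
        congr 1
        have h3 := hA (φ : MvPolynomial (Fin M) K →+* K) (e i) j
        rw [hmap] at h3
        simpa [φ] using h3
    refine ⟨fun hu => ?_, fun g h hgh => ?_⟩
    · rw [isUnit_iff_totalDegree_of_isReduced] at hu; omega
    · by_contra hcon
      rw [not_or] at hcon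
      by_cases hg : aeval ![y0, 0] g = 0
      · by_cases hh : aeval ![y0, 0] h = 0
        · apply hfwy
          rw [hgh, pderiv_mul, map_add, map_mul, map_mul, hg, hh]
          ring
        · exact key g h hgh hcon.2 hh
      · exact key h g (by rw [hgh, mul_comm]) hcon.1 hg
end bertini


section disc
variable {K : Type*} [Field K] {M : ℕ}

theorem wl_disc (p : ℕ) [Fact p.Prime] [CharP K p] {d : ℕ} {f : MvPolynomial (Fin (M + 1)) K} (hf : Irreducible f)
    (hd : f.totalDegree = d) (hc : coeff (Finsupp.single 0 d) f = 1) (hdp : d < p) :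
    ∃ R : MvPolynomial (Fin M) K, R ≠ 0 ∧ R.totalDegree ≤ 2 * d ^ 2 ∧
      ∀ x y, aeval (Fin.cons y x : Fin (M + 1) → K) f = 0 → aeval (Fin.cons y x : Fin (M + 1) → K) (pderiv 0 f) = 0 →
        aeval x R = 0 := by
  have hd1 : 1 ≤ d := hd ▸ wl_pos_of_irreducible hf
  have hg0 : pderiv 0 f ≠ 0 := wl_pderiv_ne p 0 d hd1 hdp (by rw [hc]; exact one_ne_zero)
  have hgd : (pderiv 0 f).totalDegree ≤ d - 1 := (wl_totalDegree_pderiv 0 f).trans (by rw [hd])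
  set F := finSuccEquiv K M f with hF
  set G := finSuccEquiv K M (pderiv 0 f) with hG
  have hG0 : G ≠ 0 := by
    intro h
    exact hg0 ((finSuccEquiv K M).injective (by rw [← hG, h, map_zero]))
  have hFm : F.Monic := wl_finSucc_monic hd.le hc
  have hFd : F.natDegree = d := by
    apply le_antisymm (wl_finSucc_natDegree hd.le)
    apply Polynomial.le_natDegree_of_ne_zero
    rw [wl_finSucc_coeff_top hd.le hc]; exact one_ne_zero
  have hGd : G.natDegree ≤ d - 1 := wl_finSucc_natDegree hgd
  have hFirr : Irreducible F := (MulEquiv.irreducible_iff (finSuccEquiv K M)).mpr hf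
  let E := FractionRing (MvPolynomial (Fin M) K)
  let φ := algebraMap (MvPolynomial (Fin M) K) E
  have hinj : Function.Injective φ := IsFractionRing.injective _ E
  have hFE : Irreducible (F.map φ) := (hFm.irreducible_iff_irreducible_map_fraction_map).mp hFirr
  have hco : IsCoprime (F.map φ) (G.map φ) := by
    rw [hFE.coprime_iff_not_dvd]
    intro hdvd
    have := Polynomial.natDegree_le_of_dvd hdvd (by
      rw [Ne, Polynomial.map_eq_zero_iff hinj]; exact hG0)
    rw [Polynomial.natDegree_map_eq_of_injective hinj, Polynomial.natDegree_map_eq_of_injective hinj] at this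
    omega
  refine ⟨F.resultant G, ?_, ?_, ?_⟩
  · intro h
    have h1 := Polynomial.resultant_ne_zero _ _ hco
    apply h1
    rw [Polynomial.natDegree_map_eq_of_injective hinj, Polynomial.natDegree_map_eq_of_injective hinj,
      Polynomial.resultant_map_map, h, map_zero]
  · unfold Polynomial.resultant
    rw [← Matrix.det_transpose]
    refine (wl_totalDegree_det _ (fun _ => d) ?_).trans ?_
    · intro i j
      have hF' : ∀ k, (F.coeff k).totalDegree ≤ d := by
        intro k
        by_cases h : F.coeff k = 0
        · rw [h]; simp
        · have := totalDegree_coeff_finSuccEquiv_add_le f k h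
          rw [← hF] at this
          omega
      have hG' : ∀ k, (G.coeff k).totalDegree ≤ d := by
        intro k
        by_cases h : G.coeff k = 0
        · rw [h]; simp
        · have := totalDegree_coeff_finSuccEquiv_add_le (pderiv 0 f) k h
          rw [← hG] at this
          omega
      rw [Matrix.transpose_apply, Polynomial.sylvester, Matrix.of_apply]
      refine Fin.addCases (fun i => ?_) (fun i => ?_) i
      · rw [Fin.addCases_left]
        split_ifs
        · exact hG' _
        · simp
      · rw [Fin.addCases_right]
        split_ifs
        · exact hF' _
        · simp
    · rw [Finset.sum_const, Finset.card_univ, Fintype.card_fin, smul_eq_mul]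
      have : F.natDegree + G.natDegree ≤ 2 * d := by omega
      calc _ ≤ 2 * d * d := Nat.mul_le_mul_right _ this
        _ = _ := by ring
  · intro x y h1 h2
    obtain ⟨a, b, -, -, hab⟩ := Polynomial.exists_mul_add_mul_eq_C_resultant F G le_rfl le_rfl (by omega)
    have h3 := congrArg (fun q => Polynomial.eval y (Polynomial.map (eval x) q)) hab
    simp only [Polynomial.map_add, Polynomial.map_mul, Polynomial.eval_add, Polynomial.eval_mul, Polynomial.map_C,
      Polynomial.eval_C] at h3
    rw [hF, hG, ← eval_eq_eval_mv_eval', ← eval_eq_eval_mv_eval'] at h3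
    have hev : ∀ {m : ℕ} (z : Fin m → K) (g : MvPolynomial (Fin m) K), aeval z g = eval z g := fun z g => by
      rw [← coe_aeval_eq_eval]; rfl
    rw [hev] at h1 h2 ⊢
    rw [← h3, h1, h2]
    ring

end disc

section variance
open Finset

theorem wl_line_mean {F V : Type*} [Field F] [Fintype F] [AddCommGroup V] [Module F V] [Fintype V] (r : V → ℝ) :
    ∑ q : V × V, ∑ t : F, r (q.1 + t • q.2) = Fintype.card F * Fintype.card V * ∑ x, r x := by
  rw [Finset.sum_comm]
  have : ∀ t : F, ∑ q : V × V, r (q.1 + t • q.2) = Fintype.card V * ∑ x, r x := by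
    intro t
    rw [Fintype.sum_prod_type_right]
    have : ∀ w : V, ∑ x : V, r (x + t • w) = ∑ x, r x := fun w =>
      Fintype.sum_equiv (Equiv.addRight (t • w)) _ _ (fun x => rfl)
    simp only [this, sum_const, card_univ, nsmul_eq_mul]
  simp only [this, sum_const, card_univ, nsmul_eq_mul]
  ring

theorem wl_line_sq {F V : Type*} [Field F] [Fintype F] [AddCommGroup V] [Module F V] [Fintype V] (r : V → ℝ) :
    ∑ q : V × V, (∑ t : F, r (q.1 + t • q.2)) ^ 2 =
      Fintype.card F * Fintype.card V * ∑ x, r x ^ 2 + (Fintype.card F * (Fintype.card F - 1)) * (∑ x, r x) ^ 2 := by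
  classical
  have h1 : ∀ q : V × V, (∑ t : F, r (q.1 + t • q.2)) ^ 2 =
      ∑ t : F, r (q.1 + t • q.2) ^ 2 + ∑ t : F, ∑ t' ∈ univ.erase t, r (q.1 + t • q.2) * r (q.1 + t' • q.2) := by
    intro q
    rw [pow_two, Finset.sum_mul_sum, ← Finset.sum_add_distrib]
    refine Finset.sum_congr rfl fun t _ => ?_
    rw [← Finset.add_sum_erase univ _ (mem_univ t), pow_two]
  simp only [h1, Finset.sum_add_distrib]
  rw [wl_line_mean (F := F) (fun x => r x ^ 2)]
  congr 1
  rw [Finset.sum_comm]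
  have h2 : ∀ t : F, ∑ q : V × V, ∑ t' ∈ univ.erase t, r (q.1 + t • q.2) * r (q.1 + t' • q.2) =
      (Fintype.card F - 1) * (∑ x, r x) ^ 2 := by
    intro t
    rw [Finset.sum_comm]
    have : ∀ t' ∈ univ.erase t, ∑ q : V × V, r (q.1 + t • q.2) * r (q.1 + t' • q.2) = (∑ x, r x) ^ 2 := by
      intro t' ht'
      have hne : t' ≠ t := (Finset.mem_erase.mp ht').1
      rw [pow_two, Fintype.sum_mul_sum, ← Fintype.sum_prod_type']
      let e : V × V → V × V := fun q => (q.1 + t • q.2, q.1 + t' • q.2)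
      have he : Function.Bijective e := by
        rw [← Finite.injective_iff_bijective]
        rintro ⟨a, b⟩ ⟨a', b'⟩ h
        simp only [e, Prod.mk.injEq] at h
        have h3 : (t' - t) • (b - b') = 0 := by
          rw [sub_smul, smul_sub, smul_sub]
          have := sub_eq_zero.mpr (congrArg₂ (· - ·) h.2 h.1)
          rw [← this]
          abel
        have h4 : b = b' := by
          rcases smul_eq_zero.mp h3 with h | h
          · exact absurd (sub_eq_zero.mp h) hne
          · exact sub_eq_zero.mp h
        subst h4
        simpa using h.1
      exact Function.Bijective.sum_comp he (fun q : V × V => r q.1 * r q.2)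
    rw [Finset.sum_congr rfl this, sum_const, card_erase_of_mem (mem_univ _), card_univ, nsmul_eq_mul,
      Nat.cast_sub Fintype.card_pos, Nat.cast_one]
  simp only [h2, sum_const, card_univ, nsmul_eq_mul]
  ring

/-- second moment argument -/
theorem wl_line_bound {F V : Type*} [Field F] [Fintype F] [AddCommGroup V] [Module F V] [Fintype V] (r : V → ℝ)
    (d U : ℝ) (hr0 : ∀ x, 0 ≤ r x) (hrd : ∀ x, r x ≤ d) (hd : 0 ≤ d) (G : Finset (V × V))
    (hG : (Fintype.card V : ℝ) ^ 2 ≤ 2 * G.card)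
    (hU : ∀ q ∈ G, ∑ t : F, r (q.1 + t • q.2) ≤ U) :
    (Fintype.card F : ℝ) * ∑ x, r x ≤ Fintype.card V * (U + 2 * d * Real.sqrt (Fintype.card F)) := by
  set q : ℝ := ((Fintype.card F : ℕ) : ℝ) with hq
  set v : ℝ := ((Fintype.card V : ℕ) : ℝ) with hv
  have hq1 : (1 : ℝ) ≤ q := by rw [hq]; exact_mod_cast Fintype.card_pos
  have hv1 : (1 : ℝ) ≤ v := by rw [hv]; exact_mod_cast Fintype.card_pos
  set S := ∑ x, r x with hS
  set μ := q * S / v with hμ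
  have hvar : ∑ z : V × V, (∑ t : F, r (z.1 + t • z.2) - μ) ^ 2 ≤ v ^ 2 * (q * d ^ 2) := by
    have e1 : ∑ z : V × V, (∑ t : F, r (z.1 + t • z.2) - μ) ^ 2 =
        ∑ z : V × V, (∑ t : F, r (z.1 + t • z.2)) ^ 2 - 2 * μ * ∑ z : V × V, ∑ t : F, r (z.1 + t • z.2) + v ^ 2 * μ ^ 2 := by
      rw [Finset.mul_sum, ← Finset.sum_sub_distrib]
      have : v ^ 2 * μ ^ 2 = ∑ z : V × V, μ ^ 2 := by
        rw [sum_const, card_univ, nsmul_eq_mul, Fintype.card_prod, Nat.cast_mul, hv]; ring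
      rw [this, ← Finset.sum_add_distrib]
      refine Finset.sum_congr rfl fun z _ => ?_
      ring
    rw [e1, wl_line_sq, wl_line_mean, ← hq, ← hv, ← hS]
    have h2 : ∑ x, r x ^ 2 ≤ v * d ^ 2 := by
      calc ∑ x, r x ^ 2 ≤ ∑ x : V, d ^ 2 := by
            apply Finset.sum_le_sum
            intro x _
            exact pow_le_pow_left₀ (hr0 x) (hrd x) 2
        _ = _ := by rw [sum_const, card_univ, nsmul_eq_mul]
    have hμS : q * S = μ * v := by rw [hμ]; field_simp
    have e2 : q * v * ∑ x, r x ^ 2 + q * (q - 1) * S ^ 2 - 2 * μ * (q * v * S) + v ^ 2 * μ ^ 2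
        = q * v * ∑ x, r x ^ 2 - q * S ^ 2 := by
      have h5 : q * (q - 1) * S ^ 2 = (q * S) ^ 2 - q * S ^ 2 := by ring
      have h6 : 2 * μ * (q * v * S) = 2 * μ * v * (q * S) := by ring
      rw [h5, h6, hμS]; ring
    rw [e2]
    have h3 : 0 ≤ q * S ^ 2 := by positivity
    have h4 : q * v * ∑ x, r x ^ 2 ≤ q * v * (v * d ^ 2) := by gcongr
    nlinarith
  have hle : μ ≤ U + 2 * d * Real.sqrt q := by
    by_contra hcon
    push Not at hcon
    have hs := Real.sq_sqrt (show (0:ℝ) ≤ q by linarith)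
    have hs0 := Real.sqrt_nonneg q
    have h1 : (G.card : ℝ) * (μ - U) ^ 2 ≤ v ^ 2 * (q * d ^ 2) := by
      refine le_trans ?_ hvar
      calc (G.card : ℝ) * (μ - U) ^ 2 = ∑ z ∈ G, (μ - U) ^ 2 := by rw [sum_const, nsmul_eq_mul]
        _ ≤ ∑ z ∈ G, (∑ t : F, r (z.1 + t • z.2) - μ) ^ 2 := by
            apply Finset.sum_le_sum
            intro z hz
            have := hU z hz
            have h5 : 0 ≤ 2 * d * Real.sqrt q := by positivity
            nlinarith
        _ ≤ _ := Finset.sum_le_sum_of_subset_of_nonneg (subset_univ _) (fun _ _ _ => sq_nonneg _)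
    have h5 : 0 ≤ 2 * d * Real.sqrt q := by positivity
    have h6 : 4 * (q * d ^ 2) < (μ - U) ^ 2 := by
      have : (2 * d * Real.sqrt q) ^ 2 < (μ - U) ^ 2 := pow_lt_pow_left₀ (by linarith) h5 (by norm_num)
      calc 4 * (q * d ^ 2) = (2 * d * Real.sqrt q) ^ 2 := by rw [mul_pow, hs]; ring
        _ < _ := this
    have hG0 : (0 : ℝ) < G.card := by nlinarith
    have h7 : 0 ≤ q * d ^ 2 := by positivity
    nlinarith [mul_lt_mul_of_pos_left h6 hG0, mul_nonneg (sub_nonneg.mpr hG) h7]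
  have : q * S = v * μ := by rw [hμ]; field_simp
  rw [this]
  gcongr

end variance


section count
variable {K : Type*} [Field K] {M : ℕ}

theorem wl_sz (p : ℕ) [Fact p.Prime] [Algebra (ZMod p) K] [DecidableEq K] {R : MvPolynomial (Fin M) K} (hR : R ≠ 0) :
    p * (Finset.univ.filter (fun x : Fin M → ZMod p => aeval (fun i => algebraMap (ZMod p) K (x i)) R = 0)).card
      ≤ R.totalDegree * p ^ M := by
  classical
  let ι := algebraMap (ZMod p) K
  have hι : Function.Injective ι := ι.injective
  let S : Finset K := Finset.univ.image ι
  have hS : S.card = p := by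
    rw [Finset.card_image_of_injective _ hι, Finset.card_univ, ZMod.card]
  have h := schwartz_zippel_totalDegree hR S
  have hp : (0 : ℚ≥0) < p := by exact_mod_cast (Fact.out : p.Prime).pos
  rw [hS, div_le_div_iff₀ (by positivity) hp] at h
  have hc : (Finset.univ.filter (fun x : Fin M → ZMod p => aeval (fun i => algebraMap (ZMod p) K (x i)) R = 0)).card
      ≤ (Finset.filter (fun f => eval f R = 0) (Fintype.piFinset fun _ => S)).card := by
    apply Finset.card_le_card_of_injOn (fun x i => ι (x i))
    · intro x hx
      simp only [Finset.coe_filter, Finset.mem_univ, true_and, Set.mem_ofPred_eq] at hx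
      simp only [Finset.coe_filter, Fintype.mem_piFinset, Set.mem_ofPred_eq]
      refine ⟨fun i => Finset.mem_image_of_mem _ (Finset.mem_univ _), ?_⟩
      rw [← hx, ← coe_aeval_eq_eval]; rfl
    · intro x _ y _ hxy
      ext1 i
      exact hι (congrFun hxy i)
  have h2 : (Finset.filter (fun f => eval f R = 0) (Fintype.piFinset fun _ => S)).card * p ≤ R.totalDegree * p ^ M := by
    exact_mod_cast h
  calc _ ≤ p * _ := Nat.mul_le_mul_left _ hc
    _ ≤ _ := by rw [mul_comm]; exact h2

theorem wl_aeval_cons (x : Fin M → K) (y : K) (f : MvPolynomial (Fin (M + 1)) K) :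
    aeval (Fin.cons y x : Fin (M + 1) → K) f = Polynomial.eval y (Polynomial.map (eval x) (finSuccEquiv K M f)) := by
  rw [← eval_eq_eval_mv_eval', ← coe_aeval_eq_eval]; rfl

theorem wl_slice_eval2 (x0 w : Fin M → K) (P : Fin 2 → K) (f : MvPolynomial (Fin (M + 1)) K) :
    aeval P (wlSlice (S := K) x0 w f) = aeval (Fin.cons (P 0) (fun i => x0 i + P 1 * w i) : Fin (M + 1) → K) f := by
  unfold wlSlice
  induction f using MvPolynomial.induction_on with
  | C a => simp [MvPolynomial.algebraMap_apply]
  | add a b ha hb => simp only [map_add, ha, hb]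
  | mul_X a i ha =>
    simp only [map_mul, ha, aeval_X]
    congr 1
    refine Fin.cases ?_ (fun i => ?_) i
    · simp
    · simp [mul_comm]

variable [IsAlgClosed K]

theorem wl_count_normalized (p : ℕ) [Fact p.Prime] [CharP K p] [Algebra (ZMod p) K] [DecidableEq K]
    {d : ℕ} {f : MvPolynomial (Fin (M + 1)) K} (hf : Irreducible f)
    (hd : f.totalDegree = d) (hc : coeff (Finsupp.single 0 d) f = 1) (hp : 16 * d ^ 4 ≤ p) :
    ((Finset.univ.filter (fun v : Fin (M + 1) → ZMod p => aeval (fun i => algebraMap (ZMod p) K (v i)) f = 0)).card : ℝ)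
      ≤ p ^ M + 17 * d ^ 2 * (p ^ M / Real.sqrt p) ∧
    p * (Finset.univ.filter (fun v : Fin (M + 1) → ZMod p => aeval (fun i => algebraMap (ZMod p) K (v i)) f = 0 ∧
      aeval (fun i => algebraMap (ZMod p) K (v i)) (pderiv 0 f) = 0)).card ≤ 2 * d ^ 3 * p ^ M := by
  classical
  have hd1 : 1 ≤ d := hd ▸ wl_pos_of_irreducible hf
  have hd4 : d ≤ d ^ 4 := Nat.le_self_pow (by norm_num) d
  have hd24 : d ^ 2 ≤ d ^ 4 := Nat.pow_le_pow_right hd1 (by norm_num)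
  have hp0 : 0 < p := (Fact.out : p.Prime).pos
  let ι := algebraMap (ZMod p) K
  have hι : Function.Injective ι := ι.injective
  obtain ⟨R, hR0, hRd, hR⟩ := wl_disc p hf hd hc (by omega)
  -- monic fibre polynomial
  have hFm : (finSuccEquiv K M f).Monic := wl_finSucc_monic hd.le hc
  have hFd : (finSuccEquiv K M f).natDegree = d := by
    apply le_antisymm (wl_finSucc_natDegree hd.le)
    apply Polynomial.le_natDegree_of_ne_zero
    rw [wl_finSucc_coeff_top hd.le hc]; exact one_ne_zero
  let fib : (Fin M → ZMod p) → Finset (ZMod p) := fun x =>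
    Finset.univ.filter (fun y => aeval (Fin.cons (ι y) (fun i => ι (x i)) : Fin (M + 1) → K) f = 0)
  have hfib : ∀ x, (fib x).card ≤ d := by
    intro x
    set q := Polynomial.map (eval (fun i => ι (x i))) (finSuccEquiv K M f) with hq
    have hqm : q.Monic := hFm.map _
    have hqd : q.natDegree = d := by rw [hq, hFm.natDegree_map, hFd]
    calc (fib x).card ≤ q.roots.toFinset.card := by
          apply Finset.card_le_card_of_injOn ι
          · intro y hy
            simp only [fib, Finset.coe_filter, Finset.mem_univ, true_and, Set.mem_ofPred_eq] at hy
            rw [wl_aeval_cons] at hy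
            simp only [Finset.mem_coe, Multiset.mem_toFinset]
            exact (Polynomial.mem_roots hqm.ne_zero).mpr hy
          · intro a _ b _ h
            exact hι h
      _ ≤ Multiset.card q.roots := Multiset.toFinset_card_le _
      _ ≤ q.natDegree := Polynomial.card_roots' q
      _ = d := hqd
  have hcons : ∀ v : Fin (M + 1) → ZMod p, (fun i => ι (v i)) =
      (Fin.cons (ι (v 0)) (fun i => ι (v (Fin.succ i))) : Fin (M + 1) → K) := by
    intro v
    ext1 i
    refine Fin.cases ?_ (fun i => ?_) i <;> simp
  constructor
  · let r : (Fin M → ZMod p) → ℝ := fun x => (fib x).card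
    have hN : ((Finset.univ.filter (fun v : Fin (M + 1) → ZMod p => aeval (fun i => ι (v i)) f = 0)).card : ℝ) = ∑ x, r x := by
      rw [← Nat.cast_sum]
      congr 1
      rw [Finset.card_eq_sum_card_fiberwise (f := fun v i => v (Fin.succ i)) (t := Finset.univ) (fun _ _ => by simp)]
      refine Finset.sum_congr rfl fun x _ => ?_
      apply Finset.card_nbij' (fun v => v 0) (fun y => (Fin.cons y x : Fin (M + 1) → ZMod p))
      · intro v hv
        simp only [Finset.coe_filter, Finset.mem_filter, Finset.mem_univ, true_and, Set.mem_ofPred_eq] at hv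
        simp only [fib, Finset.coe_filter, Finset.mem_univ, true_and, Set.mem_ofPred_eq]
        rw [hcons] at hv
        rw [← hv.2]
        exact hv.1
      · intro y hy
        simp only [fib, Finset.coe_filter, Finset.mem_univ, true_and, Set.mem_ofPred_eq] at hy
        simp only [Finset.coe_filter, Finset.mem_filter, Finset.mem_univ, true_and, Set.mem_ofPred_eq]
        rw [hcons]
        simp only [Fin.cons_zero, Fin.cons_succ]
        exact ⟨hy, trivial⟩
      · intro v hv
        simp only [Finset.coe_filter, Finset.mem_filter, Finset.mem_univ, true_and, Set.mem_ofPred_eq] at hv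
        ext1 i
        refine Fin.cases ?_ (fun i => ?_) i
        · simp
        · simp [← hv.2]
      · intro y hy
        simp
    have hΘ : ∀ x0 : Fin M → ZMod p, ∃ Θ : MvPolynomial (Fin M) K, aeval (fun i => ι (x0 i)) R ≠ 0 → (Θ ≠ 0 ∧ Θ.totalDegree ≤ d ^ 4 ∧
      ∀ w, aeval w Θ ≠ 0 → Irreducible (wlSlice (S := K) (fun i => ι (x0 i)) w f)) := by
      intro x0
      by_cases hx0 : aeval (fun i => ι (x0 i)) R = 0
      · exact ⟨0, fun h => absurd hx0 h⟩
      · set q := Polynomial.map (eval (fun i => ι (x0 i))) (finSuccEquiv K M f) with hq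
        have hqm : q.Monic := hFm.map _
        have hqd : q.natDegree = d := by rw [hq, hFm.natDegree_map, hFd]
        obtain ⟨y0, hy0⟩ := IsAlgClosed.exists_root q (by
          intro h
          have := Polynomial.natDegree_eq_of_degree_eq_some h
          rw [hqd] at this
          change d = 0 at this
          omega)
        have hy0' : aeval (Fin.cons y0 (fun i => ι (x0 i)) : Fin (M + 1) → K) f = 0 := by
          rw [wl_aeval_cons]; exact hy0
        obtain ⟨Θ, h1, h2, h3⟩ := wl_bertini hf hd hc (fun j hj => wl_factorial_ne p j (by omega)) (fun i => ι (x0 i)) y0 hy0'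
          (fun h => hx0 (hR _ _ hy0' h))
        exact ⟨Θ, fun _ => ⟨h1, h2, h3⟩⟩
    choose Θ hΘ using hΘ
    let G : Finset ((Fin M → ZMod p) × (Fin M → ZMod p)) := Finset.univ.filter (fun q =>
      aeval (fun i => ι (q.1 i)) R ≠ 0 ∧ aeval (fun i => ι (q.2 i)) (Θ q.1) ≠ 0)
    have hcardV : Fintype.card (Fin M → ZMod p) = p ^ M := by
      rw [Fintype.card_fun, ZMod.card, Fintype.card_fin]
    have hbad : p * (Finset.univ.filter (fun q : (Fin M → ZMod p) × (Fin M → ZMod p) => ¬ (aeval (fun i => ι (q.1 i)) R ≠ 0 ∧ aeval (fun i => ι (q.2 i)) (Θ q.1) ≠ 0))).card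
        ≤ (2 * d ^ 2 + d ^ 4) * (p ^ M * p ^ M) := by
      let B1 := Finset.univ.filter (fun x : Fin M → ZMod p => aeval (fun i => ι (x i)) R = 0)
      let B2 : (Fin M → ZMod p) → Finset (Fin M → ZMod p) := fun x => if aeval (fun i => ι (x i)) R = 0 then ∅ else
        Finset.univ.filter (fun w : Fin M → ZMod p => aeval (fun i => ι (w i)) (Θ x) = 0)
      have hsub : (Finset.univ.filter (fun q : (Fin M → ZMod p) × (Fin M → ZMod p) => ¬ (aeval (fun i => ι (q.1 i)) R ≠ 0 ∧ aeval (fun i => ι (q.2 i)) (Θ q.1) ≠ 0)))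
          ⊆ (B1 ×ˢ Finset.univ) ∪ ((Finset.univ.sigma B2).image (fun z => (z.1, z.2))) := by
        rintro ⟨x, w⟩ hq
        simp only [Finset.mem_filter, Finset.mem_univ, true_and] at hq
        by_cases hx : aeval (fun i => ι (x i)) R = 0
        · apply Finset.mem_union_left
          exact Finset.mem_product.mpr ⟨Finset.mem_filter.mpr ⟨Finset.mem_univ _, hx⟩, Finset.mem_univ _⟩
        · apply Finset.mem_union_right
          rw [Finset.mem_image]
          refine ⟨⟨x, w⟩, ?_, rfl⟩
          simp only [Finset.mem_sigma, Finset.mem_univ, true_and, B2, hx, if_false, Finset.mem_filter]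
          by_contra hw
          exact hq ⟨hx, hw⟩
      have h1 : p * B1.card ≤ 2 * d ^ 2 * p ^ M := (wl_sz p hR0).trans (Nat.mul_le_mul_right _ hRd)
      have h2 : ∀ x, p * (B2 x).card ≤ d ^ 4 * p ^ M := by
        intro x
        by_cases hx : aeval (fun i => ι (x i)) R = 0
        · simp only [B2, hx, if_true, Finset.card_empty, mul_zero, Nat.zero_le]
        · simp only [B2, hx, if_false]
          exact (wl_sz p (hΘ x hx).1).trans (Nat.mul_le_mul_right _ (hΘ x hx).2.1)
      calc _ ≤ p * (B1.card * p ^ M + ∑ x, (B2 x).card) := by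
            apply Nat.mul_le_mul_left
            refine (Finset.card_le_card hsub).trans ((Finset.card_union_le _ _).trans ?_)
            rw [Finset.card_product, Finset.card_univ, hcardV]
            apply Nat.add_le_add_left
            refine Finset.card_image_le.trans ?_
            rw [Finset.card_sigma]
        _ = p * B1.card * p ^ M + ∑ x, p * (B2 x).card := by rw [mul_add, Finset.mul_sum]; ring
        _ ≤ 2 * d ^ 2 * p ^ M * p ^ M + ∑ x : Fin M → ZMod p, d ^ 4 * p ^ M :=
            Nat.add_le_add (Nat.mul_le_mul_right _ h1) (Finset.sum_le_sum fun x _ => h2 x)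
        _ = _ := by rw [Finset.sum_const, Finset.card_univ, hcardV, smul_eq_mul]; ring
    have hGcard : ((Fintype.card (Fin M → ZMod p) : ℕ) : ℝ) ^ 2 ≤ 2 * G.card := by
      have h1 := Finset.card_filter_add_card_filter_not (s := (Finset.univ : Finset ((Fin M → ZMod p) × (Fin M → ZMod p))))
        (fun q => aeval (fun i => ι (q.1 i)) R ≠ 0 ∧ aeval (fun i => ι (q.2 i)) (Θ q.1) ≠ 0)
      rw [Finset.card_univ, Fintype.card_prod, hcardV] at h1
      set bad := (Finset.univ.filter (fun q : (Fin M → ZMod p) × (Fin M → ZMod p) => ¬ (aeval (fun i => ι (q.1 i)) R ≠ 0 ∧ aeval (fun i => ι (q.2 i)) (Θ q.1) ≠ 0))).card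
      have h2 : 2 * bad ≤ p ^ M * p ^ M := by
        apply Nat.le_of_mul_le_mul_left _ hp0
        calc p * (2 * bad) = 2 * (p * bad) := by ring
          _ ≤ 2 * ((2 * d ^ 2 + d ^ 4) * (p ^ M * p ^ M)) := Nat.mul_le_mul_left _ hbad
          _ = (2 * (2 * d ^ 2 + d ^ 4)) * (p ^ M * p ^ M) := by ring
          _ ≤ p * (p ^ M * p ^ M) := Nat.mul_le_mul_right _ (by omega)
      have h3 : p ^ M * p ^ M ≤ 2 * G.card := by
        change G.card + bad = _ at h1
        omega
      rw [hcardV, pow_two]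
      exact_mod_cast h3
    have hU : ∀ q ∈ G, ∑ t : ZMod p, r (q.1 + t • q.2) ≤ (p : ℝ) + 15 * d ^ 2 * Real.sqrt p := by
      rintro ⟨x0, w⟩ hq
      simp only [G, Finset.mem_filter, Finset.mem_univ, true_and] at hq
      have hirr := (hΘ x0 hq.1).2.2 _ hq.2
      let T : Finset ((_ : ZMod p) × ZMod p) := Finset.univ.sigma (fun t => fib (x0 + t • w))
      have hT : T.card ≤ p + 15 * d ^ 2 * Nat.sqrt p := by
        have hinj : Function.Injective (fun z : (_ : ZMod p) × ZMod p => (![ι z.2, ι z.1] : Fin 2 → K)) := by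
          rintro ⟨a, b⟩ ⟨a', b'⟩ h
          have h0 := hι (congrFun h 0)
          have h1 := hι (congrFun h 1)
          simp only at h0 h1
          subst h0 h1
          rfl
        rw [← Finset.card_image_of_injective T hinj]
        refine wl_plane_count p hirr d (wlSlice_totalDegree _ _ hd hc) (by rw [wlSlice_coeff _ _ hd.le hc]; exact one_ne_zero) hp _ ?_
        intro P hP
        rw [Finset.mem_image] at hP
        obtain ⟨⟨t, y⟩, hz, rfl⟩ := hP
        simp only [T, fib, Finset.mem_sigma, Finset.mem_univ, true_and, Finset.mem_filter] at hz
        refine ⟨?_, ?_⟩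
        · rw [wl_slice_eval2, ← hz]
          simp
        · intro j
          fin_cases j
          · change ι y ^ p = ι y
            rw [← map_pow, ZMod.pow_card]
          · change ι t ^ p = ι t
            rw [← map_pow, ZMod.pow_card]
      have hsum : ∑ t : ZMod p, r (x0 + t • w) = (T.card : ℝ) := by
        rw [Finset.card_sigma, Nat.cast_sum]
      rw [hsum]
      have hs : (Nat.sqrt p : ℝ) ≤ Real.sqrt p := Real.nat_sqrt_le_real_sqrt
      calc (T.card : ℝ) ≤ ((p + 15 * d ^ 2 * Nat.sqrt p : ℕ) : ℝ) := by exact_mod_cast hT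
        _ = p + 15 * d ^ 2 * (Nat.sqrt p : ℝ) := by push_cast; ring
        _ ≤ _ := by gcongr
    have hfin := wl_line_bound (F := ZMod p) r (d : ℝ) _ (fun x => Nat.cast_nonneg _) (fun x => Nat.cast_le.mpr (hfib x)) (Nat.cast_nonneg _) G hGcard hU
    rw [ZMod.card, hcardV, ← hN] at hfin
    have hp0' : (0 : ℝ) < p := by exact_mod_cast hp0
    have hs := Real.sq_sqrt hp0'.le
    have hs0 := Real.sqrt_pos.mpr hp0'
    have hdd : (d : ℝ) ≤ d ^ 2 := by exact_mod_cast Nat.le_self_pow (by norm_num) d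
    refine le_of_mul_le_mul_left (hfin.trans ?_) hp0'
    have e : (p : ℝ) * (p ^ M + 17 * d ^ 2 * (p ^ M / Real.sqrt p)) = (p : ℝ) ^ M * (p + 17 * d ^ 2 * Real.sqrt p) := by
      have : (p : ℝ) / Real.sqrt p = Real.sqrt p := Real.div_sqrt
      calc _ = (p : ℝ) ^ M * (p + 17 * d ^ 2 * (p / Real.sqrt p)) := by ring
        _ = _ := by rw [this]
    rw [e, Nat.cast_pow]
    refine mul_le_mul_of_nonneg_left ?_ (by positivity)
    have h9 : (d : ℝ) * Real.sqrt p ≤ d ^ 2 * Real.sqrt p := by gcongr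
    linarith
  · have h1 : (Finset.univ.filter (fun v : Fin (M + 1) → ZMod p => aeval (fun i => ι (v i)) f = 0 ∧
      aeval (fun i => ι (v i)) (pderiv 0 f) = 0)).card ≤ d * (Finset.univ.filter (fun x : Fin M → ZMod p => aeval (fun i => ι (x i)) R = 0)).card := by
      apply Finset.card_le_mul_card_image_of_maps_to (f := fun v i => v (Fin.succ i))
      · intro v hv
        simp only [Finset.mem_filter, Finset.mem_univ, true_and] at hv ⊢
        rw [hcons] at hv
        exact hR _ _ hv.1 hv.2
      · intro x _
        refine le_trans ?_ (hfib x)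
        apply Finset.card_le_card_of_injOn (fun v => v 0)
        · intro v hv
          simp only [Finset.coe_filter, Finset.mem_filter, Finset.mem_univ, true_and, Set.mem_ofPred_eq] at hv
          simp only [fib, Finset.coe_filter, Finset.mem_univ, true_and, Set.mem_ofPred_eq]
          rw [hcons] at hv
          rw [← hv.2]
          exact hv.1.1
        · intro v hv v' hv' h
          simp only [Finset.coe_filter, Finset.mem_filter, Finset.mem_univ, true_and, Set.mem_ofPred_eq] at hv hv'
          ext1 i
          refine Fin.cases h (fun i => ?_) i
          exact congrFun (hv.2.trans hv'.2.symm) i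
    have h2 : p * (Finset.univ.filter (fun x : Fin M → ZMod p => aeval (fun i => ι (x i)) R = 0)).card ≤ 2 * d ^ 2 * p ^ M :=
      (wl_sz p hR0).trans (Nat.mul_le_mul_right _ hRd)
    calc _ ≤ p * (d * (Finset.univ.filter (fun x : Fin M → ZMod p => aeval (fun i => ι (x i)) R = 0)).card) := Nat.mul_le_mul_left _ h1
      _ = d * (p * (Finset.univ.filter (fun x : Fin M → ZMod p => aeval (fun i => ι (x i)) R = 0)).card) := by ring
      _ ≤ d * (2 * d ^ 2 * p ^ M) := Nat.mul_le_mul_left _ h2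
      _ = _ := by ring
end count


section lin
variable {K : Type*} [Field K] {m : ℕ}

/-- linear substitution -/
noncomputable def wlLin (A : Matrix (Fin m) (Fin m) K) : MvPolynomial (Fin m) K →ₐ[K] MvPolynomial (Fin m) K :=
  aeval (fun i => ∑ j, C (A i j) * X j)

theorem wlLin_comp (A B : Matrix (Fin m) (Fin m) K) (f : MvPolynomial (Fin m) K) :
    wlLin A (wlLin B f) = wlLin (B * A) f := by
  have : (wlLin A).comp (wlLin B) = wlLin (B * A) := by
    apply algHom_ext
    intro i
    simp only [wlLin, AlgHom.comp_apply, aeval_X, map_sum, map_mul, algHom_C, Matrix.mul_apply, MvPolynomial.algebraMap_eq]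
    simp only [Finset.mul_sum, Finset.sum_mul, C_mul]
    rw [Finset.sum_comm]
    simp only [mul_assoc]
  exact DFunLike.congr_fun this f

theorem wlLin_one (f : MvPolynomial (Fin m) K) : wlLin 1 f = f := by
  have : wlLin (1 : Matrix (Fin m) (Fin m) K) = AlgHom.id K _ := by
    apply algHom_ext
    intro i
    simp only [wlLin, aeval_X, AlgHom.id_apply]
    rw [Finset.sum_eq_single i]
    · simp
    · intro j _ hj
      rw [Matrix.one_apply_ne hj.symm]; simp
    · simp
  rw [this]; rfl

theorem wlLin_eval (A : Matrix (Fin m) (Fin m) K) (x : Fin m → K) (f : MvPolynomial (Fin m) K) :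
    aeval x (wlLin A f) = aeval (A.mulVec x) f := by
  have : (aeval x).comp (wlLin A) = aeval (A.mulVec x) := by
    apply algHom_ext
    intro i
    simp [wlLin, Matrix.mulVec, dotProduct]
  exact DFunLike.congr_fun this f

theorem wlLin_pderiv (A : Matrix (Fin m) (Fin m) K) (k : Fin m) (f : MvPolynomial (Fin m) K) :
    pderiv k (wlLin A f) = ∑ i, C (A i k) * wlLin A (pderiv i f) := by
  induction f using MvPolynomial.induction_on with
  | C a => simp [wlLin]
  | add a b ha hb => simp only [map_add, ha, hb, mul_add, Finset.sum_add_distrib]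
  | mul_X a i ha =>
    have h1 : pderiv k (wlLin A (X i)) = C (A i k) := by
      simp only [wlLin, aeval_X, map_sum, pderiv_C_mul, pderiv_X]
      rw [Finset.sum_eq_single k]
      · simp
      · intro j _ hj
        rw [Pi.single_eq_of_ne hj]; simp
      · simp
    rw [map_mul, pderiv_mul, ha, h1]
    simp only [pderiv_mul, map_add, map_mul, mul_add, Finset.sum_add_distrib, Finset.sum_mul]
    congr 1
    · refine Finset.sum_congr rfl fun j _ => by ring
    · rw [Finset.sum_eq_single i]
      · simp [mul_comm]
      · intro j _ hj
        rw [pderiv_X_of_ne hj.symm]; simp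
      · simp

theorem wlLin_irreducible {A A' : Matrix (Fin m) (Fin m) K} (h1 : A * A' = 1) (h2 : A' * A = 1)
    {f : MvPolynomial (Fin m) K} (hf : Irreducible f) : Irreducible (wlLin A f) := by
  let e : MvPolynomial (Fin m) K ≃ₐ[K] MvPolynomial (Fin m) K :=
    AlgEquiv.ofAlgHom (wlLin A) (wlLin A')
      (by ext1 i; rw [AlgHom.comp_apply, wlLin_comp, h2, wlLin_one]; rfl)
      (by ext1 i; rw [AlgHom.comp_apply, wlLin_comp, h1, wlLin_one]; rfl)
  exact (MulEquiv.irreducible_iff e).mpr hf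

theorem wlLin_homog (A : Matrix (Fin m) (Fin m) K) {f : MvPolynomial (Fin m) K} {d : ℕ} (hf : f.IsHomogeneous d) :
    (wlLin A f).IsHomogeneous d := by
  have := hf.aeval (S := K) (fun i => ∑ j, C (A i j) * X j) (n := 1) (fun i => by
    apply IsHomogeneous.sum
    intro j _
    simpa using (isHomogeneous_C (Fin m) (A i j)).mul (isHomogeneous_X K j))
  rwa [one_mul] at this

end lin

theorem wl_matrix_col {F : Type*} [Field F] {M : ℕ} (v : Fin (M + 1) → F) (hv : v ≠ 0) :
    ∃ A A' : Matrix (Fin (M + 1)) (Fin (M + 1)) F, A * A' = 1 ∧ A' * A = 1 ∧ ∀ i, A i 0 = v i := by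
  obtain ⟨k, hk⟩ := Function.ne_iff.mp hv
  let A : Matrix (Fin (M + 1)) (Fin (M + 1)) F := ((1 : Matrix (Fin (M + 1)) (Fin (M + 1)) F).updateCol k v).submatrix id (Equiv.swap 0 k)
  have hdet : IsUnit A.det := by
    rw [Matrix.det_permute']
    apply IsUnit.mul
    · rcases Int.units_eq_one_or (Equiv.Perm.sign (Equiv.swap 0 k)) with h | h <;> simp [h]
    · rw [← Matrix.cramer_apply, Matrix.cramer_one]
      exact IsUnit.mk0 _ hk
  refine ⟨A, A⁻¹, Matrix.mul_nonsing_inv _ hdet, Matrix.nonsing_inv_mul _ hdet, fun i => ?_⟩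
  simp [A]

theorem wl_coeff_single {K : Type*} [Field K] {M d : ℕ} {g : MvPolynomial (Fin (M + 1)) K} (hg : g.IsHomogeneous d) :
    coeff (Finsupp.single 0 d) g = aeval (Pi.single 0 1 : Fin (M + 1) → K) g := by
  classical
  rw [aeval_def, eval₂_eq']
  simp only [Algebra.algebraMap_self, RingHom.id_apply]
  have hterm : ∀ a ∈ g.support, a ≠ Finsupp.single 0 d → coeff a g * ∏ i, (Pi.single 0 1 : Fin (M + 1) → K) i ^ a i = 0 := by
    intro a ha hne
    have hdeg : ∑ i, a i = d := by
      have := hg (mem_support_iff.mp ha)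
      rw [← this, Finsupp.weight_apply, ← wl_sum_eq_univ]
      simp
    have : ∃ i, i ≠ 0 ∧ a i ≠ 0 := by
      by_contra hcon
      push Not at hcon
      apply hne
      have h0 : a 0 = d := by
        rw [← hdeg, Finset.sum_eq_single 0 (fun i _ hi => hcon i hi) (by simp)]
      ext i
      by_cases hi : i = 0
      · subst hi; simp [h0]
      · rw [hcon i hi, Finsupp.single_eq_of_ne hi]
    obtain ⟨i, hi, hai⟩ := this
    rw [Finset.prod_eq_zero (Finset.mem_univ i), mul_zero]
    rw [Pi.single_eq_of_ne hi, zero_pow hai]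
  by_cases hs : Finsupp.single 0 d ∈ g.support
  · rw [Finset.sum_eq_single_of_mem _ hs hterm, Fin.prod_univ_succ]
    simp
  · rw [Finset.sum_eq_zero (fun a ha => hterm a ha (fun h => hs (h ▸ ha)))]
    exact notMem_support_iff.mp hs

/-- weighted count on the cone -/
theorem wl_cone_count {K : Type*} [Field K] {M : ℕ} [IsAlgClosed K] (p : ℕ) [Fact p.Prime] [CharP K p] [Algebra (ZMod p) K] [DecidableEq K]
    {d : ℕ} {f : MvPolynomial (Fin (M + 1)) K} (hf : Irreducible f) (hh : f.IsHomogeneous d) (hp : 16 * d ^ 4 ≤ p) :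
    ((Finset.univ.filter (fun v : Fin (M + 1) → ZMod p => aeval (fun i => algebraMap (ZMod p) K (v i)) f = 0)).card : ℝ)
    + d * ((Finset.univ.filter (fun v : Fin (M + 1) → ZMod p => aeval (fun i => algebraMap (ZMod p) K (v i)) f = 0 ∧
      ∀ k, aeval (fun i => algebraMap (ZMod p) K (v i)) (pderiv k f) = 0)).card : ℝ)
      ≤ p ^ M * (1 + 19 * d ^ 2 / Real.sqrt p) := by
  classical
  let ι := algebraMap (ZMod p) K
  have hι : Function.Injective ι := ι.injective
  have hp0 : 0 < p := (Fact.out : p.Prime).pos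
  have hfd : f.totalDegree = d := hh.totalDegree hf.ne_zero
  have hd1 : 1 ≤ d := hfd ▸ wl_pos_of_irreducible hf
  have hd4 : d ≤ d ^ 4 := Nat.le_self_pow (by norm_num) d
  -- a point off the cone
  have hv : ∃ v : Fin (M + 1) → ZMod p, aeval (fun i => ι (v i)) f ≠ 0 := by
    by_contra hcon
    push Not at hcon
    have h1 := wl_sz (K := K) p hf.ne_zero
    rw [Finset.filter_true_of_mem (fun v _ => hcon v), Finset.card_univ, Fintype.card_fun, ZMod.card, Fintype.card_fin, hfd] at h1
    have := Nat.le_of_mul_le_mul_right h1 (by positivity)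
    omega
  obtain ⟨v, hv⟩ := hv
  have hv0 : v ≠ 0 := by
    rintro rfl
    apply hv
    simp only [Pi.zero_apply, map_zero]
    rw [aeval_def, eval₂_eq']
    apply Finset.sum_eq_zero
    intro a ha
    have hdeg : ∑ i, a i = d := by
      have := hh (mem_support_iff.mp ha)
      rw [← this, Finsupp.weight_apply, ← wl_sum_eq_univ]
      simp
    obtain ⟨i, -, hi⟩ : ∃ i ∈ Finset.univ, a i ≠ 0 := by
      apply Finset.exists_ne_zero_of_sum_ne_zero
      omega
    rw [Finset.prod_eq_zero (Finset.mem_univ i) (zero_pow hi), mul_zero]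
  obtain ⟨A0, A0', h1, h2, hcol⟩ := wl_matrix_col v hv0
  let A := A0.map ι
  let A' := A0'.map ι
  have hA1 : A * A' = 1 := by rw [← Matrix.map_mul, h1, Matrix.map_one _ (map_zero _) (map_one _)]
  have hA2 : A' * A = 1 := by rw [← Matrix.map_mul, h2, Matrix.map_one _ (map_zero _) (map_one _)]
  set a := aeval (fun i => ι (v i)) f with ha
  set g := C a⁻¹ * wlLin A f with hg
  have hgirr : Irreducible g := by
    have hu : IsUnit (C a⁻¹ : MvPolynomial (Fin (M + 1)) K) := (IsUnit.mk0 _ (inv_ne_zero hv)).map C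
    obtain ⟨u, hu⟩ := hu
    rw [hg, ← hu, irreducible_units_mul]
    exact wlLin_irreducible hA1 hA2 hf
  have hgh : g.IsHomogeneous d := by
    have := (isHomogeneous_C (Fin (M + 1)) a⁻¹).mul (wlLin_homog A hh)
    rwa [zero_add] at this
  have hgd : g.totalDegree = d := hgh.totalDegree hgirr.ne_zero
  have hgc : coeff (Finsupp.single 0 d) g = 1 := by
    rw [wl_coeff_single hgh, hg, map_mul, wlLin_eval]
    have : A.mulVec (Pi.single 0 1) = fun i => ι (v i) := by
      ext i
      simp [A, hcol]
    rw [this, ← ha]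
    simp [hv]
  have hgeval : ∀ x : Fin (M + 1) → ZMod p, aeval (fun i => ι (x i)) g = a⁻¹ * aeval (fun i => ι (A0.mulVec x i)) f := by
    intro x
    rw [hg, map_mul, wlLin_eval]
    congr 1
    · simp
    · congr 1
      congr 1
      ext i
      simp [A, Matrix.mulVec, dotProduct]
  have hgp : ∀ x : Fin (M + 1) → ZMod p, (∀ k, aeval (fun i => ι (A0.mulVec x i)) (pderiv k f) = 0) → aeval (fun i => ι (x i)) (pderiv 0 g) = 0 := by
    intro x hx
    rw [hg, pderiv_C_mul, wlLin_pderiv, map_mul, map_sum, Finset.sum_eq_zero, mul_zero]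
    intro i _
    rw [map_mul, wlLin_eval]
    have : A.mulVec (fun i => ι (x i)) = fun i => ι (A0.mulVec x i) := by
      ext i
      simp [A, Matrix.mulVec, dotProduct]
    rw [this, hx, mul_zero]
  have hbij : ∀ x, A0.mulVec (A0'.mulVec x) = x := fun x => by rw [Matrix.mulVec_mulVec, h1, Matrix.one_mulVec]
  have hinj : Function.Injective (fun x => A0'.mulVec x) := fun x y h => by
    rw [← hbij x, ← hbij y]; exact congrArg _ h
  obtain ⟨hc1, hc2⟩ := wl_count_normalized p hgirr hgd hgc hp
  have e1 : (Finset.univ.filter (fun v : Fin (M + 1) → ZMod p => aeval (fun i => ι (v i)) f = 0)).card ≤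
      (Finset.univ.filter (fun v : Fin (M + 1) → ZMod p => aeval (fun i => ι (v i)) g = 0)).card := by
    apply Finset.card_le_card_of_injOn (fun x => A0'.mulVec x) _ hinj.injOn
    intro x hx
    simp only [Finset.coe_filter, Finset.mem_univ, true_and, Set.mem_ofPred_eq] at hx ⊢
    rw [hgeval, hbij, hx, mul_zero]
  have e2 : (Finset.univ.filter (fun v : Fin (M + 1) → ZMod p => aeval (fun i => ι (v i)) f = 0 ∧
      ∀ k, aeval (fun i => ι (v i)) (pderiv k f) = 0)).card ≤ (Finset.univ.filter (fun v : Fin (M + 1) → ZMod p => aeval (fun i => ι (v i)) g = 0 ∧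
      aeval (fun i => ι (v i)) (pderiv 0 g) = 0)).card := by
    apply Finset.card_le_card_of_injOn (fun x => A0'.mulVec x) _ hinj.injOn
    intro x hx
    simp only [Finset.coe_filter, Finset.mem_univ, true_and, Set.mem_ofPred_eq] at hx ⊢
    refine ⟨by rw [hgeval, hbij, hx.1, mul_zero], hgp _ ?_⟩
    rw [hbij]; exact hx.2
  set N0 := (Finset.univ.filter (fun v : Fin (M + 1) → ZMod p => aeval (fun i => ι (v i)) g = 0)).card
  set Ns := (Finset.univ.filter (fun v : Fin (M + 1) → ZMod p => aeval (fun i => ι (v i)) g = 0 ∧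
      aeval (fun i => ι (v i)) (pderiv 0 g) = 0)).card
  have hp0' : (0 : ℝ) < p := by exact_mod_cast hp0
  have hs := Real.mul_self_sqrt hp0'.le
  have hs0 := Real.sqrt_pos.mpr hp0'
  have hsd : (d : ℝ) ^ 2 ≤ Real.sqrt p := by
    apply Real.le_sqrt_of_sq_le
    have : ((d : ℝ) ^ 2) ^ 2 = d ^ 4 := by ring
    rw [this]
    have h16 : ((16 * d ^ 4 : ℕ) : ℝ) ≤ p := by exact_mod_cast hp
    push_cast at h16
    have : (0 : ℝ) ≤ (d : ℝ) ^ 4 := by positivity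
    linarith
  have hNs : (d : ℝ) * Ns ≤ 2 * d ^ 2 * (p ^ M / Real.sqrt p) := by
    have h3 : (p : ℝ) * Ns ≤ 2 * d ^ 3 * p ^ M := by exact_mod_cast hc2
    have h4 : (d : ℝ) * Ns ≤ 2 * d ^ 4 * p ^ M / p := by
      rw [le_div_iff₀ hp0']
      calc (d : ℝ) * Ns * p = d * (p * Ns) := by ring
        _ ≤ d * (2 * d ^ 3 * p ^ M) := by gcongr
        _ = _ := by ring
    refine h4.trans ?_
    calc 2 * (d : ℝ) ^ 4 * p ^ M / p = 2 * d ^ 2 * (p ^ M / Real.sqrt p) * (d ^ 2 / Real.sqrt p) := by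
          field_simp; exact Real.sq_sqrt hp0'.le
      _ ≤ 2 * d ^ 2 * (p ^ M / Real.sqrt p) * 1 := by
          gcongr
          rw [div_le_one hs0]; exact hsd
      _ = _ := by ring
  have e1' : ((Finset.univ.filter (fun v : Fin (M + 1) → ZMod p => aeval (fun i => ι (v i)) f = 0)).card : ℝ) ≤ N0 := by exact_mod_cast e1
  have e2' : ((Finset.univ.filter (fun v : Fin (M + 1) → ZMod p => aeval (fun i => ι (v i)) f = 0 ∧
      ∀ k, aeval (fun i => ι (v i)) (pderiv k f) = 0)).card : ℝ) ≤ Ns := by exact_mod_cast e2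
  calc _ ≤ (N0 : ℝ) + d * Ns := add_le_add e1' (mul_le_mul_of_nonneg_left e2' (Nat.cast_nonneg _))
    _ ≤ (p ^ M + 17 * d ^ 2 * (p ^ M / Real.sqrt p)) + 2 * d ^ 2 * (p ^ M / Real.sqrt p) := add_le_add hc1 hNs
    _ = _ := by ring


/-- multilinear expansion: divisibility of a determinant by a power of `π` -/
theorem wl_det_dvd {R G : Type*} [CommRing R] [Fintype G] {s : ℕ} (π : R) (w : G → ℕ) (ψ : G → Fin s → R)
    (a : Fin s → G → R) (e : ℕ) (he : ∀ g : Fin s → G, Function.Injective g → e ≤ ∑ j, w (g j))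
    (A : Matrix (Fin s) (Fin s) R) (hA : ∀ i j, A i j = ∑ g, a j g * (π ^ w g * ψ g i)) :
    π ^ e ∣ A.det := by
  classical
  have h1 : A.transpose = fun j => ∑ g, a j g • (π ^ w g • ψ g) := by
    ext j i
    rw [Matrix.transpose_apply, hA, Finset.sum_apply]
    simp
  have h2 : A.det = Matrix.detRowAlternating (fun j => ∑ g, a j g • (π ^ w g • ψ g)) := by
    rw [← Matrix.det_transpose, h1]; rfl
  rw [h2, ← AlternatingMap.coe_multilinearMap, MultilinearMap.map_sum]
  apply Finset.dvd_sum
  intro g _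
  rw [MultilinearMap.map_smul_univ, MultilinearMap.map_smul_univ, smul_eq_mul, smul_eq_mul]
  by_cases hg : Function.Injective g
  · apply Dvd.dvd.mul_left
    apply Dvd.dvd.mul_right
    rw [Finset.prod_pow_eq_pow_sum]
    exact pow_dvd_pow _ (he g hg)
  · have : (Matrix.detRowAlternating : (Fin s → R) [⋀^Fin s]→ₗ[R] R) (fun j => ψ (g j)) = 0 := by
      simp only [Function.Injective, not_forall] at hg
      obtain ⟨i, j, hij, hne⟩ := hg
      exact AlternatingMap.map_eq_zero_of_eq _ _ (by simp only [hij]) hne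
    rw [AlternatingMap.coe_multilinearMap, this, mul_zero, mul_zero]
    exact dvd_zero _

/-- sum of the weights of distinct generators -/
theorem wl_weight_sum {G : Type*} [Fintype G] {s : ℕ} (w : G → ℕ) (K : ℕ) (N : ℕ → ℕ)
    (hw : ∀ k < K, (Finset.univ.filter (fun g => w g ≤ k)).card ≤ N k) (g : Fin s → G) (hg : Function.Injective g) :
    K * s ≤ ∑ j, w (g j) + ∑ k ∈ Finset.range K, N k := by
  classical
  have h1 : ∀ j, (∑ k ∈ Finset.range K, if k < w (g j) then 1 else 0) ≤ w (g j) := by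
    intro j
    rw [← Finset.card_filter]
    calc _ ≤ (Finset.range (w (g j))).card := Finset.card_le_card (by
          intro k; simp only [Finset.mem_filter, Finset.mem_range]; exact fun h => h.2)
      _ = _ := Finset.card_range _
  have h2 : ∀ k ∈ Finset.range K, s ≤ (∑ j, if k < w (g j) then 1 else 0) + N k := by
    intro k hk
    rw [← Finset.card_filter]
    have h3 : (Finset.univ.filter (fun j => ¬ k < w (g j))).card ≤ N k := by
      refine le_trans ?_ (hw k (Finset.mem_range.mp hk))
      apply Finset.card_le_card_of_injOn g _ hg.injOn
      intro j
      simp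
    have h4 := Finset.card_filter_add_card_filter_not (s := (Finset.univ : Finset (Fin s))) (fun j => k < w (g j))
    rw [Finset.card_univ, Fintype.card_fin] at h4
    omega
  calc K * s = ∑ k ∈ Finset.range K, s := by simp
    _ ≤ ∑ k ∈ Finset.range K, ((∑ j, if k < w (g j) then 1 else 0) + N k) := Finset.sum_le_sum h2
    _ = (∑ j, ∑ k ∈ Finset.range K, if k < w (g j) then 1 else 0) + ∑ k ∈ Finset.range K, N k := by
      rw [Finset.sum_add_distrib, Finset.sum_comm]
    _ ≤ _ := Nat.add_le_add_right (Finset.sum_le_sum fun j _ => h1 j) _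

theorem wl_reduced_count (n k : ℕ) (α : Fin (n + 1) →₀ ℕ) :
    ((wlMonLE (n + 1) k).filter (fun β => ¬ α ≤ β)).card ≤ (∑ i, α i) * (n + k).choose n := by
  classical
  have hsub : (wlMonLE (n + 1) k).filter (fun β => ¬ α ≤ β) ⊆
      (Finset.univ : Finset (Fin (n + 1))).biUnion (fun j => (Finset.range (α j)).biUnion
        (fun b => (wlMonLE (n + 1) k).filter (fun β => β j = b))) := by
    intro β
    simp only [Finset.mem_filter, Finset.mem_biUnion, Finset.mem_univ, true_and, Finset.mem_range]
    rintro ⟨h1, h2⟩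
    rw [Finsupp.le_def] at h2
    push Not at h2
    obtain ⟨j, hj⟩ := h2
    exact ⟨j, β j, hj, h1, rfl⟩
  have hone : ∀ j b, ((wlMonLE (n + 1) k).filter (fun β => β j = b)).card ≤ (n + k).choose n := by
    intro j b
    rw [← wl_card_monLE]
    apply Finset.card_le_card_of_injOn (fun β => Finsupp.equivFunOnFinite.symm (fun i => β (j.succAbove i)))
    · intro β
      simp only [Finset.coe_filter, Set.mem_ofPred_eq, Finset.mem_coe, wl_mem_monLE]
      rintro ⟨h1, -⟩
      rw [Fin.sum_univ_succAbove _ j] at h1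
      simp only [Finsupp.equivFunOnFinite_symm_apply_apply]
      omega
    · intro β hβ β' hβ' h
      simp only [Finset.coe_filter, Set.mem_ofPred_eq] at hβ hβ'
      have h' := Finsupp.equivFunOnFinite.symm.injective h
      ext i
      rcases Fin.eq_self_or_eq_succAbove j i with rfl | ⟨i, rfl⟩
      · rw [hβ.2, hβ'.2]
      · exact congrFun h' i
  calc _ ≤ _ := Finset.card_le_card hsub
    _ ≤ ∑ j, ((Finset.range (α j)).biUnion
        (fun b => (wlMonLE (n + 1) k).filter (fun β => β j = b))).card := Finset.card_biUnion_le
    _ ≤ ∑ j, α j * (n + k).choose n := by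
      refine Finset.sum_le_sum fun j _ => ?_
      refine Finset.card_biUnion_le.trans ?_
      calc _ ≤ ∑ b ∈ Finset.range (α j), (n + k).choose n := Finset.sum_le_sum fun b _ => hone j b
        _ = _ := by simp
    _ = _ := by rw [Finset.sum_mul]

theorem wl_span {R I : Type*} [CommRing R] [Nontrivial R] {m : ℕ} (π : R) (hloc : ∀ r : R, IsUnit r ∨ π ∣ r)
    (q : MvPolynomial (Fin m) R) (α0 : Fin m →₀ ℕ) (hα0 : IsUnit (coeff α0 q))
    (hmin : ∀ α, IsUnit (coeff α q) → α ≠ α0 → MonomialOrder.degLex.toSyn α0 < MonomialOrder.degLex.toSyn α)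
    (χ : I → R) (T : I → Fin m → R) (hT : ∀ i j, π ∣ T i j) (hq : ∀ i, χ i * eval (T i) q = 0)
    (K : ℕ) (N : Submodule R (I → R))
    (hN1 : ∀ β : Fin m →₀ ℕ, ¬ α0 ≤ β → ∑ j, β j < K → (fun i => χ i * ∏ j, T i j ^ β j) ∈ N)
    (hN2 : ∀ v : I → R, π ^ K • v ∈ N) :
    ∀ β : Fin m →₀ ℕ, (fun i => χ i * ∏ j, T i j ^ β j) ∈ N := by
  classical
  set φ : (Fin m →₀ ℕ) → I → R := fun β i => χ i * ∏ j, T i j ^ β j with hφ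
  have htriv : ∀ v β, K ≤ v + ∑ j, β j → π ^ v • φ β ∈ N := by
    intro v β hv
    have : ∀ i, π ^ (∑ j, β j) ∣ φ β i := by
      intro i
      apply Dvd.dvd.mul_left
      rw [← Finset.prod_pow_eq_pow_sum]
      exact Finset.prod_dvd_prod_of_dvd _ _ fun j _ => pow_dvd_pow_of_dvd (hT i j) _
    choose ψ hψ using this
    have h2 : π ^ v • φ β = π ^ K • (π ^ (v + ∑ j, β j - K) • ψ) := by
      ext i
      simp only [Pi.smul_apply, smul_eq_mul]
      rw [hψ, ← mul_assoc, ← pow_add, ← mul_assoc, ← pow_add]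
      congr 2; omega
    rw [h2]
    exact hN2 _
  have key : ∀ t v, K ≤ v + t → ∀ c β, ((wlMonLE m K).filter (fun β' => MonomialOrder.degLex.toSyn β < MonomialOrder.degLex.toSyn β')).card = c →
      π ^ v • φ β ∈ N := by
    intro t
    induction t with
    | zero => intro v hv c β _; exact htriv v β (by omega)
    | succ t iht =>
      intro v hv c
      induction c using Nat.strong_induction_on with
      | _ c ihc =>
        intro β hc
        by_cases hβ : K ≤ ∑ j, β j
        · exact htriv _ _ (by omega)
        by_cases hle : α0 ≤ β
        swap
        · exact N.smul_mem _ (hN1 β hle (by omega))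
        obtain ⟨γ, rfl⟩ := exists_add_of_le hle
        have hrel : ∑ α ∈ q.support, coeff α q • φ (α + γ) = 0 := by
          ext i
          rw [Finset.sum_apply]
          have h0 := hq i
          rw [eval_eq'] at h0
          simp only [Pi.smul_apply, smul_eq_mul, hφ, Finsupp.add_apply, pow_add, Finset.prod_mul_distrib, Pi.zero_apply]
          calc _ = χ i * (∑ α ∈ q.support, coeff α q * ∏ j, T i j ^ α j) * ∏ j, T i j ^ γ j := by
                rw [Finset.mul_sum, Finset.sum_mul]
                exact Finset.sum_congr rfl fun α _ => by ring
            _ = 0 := by rw [h0, zero_mul]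
        have hmem : α0 ∈ q.support := by
          rw [mem_support_iff]
          intro h0
          rw [h0] at hα0
          exact not_isUnit_zero hα0
        rw [← Finset.add_sum_erase _ _ hmem] at hrel
        obtain ⟨u, hu⟩ := hα0
        have h3 : π ^ v • φ (α0 + γ) = -((↑u⁻¹ : R) • ∑ α ∈ q.support.erase α0, π ^ v • coeff α q • φ (α + γ)) := by
          rw [← Finset.smul_sum, eq_neg_of_add_eq_zero_right hrel, ← hu]
          simp only [smul_neg, neg_neg, smul_smul]
          congr 1
          rw [mul_comm (π ^ v), ← mul_assoc, Units.inv_mul, one_mul]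
        rw [h3]
        refine N.neg_mem (N.smul_mem _ (N.sum_mem fun α hα => ?_))
        rw [Finset.mem_erase] at hα
        rcases hloc (coeff α q) with hun | ⟨r, hr⟩
        · rw [smul_comm]
          apply N.smul_mem
          by_cases hαK : K ≤ ∑ j, (α + γ) j
          · exact htriv _ _ (by omega)
          have hlt : MonomialOrder.degLex.toSyn (α0 + γ) < MonomialOrder.degLex.toSyn (α + γ) := by
            rw [map_add, map_add]
            exact add_lt_add_left (hmin α hun hα.1) _
          refine ihc _ ?_ _ rfl
          rw [← hc]
          apply Finset.card_lt_card
          rw [Finset.ssubset_iff_of_subset]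
          · refine ⟨α + γ, ?_, by simp⟩
            rw [Finset.mem_filter, wl_mem_monLE]
            exact ⟨by omega, hlt⟩
          · intro β'
            simp only [Finset.mem_filter]
            exact fun h => ⟨h.1, hlt.trans h.2⟩
        · have : π ^ v • coeff α q • φ (α + γ) = r • π ^ (v + 1) • φ (α + γ) := by
            rw [hr, smul_smul, smul_smul]
            congr 1
            ring
          rw [this]
          exact N.smul_mem _ (iht (v + 1) (by omega) _ _ rfl)
  intro β
  have := key K 0 (by omega) _ β rfl
  simpa using this


theorem wl_hockey (n K : ℕ) : ∑ k ∈ Finset.range K, (n + k).choose n = (n + K).choose (n + 1) := by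
  induction K with
  | zero => simp
  | succ K ih =>
    rw [Finset.sum_range_succ, ih, ← add_assoc, Nat.choose_succ_succ, add_comm]

theorem wl_local_det {R Cls : Type*} [CommRing R] [Nontrivial R] [Fintype Cls] {n s : ℕ} (π : R)
    (hloc : ∀ r : R, IsUnit r ∨ π ∣ r)
    (q : Cls → MvPolynomial (Fin (n + 1)) R) (α : Cls → Fin (n + 1) →₀ ℕ) (hα : ∀ P, IsUnit (coeff (α P) (q P)))
    (hmin : ∀ P β, IsUnit (coeff β (q P)) → β ≠ α P → MonomialOrder.degLex.toSyn (α P) < MonomialOrder.degLex.toSyn β)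
    (χ : Cls → Fin s → R) (T : Cls → Fin s → Fin (n + 1) → R) (hT : ∀ P i j, π ∣ T P i j)
    (hq : ∀ P i, χ P i * eval (T P i) (q P) = 0) (h : Cls → Fin s → MvPolynomial (Fin (n + 1)) R)
    (A : Matrix (Fin s) (Fin s) R) (hA : ∀ i j, A i j = ∑ P, χ P i * eval (T P i) (h P j)) (K : ℕ) :
    ∃ e, K * s ≤ e + (∑ P, ∑ i, α P i) * (n + K).choose (n + 1) ∧ π ^ e ∣ A.det := by
  classical
  let G1 : Finset (Cls × (Fin (n + 1) →₀ ℕ)) :=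
    (Finset.univ ×ˢ wlMonLE (n + 1) K).filter (fun x => ¬ α x.1 ≤ x.2 ∧ ∑ i, x.2 i < K)
  let G := G1 ⊕ Fin s
  let w : G → ℕ := Sum.elim (fun x => ∑ i, x.1.2 i) (fun _ => K)
  choose T' hT' using hT
  let ψ : G → Fin s → R := Sum.elim (fun x i => χ x.1.1 i * ∏ j, T' x.1.1 i j ^ x.1.2 j) (fun i => Pi.single i 1)
  let N : Submodule R (Fin s → R) := Submodule.span R (Set.range (fun g : G => π ^ w g • ψ g))
  have hφ : ∀ P (β : Fin (n + 1) →₀ ℕ) i, χ P i * ∏ j, T P i j ^ β j = π ^ (∑ j, β j) * (χ P i * ∏ j, T' P i j ^ β j) := by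
    intro P β i
    rw [← Finset.prod_pow_eq_pow_sum]
    simp only [hT', mul_pow, Finset.prod_mul_distrib]
    ring
  have hN2 : ∀ v : Fin s → R, π ^ K • v ∈ N := by
    intro v
    have : π ^ K • v = ∑ i, v i • (π ^ K • (Pi.single i 1 : Fin s → R)) := by
      ext k
      rw [Finset.sum_apply]
      simp [Pi.single_apply, mul_comm]
    rw [this]
    refine N.sum_mem fun i _ => N.smul_mem _ (Submodule.subset_span ⟨Sum.inr i, rfl⟩)
  have hspan : ∀ P (β : Fin (n + 1) →₀ ℕ), (fun i => χ P i * ∏ j, T P i j ^ β j) ∈ N := by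
    intro P
    refine wl_span π hloc (q P) (α P) (hα P) (hmin P) (χ P) (T P) (fun i j => ⟨_, hT' P i j⟩) (hq P) K N ?_ hN2
    intro β h1 h2
    have hmem : (P, β) ∈ G1 := by
      simp only [G1, Finset.mem_filter, Finset.mem_product, Finset.mem_univ, true_and, wl_mem_monLE]
      exact ⟨h2.le, h1, h2⟩
    refine Submodule.subset_span ⟨Sum.inl ⟨(P, β), hmem⟩, ?_⟩
    ext i
    simp only [Pi.smul_apply, smul_eq_mul, w, ψ, Sum.elim_inl]
    exact (hφ P β i).symm
  have hcol : ∀ j, (fun i => A i j) ∈ N := by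
    intro j
    have : (fun i => A i j) = ∑ P, ∑ β ∈ (h P j).support, coeff β (h P j) • (fun i => χ P i * ∏ j, T P i j ^ β j) := by
      ext i
      simp only [hA, Finset.sum_apply, Pi.smul_apply, smul_eq_mul]
      refine Finset.sum_congr rfl fun P _ => ?_
      rw [eval_eq', Finset.mul_sum]
      exact Finset.sum_congr rfl fun β _ => by ring
    rw [this]
    exact N.sum_mem fun P _ => N.sum_mem fun β _ => N.smul_mem _ (hspan P β)
  have hcol' : ∀ j, ∃ a : G → R, ∑ g, a g • (π ^ w g • ψ g) = fun i => A i j := fun j =>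
    (Submodule.mem_span_range_iff_exists_fun R).mp (hcol j)
  choose a ha using hcol'
  refine ⟨K * s - (∑ P, ∑ i, α P i) * (n + K).choose (n + 1), by omega, ?_⟩
  refine wl_det_dvd π w ψ a _ ?_ A ?_
  · intro g hg
    have := wl_weight_sum w K (fun k => (∑ P, ∑ i, α P i) * (n + k).choose n) ?_ g hg
    · rw [← Finset.mul_sum, wl_hockey] at this
      omega
    · intro k hk
      have hsub : ((Finset.univ.filter (fun g => w g ≤ k)).card : ℕ) ≤
          ((Finset.univ : Finset Cls).sigma (fun P => (wlMonLE (n + 1) k).filter (fun β => ¬ α P ≤ β))).card := by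
        rw [← Finset.card_map Function.Embedding.some (s := Finset.univ.sigma _)]
        apply Finset.card_le_card_of_injOn
          (Sum.elim (fun x : G1 => some (⟨x.1.1, x.1.2⟩ : Sigma fun _ : Cls => (Fin (n + 1) →₀ ℕ))) (fun i => none))
        · rintro (⟨⟨P, β⟩, hx⟩ | i) hg
          · simp only [Finset.coe_filter, Finset.mem_univ, true_and, Set.mem_ofPred_eq, w, Sum.elim_inl] at hg
            simp only [G1, Finset.mem_filter] at hx
            simp only [Sum.elim_inl, Finset.coe_map, Set.mem_image, Finset.mem_coe, Finset.mem_sigma, Finset.mem_univ,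
              true_and, Finset.mem_filter, wl_mem_monLE]
            exact ⟨⟨P, β⟩, ⟨hg, hx.2.1⟩, rfl⟩
          · simp only [Finset.coe_filter, Finset.mem_univ, true_and, Set.mem_ofPred_eq, w, Sum.elim_inr] at hg
            omega
        · rintro (⟨⟨P, β⟩, hx⟩ | i) hg (⟨⟨P', β'⟩, hx'⟩ | i') hg' h
          · simp only [Sum.elim_inl, Option.some.injEq, Sigma.mk.injEq, heq_eq_eq] at h
            obtain ⟨rfl, rfl⟩ := h
            rfl
          · simp at h
          · simp at h
          · simp only [Finset.coe_filter, Finset.mem_univ, true_and, Set.mem_ofPred_eq, w, Sum.elim_inr] at hg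
            omega
      refine hsub.trans ?_
      rw [Finset.card_sigma, Finset.sum_mul]
      exact Finset.sum_le_sum fun P _ => wl_reduced_count n k (α P)
  · intro i j
    have := congrFun (ha j) i
    rw [← this]
    simp [Finset.sum_apply]


theorem wl_ev {σ A B : Type*} [CommRing A] [CommRing B] [Algebra ℤ A] [Algebra ℤ B] (φ : A →+* B) (v : σ → A) (f : MvPolynomial σ ℤ) :
    φ (aeval v f) = aeval (fun i => φ (v i)) f := by
  rw [aeval_def, aeval_def, hom_eval₂, RingHom.ext_int (φ.comp (algebraMap ℤ A)) (algebraMap ℤ B)]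

theorem wl_totalDegree_aeval_le_int {σ τ S : Type*} [CommRing S] (v : σ → MvPolynomial τ S)
    (hv : ∀ i, (v i).totalDegree ≤ 1) (f : MvPolynomial σ ℤ) : (aeval v f).totalDegree ≤ f.totalDegree := by
  rw [aeval_def, eval₂_eq]
  apply totalDegree_finsetSum_le
  intro m hm
  refine (totalDegree_mul _ _).trans ?_
  rw [MvPolynomial.algebraMap_apply, totalDegree_C, zero_add]
  refine (totalDegree_finsetProd _ _).trans (le_trans ?_ (le_totalDegree hm))
  apply Finset.sum_le_sum
  intro i _
  refine (totalDegree_pow _ _).trans ?_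
  calc m i * (v i).totalDegree ≤ m i * 1 := Nat.mul_le_mul_left _ (hv i)
    _ = m i := mul_one _

theorem wl_ev_map {σ A : Type*} [CommRing A] (v : σ → A) (f : MvPolynomial σ ℤ) :
    eval v (map (Int.castRingHom A) f) = aeval v f := by
  rw [eval_map, aeval_def]; rfl

theorem wl_homog_smul {A : Type*} [CommRing A] [Algebra ℤ A] {m d : ℕ} {f : MvPolynomial (Fin m) ℤ} (hf : f.IsHomogeneous d) (c : A)
    (v : Fin m → A) : aeval (fun i => c * v i) f = c ^ d * aeval v f := by
  rw [aeval_def, aeval_def, eval₂_eq', eval₂_eq', Finset.mul_sum]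
  refine Finset.sum_congr rfl fun a ha => ?_
  have hdeg : ∑ i, a i = d := by
    have := hf (mem_support_iff.mp ha)
    rw [← this, Finsupp.weight_apply, ← wl_sum_eq_univ]
    simp
  simp only [mul_pow, Finset.prod_mul_distrib, Finset.prod_pow_eq_pow_sum, hdeg]
  ring

/-- affine chart around the point `P` -/
noncomputable def wlChart {R : Type*} [CommRing R] {m : ℕ} (i0 : Fin (m + 1)) (P : Fin m → R) : Fin (m + 1) → MvPolynomial (Fin m) R :=
  i0.insertNth 1 (fun j => C (P j) + X j)

theorem wlChart_hom {R S : Type*} [CommRing R] [CommRing S] {m : ℕ} (i0 : Fin (m + 1)) (P : Fin m → R)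
    (φ : MvPolynomial (Fin m) R →+* S) (k : Fin (m + 1)) :
    φ (wlChart i0 P k) = (i0.insertNth 1 (fun j => φ (C (P j)) + φ (X j)) : Fin (m + 1) → S) k := by
  rcases Fin.eq_self_or_eq_succAbove i0 k with rfl | ⟨k, rfl⟩
  · simp [wlChart]
  · simp [wlChart]

theorem wlChart_eval {R : Type*} [CommRing R] {m : ℕ} (i0 : Fin (m + 1)) (P T : Fin m → R) (f : MvPolynomial (Fin (m + 1)) ℤ) :
    eval T (aeval (wlChart i0 P) f) = aeval (i0.insertNth 1 (fun j => P j + T j) : Fin (m + 1) → R) f := by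
  rw [wl_ev]
  congr 2
  ext k
  rw [wlChart_hom]
  simp

theorem wlChart_map {R S : Type*} [CommRing R] [CommRing S] (ρ : R →+* S) {m : ℕ} (i0 : Fin (m + 1)) (P : Fin m → R) (f : MvPolynomial (Fin (m + 1)) ℤ) :
    map ρ (aeval (wlChart i0 P) f) = aeval (wlChart i0 (fun j => ρ (P j))) f := by
  rw [wl_ev]
  congr 2
  ext1 k
  rw [wlChart_hom]
  simp [wlChart]

theorem wlChart_ne {L : Type*} [Field L] [Infinite L] {m d : ℕ} (i0 : Fin (m + 1)) (P : Fin m → L) {f : MvPolynomial (Fin (m + 1)) ℤ}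
    (hf : f.IsHomogeneous d) (hne : map (Int.castRingHom L) f ≠ 0) : aeval (wlChart i0 P) f ≠ 0 := by
  intro h0
  have hz : X i0 * map (Int.castRingHom L) f = 0 := by
    apply MvPolynomial.funext
    intro z
    rw [map_mul, eval_X, map_zero, wl_ev_map]
    by_cases hz : z i0 = 0
    · rw [hz, zero_mul]
    have h1 : z = fun i => z i0 * (i0.insertNth 1 (fun j => P j + ((z i0)⁻¹ * z (i0.succAbove j) - P j)) : Fin (m + 1) → L) i := by
      ext k
      rcases Fin.eq_self_or_eq_succAbove i0 k with rfl | ⟨k, rfl⟩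
      · simp
      · simp [hz]
    rw [h1, wl_homog_smul hf, ← wlChart_eval, h0]
    simp
  rcases mul_eq_zero.mp hz with h | h
  · exact X_ne_zero i0 h
  · exact hne h

theorem wl_pderiv_aeval {R : Type*} [CommRing R] {m : ℕ} {σ : Type*} [Fintype σ] [DecidableEq σ] (v : σ → MvPolynomial (Fin m) R) (j : Fin m) (f : MvPolynomial σ ℤ) :
    pderiv j (aeval v f) = ∑ k, aeval v (pderiv k f) * pderiv j (v k) := by
  induction f using MvPolynomial.induction_on with
  | C a => simp
  | add a b ha hb => simp only [map_add, ha, hb, add_mul, Finset.sum_add_distrib]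
  | mul_X a i ha =>
    rw [map_mul, pderiv_mul, ha, aeval_X]
    simp only [pderiv_mul, map_add, map_mul, add_mul, Finset.sum_add_distrib, Finset.sum_mul, aeval_X]
    congr 1
    · refine Finset.sum_congr rfl fun j _ => by ring
    · rw [Finset.sum_eq_single i]
      · simp
      · intro k _ hk
        rw [pderiv_X_of_ne hk.symm]; simp
      · simp

theorem wlChart_coeff {R : Type*} [CommRing R] {m : ℕ} (i0 : Fin (m + 1)) (P : Fin m → R) (f : MvPolynomial (Fin (m + 1)) ℤ) (j : Fin m) :
    coeff (Finsupp.single j 1) (aeval (wlChart i0 P) f) = aeval (i0.insertNth 1 P : Fin (m + 1) → R) (pderiv (i0.succAbove j) f) := by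
  have h1 : coeff (Finsupp.single j 1) (aeval (wlChart i0 P) f) = coeff 0 (pderiv j (aeval (wlChart i0 P) f)) := by
    rw [coeff_pderiv]; simp
  rw [h1, wl_pderiv_aeval, Fin.sum_univ_succAbove _ i0]
  have h2 : pderiv j (wlChart i0 P i0) = 0 := by simp [wlChart]
  have h3 : ∀ k, pderiv j (wlChart i0 P (i0.succAbove k)) = if k = j then 1 else 0 := by
    intro k
    simp only [wlChart, Fin.insertNth_apply_succAbove, map_add, pderiv_C, zero_add, pderiv_X]
    by_cases h : k = j
    · subst h; simp
    · rw [if_neg h, Pi.single_eq_of_ne h]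
  simp only [h2, h3, mul_zero, zero_add, mul_ite, mul_one, Finset.sum_ite_eq', Finset.mem_univ, if_true]
  have h4 := wlChart_eval i0 P 0 (pderiv (i0.succAbove j) f)
  simp only [Pi.zero_apply, add_zero] at h4
  rw [← h4, ← constantCoeff_eq, ← eval_zero]

theorem wl_exists_min {R : Type*} [CommRing R] [Nontrivial R] {m : ℕ} (q : MvPolynomial (Fin m) R) (β : Fin m →₀ ℕ) (hβ : IsUnit (coeff β q)) :
    ∃ α, IsUnit (coeff α q) ∧ (∀ γ, IsUnit (coeff γ q) → γ ≠ α → MonomialOrder.degLex.toSyn α < MonomialOrder.degLex.toSyn γ) ∧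
      ∑ i, α i ≤ ∑ i, β i := by
  classical
  let S := q.support.filter (fun γ => IsUnit (coeff γ q))
  have hS : ∀ γ, IsUnit (coeff γ q) → γ ∈ S := by
    intro γ h
    rw [Finset.mem_filter, mem_support_iff]
    exact ⟨fun h0 => not_isUnit_zero (h0 ▸ h), h⟩
  obtain ⟨α, hα, hm⟩ := Finset.exists_min_image S MonomialOrder.degLex.toSyn ⟨β, hS β hβ⟩
  refine ⟨α, (Finset.mem_filter.mp hα).2, ?_, ?_⟩
  · intro γ h hne
    refine lt_of_le_of_ne (hm γ (hS γ h)) fun h => hne (MonomialOrder.degLex.toSyn.injective h.symm)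
  · have := hm β (hS β hβ)
    rw [MonomialOrder.degLex_le_iff] at this
    have := Finsupp.DegLex.monotone_degree this
    simpa [Finsupp.degree_eq_sum] using this

theorem wl_exists_alpha {R L : Type*} [CommRing R] [Nontrivial R] [Field L] [Infinite L] (ρ : R →+* L) (hρ : ∀ r, ρ r ≠ 0 → IsUnit r) {m d : ℕ}
    (i0 : Fin (m + 1)) (P : Fin m → R) {f : MvPolynomial (Fin (m + 1)) ℤ}
    (hf : f.IsHomogeneous d) (hne : map (Int.castRingHom L) f ≠ 0) (v : Fin (m + 1) → L) (hv : v = i0.insertNth 1 (fun j => ρ (P j)))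
    (hz : aeval v f = 0) [Decidable (∃ k, aeval v (pderiv k f) ≠ 0)] :
    ∃ α, IsUnit (coeff α (aeval (wlChart i0 P) f)) ∧
      (∀ γ, IsUnit (coeff γ (aeval (wlChart i0 P) f)) → γ ≠ α → MonomialOrder.degLex.toSyn α < MonomialOrder.degLex.toSyn γ) ∧
      ∑ i, α i ≤ if ∃ k, aeval v (pderiv k f) ≠ 0 then 1 else d := by
  have main : ∃ β, IsUnit (coeff β (aeval (wlChart i0 P) f)) ∧ ∑ i, β i ≤ if ∃ k, aeval v (pderiv k f) ≠ 0 then 1 else d := by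
    split_ifs with h
    · have h2 : ∃ j, aeval v (pderiv (i0.succAbove j) f) ≠ 0 := by
        by_contra hcon
        push Not at hcon
        obtain ⟨k, hk⟩ := h
        rcases Fin.eq_self_or_eq_succAbove i0 k with rfl | ⟨j, rfl⟩
        · have := congrArg (aeval v) hf.sum_X_mul_pderiv
          rw [map_nsmul, hz, smul_zero, map_sum, Fin.sum_univ_succAbove _ k] at this
          simp only [map_mul, aeval_X, hcon, mul_zero, Finset.sum_const_zero, add_zero] at this
          apply hk
          rw [hv, Fin.insertNth_apply_same, one_mul, ← hv] at this
          exact this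
        · exact hk (hcon j)
      obtain ⟨j, hj⟩ := h2
      refine ⟨Finsupp.single j 1, hρ _ ?_, ?_⟩
      · rw [← coeff_map, wlChart_map, wlChart_coeff, ← hv]
        exact hj
      · rw [← wl_sum_eq_univ]; simp
    · have h1 := wlChart_ne i0 (fun j => ρ (P j)) hf hne
      rw [← wlChart_map] at h1
      obtain ⟨β, hβ⟩ := MvPolynomial.ne_zero_iff.mp h1
      rw [coeff_map] at hβ
      refine ⟨β, hρ _ hβ, ?_⟩
      rw [← wl_sum_eq_univ]
      refine (le_totalDegree (p := aeval (wlChart i0 P) f) ?_).trans ?_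
      · rw [mem_support_iff]
        intro h0; rw [h0, map_zero] at hβ; exact hβ rfl
      · have hfd : f.totalDegree ≤ d := hf.totalDegree_le
        refine (wl_totalDegree_aeval_le_int (wlChart i0 P) ?_ f).trans hfd
        intro k
        rcases Fin.eq_self_or_eq_succAbove i0 k with rfl | ⟨j, rfl⟩
        · simp [wlChart]
        · simp only [wlChart, Fin.insertNth_apply_succAbove]
          refine (totalDegree_add _ _).trans ?_
          rw [totalDegree_C]
          exact max_le (by omega) (totalDegree_monomial_le _ _ |>.trans (by simp))
  obtain ⟨β, h1, h2⟩ := main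
  obtain ⟨α, h3, h4, h5⟩ := wl_exists_min _ β h1
  exact ⟨α, h3, h4, h5.trans h2⟩


/-- normalized representatives of projective points over `F_p` -/
def wlNormalized {p m : ℕ} (P : Fin m → ZMod p) : Prop := ∃ i0, P i0 = 1 ∧ ∀ j < i0, P j = 0

section
open Classical
variable (p : ℕ) [Fact p.Prime] {m : ℕ} (f : MvPolynomial (Fin m) ℤ)

noncomputable def wlZ : Finset (Fin m → ZMod p) :=
  Finset.univ.filter (fun P => wlNormalized P ∧ aeval (fun i => algebraMap (ZMod p) (AlgebraicClosure (ZMod p)) (P i)) f = 0)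

noncomputable def wlWt (P : Fin m → ZMod p) : ℕ :=
  if ∃ k, aeval (fun i => algebraMap (ZMod p) (AlgebraicClosure (ZMod p)) (P i)) (pderiv k f) ≠ 0 then 1 else f.totalDegree

noncomputable def wlW : ℕ := ∑ P ∈ wlZ p f, wlWt p f P

end

theorem wl_local (p : ℕ) [Fact p.Prime] {n d s D : ℕ} (f : MvPolynomial (Fin (n + 2)) ℤ) (hf : f.IsHomogeneous d)
    (hne : map (Int.castRingHom (AlgebraicClosure (ZMod p))) f ≠ 0)
    (h : Fin s → MvPolynomial (Fin (n + 2)) ℤ) (hh : ∀ j, (h j).IsHomogeneous D)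
    (ξ : Fin s → Fin (n + 2) → ℤ) (hξ : ∀ i, eval (ξ i) f = 0) (hprim : ∀ i, ∃ k, ¬ (p : ℤ) ∣ ξ i k) (K : ℕ) :
    ∃ e, K * s ≤ e + wlW p f * (n + K).choose (n + 1) ∧ (p : ℤ) ^ e ∣ (Matrix.of fun i j => eval (ξ i) (h j)).det := by
  classical
  let L := AlgebraicClosure (ZMod p)
  let ι := algebraMap (ZMod p) L
  let τ : ℤ_[p] →+* ZMod p := PadicInt.toZMod
  let ρ : ℤ_[p] →+* L := ι.comp τ
  have hfd : f.totalDegree = d := by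
    apply hf.totalDegree
    rintro rfl
    simp at hne
  have hunit : ∀ r : ℤ_[p], τ r ≠ 0 → IsUnit r := by
    intro r hr
    by_contra hu
    apply hr
    have : r ∈ IsLocalRing.maximalIdeal ℤ_[p] := hu
    rw [← PadicInt.ker_toZMod] at this
    exact this
  have hdvd : ∀ r : ℤ_[p], τ r = 0 → (p : ℤ_[p]) ∣ r := by
    intro r hr
    have : r ∈ RingHom.ker (PadicInt.toZMod (p := p)) := hr
    rw [PadicInt.ker_toZMod, PadicInt.maximalIdeal_eq_span_p, Ideal.mem_span_singleton] at this
    exact this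
  have hloc : ∀ r : ℤ_[p], IsUnit r ∨ (p : ℤ_[p]) ∣ r := by
    intro r
    by_cases hr : τ r = 0
    · exact Or.inr (hdvd r hr)
    · exact Or.inl (hunit r hr)
  have hρ : ∀ r, ρ r ≠ 0 → IsUnit r := fun r hr => hunit r (fun h0 => hr (by simp [ρ, h0]))
  have hlift : ∀ a : ZMod p, τ ((a.val : ℕ) : ℤ_[p]) = a := fun a => by rw [map_natCast, ZMod.natCast_zmod_val]
  -- data attached to classes
  let Cls := wlZ p f
  have hcls : ∀ P : Cls, wlNormalized P.1 ∧ aeval (fun i => ι (P.1 i)) f = 0 := fun P => by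
    exact (Finset.mem_filter.mp P.2).2
  choose i0 hi0 using fun P : Cls => (hcls P).1
  let lift : Cls → Fin (n + 1) → ℤ_[p] := fun P j => ((P.1 ((i0 P).succAbove j)).val : ℕ)
  have hvP : ∀ P : Cls, (fun i => ι (P.1 i)) = ((i0 P).insertNth 1 (fun j => ρ (lift P j)) : Fin (n + 2) → L) := by
    intro P
    ext k
    rcases Fin.eq_self_or_eq_succAbove (i0 P) k with h | ⟨j, rfl⟩
    · rw [h, Fin.insertNth_apply_same, (hi0 P).1, map_one]
    · rw [Fin.insertNth_apply_succAbove]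
      simp only [ρ, RingHom.comp_apply, lift, hlift]
  choose α hα hmin hαw using fun P : Cls => wl_exists_alpha ρ hρ (i0 P) (lift P) hf hne _ (hvP P) (hcls P).2
  -- data attached to points
  let c0 : Fin s → Fin (n + 2) → ZMod p := fun i k => (ξ i k : ZMod p)
  have hfirst : ∀ i, ∃ k, c0 i k ≠ 0 ∧ ∀ j < k, c0 i j = 0 := by
    intro i
    have hex : ∃ k, c0 i k ≠ 0 := by
      obtain ⟨k, hk⟩ := hprim i
      exact ⟨k, fun h0 => hk ((ZMod.intCast_zmod_eq_zero_iff_dvd _ _).mp h0)⟩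
    have hne : (Finset.univ.filter (fun k => c0 i k ≠ 0)).Nonempty := by
      obtain ⟨k, hk⟩ := hex
      exact ⟨k, by simp [hk]⟩
    refine ⟨Finset.min' _ hne, (Finset.mem_filter.mp (Finset.min'_mem _ hne)).2, ?_⟩
    intro j hj
    by_contra hcon
    exact absurd (Finset.min'_le _ j (by simp [hcon])) (not_le.mpr hj)
  choose k0 hk0 hk0' using hfirst
  have hcu : ∀ i, ∃ u : ℤ_[p]ˣ, (u : ℤ_[p]) = (ξ i (k0 i) : ℤ_[p]) := by
    intro i
    have : IsUnit ((ξ i (k0 i) : ℤ) : ℤ_[p]) := hunit _ (by rw [map_intCast]; exact hk0 i)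
    exact ⟨this.unit, rfl⟩
  choose u hu using hcu
  let cv : Fin s → Fin (n + 2) → ZMod p := fun i k => (c0 i (k0 i))⁻¹ * c0 i k
  have hcvmem : ∀ i, cv i ∈ wlZ p f := by
    intro i
    simp only [wlZ, Finset.mem_filter, Finset.mem_univ, true_and]
    refine ⟨⟨k0 i, inv_mul_cancel₀ (hk0 i), fun j hj => by simp only [cv]; rw [hk0' i j hj, mul_zero]⟩, ?_⟩
    have h1 : (fun k => algebraMap (ZMod p) (AlgebraicClosure (ZMod p)) (cv i k)) = fun k => ι (c0 i (k0 i))⁻¹ * ((Int.castRingHom L) (ξ i k)) := by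
      ext k
      simp [cv, c0, ι]
    rw [h1, wl_homog_smul hf, ← wl_ev]
    have : aeval (fun k => ξ i k) f = 0 := by
      have := hξ i
      rw [← coe_aeval_eq_eval] at this
      exact this
    rw [this, map_zero, mul_zero]
  let cl : Fin s → Cls := fun i => ⟨cv i, hcvmem i⟩
  have hi0cl : ∀ i, i0 (cl i) = k0 i := by
    intro i
    obtain ⟨h1, h2⟩ := hi0 (cl i)
    rcases lt_trichotomy (i0 (cl i)) (k0 i) with hlt | heq | hgt
    · exfalso
      simp only [cl, cv] at h1
      rw [hk0' i _ hlt, mul_zero] at h1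
      exact zero_ne_one h1
    · exact heq
    · have := h2 _ hgt
      simp only [cl, cv] at this
      rw [inv_mul_cancel₀ (hk0 i)] at this
      exact absurd this one_ne_zero
  let T : Cls → Fin s → Fin (n + 1) → ℤ_[p] := fun P i j =>
    if cl i = P then (↑(u i)⁻¹ : ℤ_[p]) * (ξ i ((i0 P).succAbove j) : ℤ_[p]) - lift P j else 0
  let χ : Cls → Fin s → ℤ_[p] := fun P i => if cl i = P then (u i : ℤ_[p]) ^ D else 0
  have hpt : ∀ i, (fun k => ((ξ i k : ℤ) : ℤ_[p])) =
      fun k => (u i : ℤ_[p]) * ((i0 (cl i)).insertNth 1 (fun j => lift (cl i) j + T (cl i) i j) : Fin (n + 2) → ℤ_[p]) k := by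
    intro i
    ext1 k
    rcases Fin.eq_self_or_eq_succAbove (i0 (cl i)) k with h | ⟨j, rfl⟩
    · rw [h, Fin.insertNth_apply_same, mul_one, hu, hi0cl]
    · rw [Fin.insertNth_apply_succAbove]
      simp only [T, if_true, add_sub_cancel, Units.mul_inv_cancel_left]
  have hTd : ∀ P i j, (p : ℤ_[p]) ∣ T P i j := by
    intro P i j
    by_cases hP : cl i = P
    · simp only [T, if_pos hP]
      apply hdvd
      have hui : τ (↑(u i)⁻¹) = (c0 i (k0 i))⁻¹ := by
        apply eq_inv_of_mul_eq_one_left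
        have : c0 i (k0 i) = τ (u i) := by rw [hu, map_intCast]
        rw [this, ← map_mul, Units.inv_mul, map_one]
      rw [map_sub, map_mul, hui, map_intCast]
      simp only [lift, hlift]
      rw [← hP]
      simp [cl, cv, c0]
    · simp only [T, if_neg hP]; exact dvd_zero _
  have hinteq : ∀ i (g : MvPolynomial (Fin (n + 2)) ℤ), aeval (fun k => ((ξ i k : ℤ) : ℤ_[p])) g = ((eval (ξ i) g : ℤ) : ℤ_[p]) := by
    intro i g
    have := wl_ev (Int.castRingHom ℤ_[p]) (ξ i) g
    rw [show eval (ξ i) g = aeval (ξ i) g by rw [← coe_aeval_eq_eval]; rfl]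
    exact this.symm
  have hdet := wl_local_det (p : ℤ_[p]) hloc (fun P => aeval (wlChart (i0 P) (lift P)) f) α hα hmin χ T hTd ?_
    (fun P j => aeval (wlChart (i0 P) (lift P)) (h j)) (Matrix.of fun i j => ((eval (ξ i) (h j) : ℤ) : ℤ_[p])) ?_ K
  · obtain ⟨e, he, hd⟩ := hdet
    refine ⟨e, he.trans ?_, ?_⟩
    · apply Nat.add_le_add_left
      apply Nat.mul_le_mul_right
      rw [wlW, ← Finset.sum_coe_sort (wlZ p f)]
      refine Finset.sum_le_sum fun P _ => ?_
      refine (hαw P).trans (le_of_eq ?_)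
      rw [wlWt, hfd]
      congr
    · have hm : (Matrix.of fun i j => ((eval (ξ i) (h j) : ℤ) : ℤ_[p])) = (Int.castRingHom ℤ_[p]).mapMatrix (Matrix.of fun i j => eval (ξ i) (h j)) := by
        ext i j; simp
      rw [hm, ← RingHom.map_det] at hd
      have := PadicInt.pow_p_dvd_int_iff (p := p) e (Matrix.of fun i j => eval (ξ i) (h j)).det
      exact this.mp hd
  · intro P i
    by_cases hP : cl i = P
    · have h1 := hinteq i f
      rw [hpt, wl_homog_smul hf, hξ, Int.cast_zero] at h1
      rw [wlChart_eval, ← hP]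
      have := (((u i).isUnit.pow d).mul_right_eq_zero).mp h1
      rw [this, mul_zero]
    · simp only [χ, if_neg hP, zero_mul]
  · intro i j
    rw [Finset.sum_eq_single (cl i)]
    · rw [wlChart_eval, Matrix.of_apply, ← hinteq, hpt, wl_homog_smul (hh j)]
      simp only [χ, if_true]
    · intro P _ hP
      simp only [χ, if_neg (Ne.symm hP), zero_mul]
    · simp


theorem wl_normalized_count (p : ℕ) [Fact p.Prime] {m : ℕ} (S C : Finset (Fin m → ZMod p)) (hS : ∀ P ∈ S, wlNormalized P)
    (hC : ∀ P ∈ S, ∀ c : (ZMod p)ˣ, (fun i => (c : ZMod p) * P i) ∈ C) : (p - 1) * S.card ≤ C.card := by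
  classical
  have h1 : ((Finset.univ : Finset (ZMod p)ˣ) ×ˢ S).card = (p - 1) * S.card := by
    rw [Finset.card_product, Finset.card_univ, ZMod.card_units_eq_totient, Nat.totient_prime Fact.out]
  rw [← h1]
  apply Finset.card_le_card_of_injOn (fun x => fun i => (x.1 : ZMod p) * x.2 i)
  · rintro ⟨c, P⟩ h
    simp only [Finset.coe_product, Set.mem_prod, Finset.mem_coe] at h
    exact hC P h.2 c
  · rintro ⟨c, P⟩ h ⟨c', P'⟩ h' heq
    simp only [Finset.coe_product, Set.mem_prod, Finset.mem_coe] at h h'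
    have heq : ∀ i, (c : ZMod p) * P i = c' * P' i := fun i => congrFun heq i
    obtain ⟨i, hi, hi'⟩ := hS P h.2
    obtain ⟨j, hj, hj'⟩ := hS P' h'.2
    have hij : i = j := by
      rcases lt_trichotomy i j with hl | he | hl
      · have := heq i
        rw [hi, hj' i hl, mul_one, mul_zero] at this
        exact absurd this c.ne_zero
      · exact he
      · have := heq j
        rw [hj, hi' j hl, mul_one, mul_zero] at this
        exact absurd this.symm c'.ne_zero
    subst hij
    have hc : (c : ZMod p) = c' := by
      have := heq i
      rwa [hi, hj, mul_one, mul_one] at this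
    have hc' : c = c' := Units.ext hc
    subst hc'
    have : P = P' := by
      ext1 k
      exact (Units.mul_right_inj c).mp (heq k)
    rw [this]

theorem wl_aeval_map_int {σ A : Type*} [CommRing A] [Algebra ℤ A] (v : σ → A) (f : MvPolynomial σ ℤ) :
    aeval v (map (Int.castRingHom A) f) = aeval v f := by
  rw [aeval_def, eval₂_map, aeval_def]
  congr 1
  exact RingHom.ext_int _ _

theorem wl_W_bound (p : ℕ) [Fact p.Prime] {n d : ℕ} (f : MvPolynomial (Fin (n + 2)) ℤ) (hf : f.IsHomogeneous d)
    (hirr : Irreducible (map (Int.castRingHom (AlgebraicClosure (ZMod p))) f)) (hp : 16 * d ^ 4 ≤ p) :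
    (wlW p f : ℝ) ≤ p ^ n * (1 + 40 * d ^ 2 / Real.sqrt p) := by
  classical
  let L := AlgebraicClosure (ZMod p)
  let ι := algebraMap (ZMod p) L
  have hfd : f.totalDegree = d := by
    apply hf.totalDegree
    rintro rfl
    simp at hirr
  have hcount := wl_cone_count p hirr (hf.map _) hp
  have hav : ∀ (v : Fin (n + 2) → L) (g : MvPolynomial (Fin (n + 2)) ℤ), aeval v (map (Int.castRingHom L) g) = aeval v g := by
    intro v g
    rw [wl_aeval_map_int v g]
  set C1 := (Finset.univ.filter (fun v : Fin (n + 2) → ZMod p => aeval (fun i => ι (v i)) (map (Int.castRingHom L) f) = 0)) with hC1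
  set C2 := (Finset.univ.filter (fun v : Fin (n + 2) → ZMod p => aeval (fun i => ι (v i)) (map (Int.castRingHom L) f) = 0 ∧
      ∀ k, aeval (fun i => ι (v i)) (pderiv k (map (Int.castRingHom L) f)) = 0)) with hC2
  let Z := wlZ p f
  let Zs := Z.filter (fun P => ∀ k, aeval (fun i => ι (P i)) (pderiv k f) = 0)
  have hZ : ∀ P ∈ Z, wlNormalized P ∧ aeval (fun i => ι (P i)) f = 0 := fun P hP => (Finset.mem_filter.mp hP).2
  have hsm : ∀ (c : (ZMod p)ˣ) (P : Fin (n + 2) → ZMod p) (e : ℕ) (g : MvPolynomial (Fin (n + 2)) ℤ), g.IsHomogeneous e →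
      aeval (fun i => ι (P i)) g = 0 → aeval (fun i => ι (c * P i)) g = 0 := by
    intro c P e g hg h0
    simp only [map_mul]
    rw [wl_homog_smul hg, h0, mul_zero]
  have h1 : (p - 1) * Z.card ≤ C1.card := by
    refine wl_normalized_count p Z C1 (fun P hP => (hZ P hP).1) ?_
    intro P hP c
    rw [hC1, Finset.mem_filter, hav]
    exact ⟨Finset.mem_univ _, hsm c P d f hf (hZ P hP).2⟩
  have h2 : (p - 1) * Zs.card ≤ C2.card := by
    refine wl_normalized_count p Zs C2 (fun P hP => (hZ P (Finset.mem_filter.mp hP).1).1) ?_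
    intro P hP c
    have hP1 := (Finset.mem_filter.mp hP).1
    have hP2 := (Finset.mem_filter.mp hP).2
    rw [hC2, Finset.mem_filter, hav]
    refine ⟨Finset.mem_univ _, hsm c P d f hf (hZ P hP1).2, fun k => ?_⟩
    rw [pderiv_map, hav]
    exact hsm c P (d - 1) _ hf.pderiv (hP2 k)
  have hW : wlW p f ≤ Z.card + d * Zs.card := by
    rw [wlW, Finset.card_eq_sum_ones, Finset.card_filter, Finset.mul_sum, ← Finset.sum_add_distrib]
    refine Finset.sum_le_sum fun P _ => ?_
    rw [wlWt, hfd]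
    by_cases hk : ∃ k, aeval (fun i => algebraMap (ZMod p) (AlgebraicClosure (ZMod p)) (P i)) (pderiv k f) ≠ 0
    · rw [if_pos hk]; omega
    · rw [if_neg hk]
      push Not at hk
      rw [if_pos hk]
      omega
  have hp1 : 1 < p := (Fact.out : p.Prime).one_lt
  have h3 : (p - 1) * wlW p f ≤ C1.card + d * C2.card := by
    calc _ ≤ (p - 1) * (Z.card + d * Zs.card) := Nat.mul_le_mul_left _ hW
      _ = (p - 1) * Z.card + d * ((p - 1) * Zs.card) := by ring
      _ ≤ _ := by gcongr
  have h4 : ((p : ℝ) - 1) * wlW p f ≤ C1.card + d * C2.card := by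
    have : (((p - 1) * wlW p f : ℕ) : ℝ) ≤ ((C1.card + d * C2.card : ℕ) : ℝ) := by exact_mod_cast h3
    push_cast [Nat.cast_sub hp1.le] at this
    exact this
  have h5 := h4.trans hcount
  have hd1 : 1 ≤ d := by
    have := wl_pos_of_irreducible hirr
    exact this.trans ((hf.map _).totalDegree_le)
  have hd1' : (1 : ℝ) ≤ d := by exact_mod_cast hd1
  have hp0' : (0 : ℝ) < p := by positivity
  have hs := Real.mul_self_sqrt hp0'.le
  have hs0 := Real.sqrt_pos.mpr hp0'
  have hsd : 4 * (d : ℝ) ^ 2 ≤ Real.sqrt p := by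
    apply Real.le_sqrt_of_sq_le
    have : (4 * (d : ℝ) ^ 2) ^ 2 = 16 * d ^ 4 := by ring
    rw [this]
    exact_mod_cast hp
  set x : ℝ := d ^ 2 / Real.sqrt p with hx
  have hx0 : 0 ≤ x := by positivity
  have hx1 : x ≤ 1 / 4 := by
    rw [hx, div_le_iff₀ hs0]; linarith
  have hpx : 1 ≤ p * x := by
    rw [hx]
    nth_rewrite 1 [← hs]
    have hd2 : (1 : ℝ) ≤ d ^ 2 := one_le_pow₀ hd1'
    have : Real.sqrt p * Real.sqrt p * (d ^ 2 / Real.sqrt p) = Real.sqrt p * d ^ 2 := by field_simp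
    rw [this]
    nlinarith
  have hp2 : (2 : ℝ) ≤ p := by exact_mod_cast hp1
  have e1 : (19 * (d : ℝ) ^ 2 / Real.sqrt p) = 19 * x := by rw [hx]; ring
  have e2 : (40 * (d : ℝ) ^ 2 / Real.sqrt p) = 40 * x := by rw [hx]; ring
  rw [e1] at h5
  rw [e2]
  have h6 : ((p : ℝ) - 1) * wlW p f ≤ (p - 1) * (p ^ n * (1 + 40 * x)) := by
    refine h5.trans ?_
    rw [pow_succ, mul_assoc]
    have h7 : (p : ℝ) * (1 + 19 * x) ≤ (p - 1) * (1 + 40 * x) := by nlinarith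
    calc (p : ℝ) ^ n * (p * (1 + 19 * x)) ≤ p ^ n * ((p - 1) * (1 + 40 * x)) := by gcongr
      _ = _ := by ring
  exact le_of_mul_le_mul_left h6 (by linarith)


theorem wl_root_sum {N : ℕ} {ω : ℂ} (hω : IsPrimitiveRoot ω N) (a b : ℕ) (ha : a < N) (hb : b < N) :
    ∑ k : Fin N, (ω ^ (k : ℕ)) ^ a * ((ω ^ (k : ℕ)) ^ b)⁻¹ = if a = b then (N : ℂ) else 0 := by
  have hω0 : ω ≠ 0 := hω.ne_zero (by omega)
  have h1 : ∀ k : Fin N, (ω ^ (k : ℕ)) ^ a * ((ω ^ (k : ℕ)) ^ b)⁻¹ = (ω ^ a * (ω ^ b)⁻¹) ^ (k : ℕ) := by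
    intro k
    rw [mul_pow, inv_pow, ← pow_mul, ← pow_mul, ← pow_mul, ← pow_mul, mul_comm _ a, mul_comm _ b]
  simp only [h1]
  rw [Fin.sum_univ_eq_sum_range (fun k => (ω ^ a * (ω ^ b)⁻¹) ^ k)]
  split_ifs with h
  · subst h
    simp [hω0]
  · have hne : ω ^ a * (ω ^ b)⁻¹ - 1 ≠ 0 := by
      rw [sub_ne_zero]
      intro h0
      have : ω ^ a = ω ^ b := by field_simp at h0; exact h0
      exact h (hω.pow_inj ha hb this)
    have hpow : (ω ^ a * (ω ^ b)⁻¹) ^ N = 1 := by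
      rw [mul_pow, inv_pow, ← pow_mul, ← pow_mul, mul_comm a, mul_comm b, pow_mul, pow_mul, hω.pow_eq_one]
      simp
    have := geom_sum_mul (ω ^ a * (ω ^ b)⁻¹) N
    rw [hpow, sub_self] at this
    exact (mul_eq_zero.mp this).resolve_right hne

theorem wl_fourier {m : ℕ} (f : MvPolynomial (Fin m) ℂ) (α : Fin m →₀ ℕ) :
    ∃ z : Fin m → ℂ, (∀ i, ‖z i‖ = 1) ∧ ‖coeff α f‖ ≤ ‖eval z f‖ := by
  classical
  by_cases hα : α ∈ f.support
  swap
  · exact ⟨fun _ => 1, by simp, by rw [notMem_support_iff.mp hα]; simp⟩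
  let N := f.totalDegree + 1
  have hN : N ≠ 0 := by omega
  obtain ⟨ω, hω⟩ : ∃ ω : ℂ, IsPrimitiveRoot ω N := ⟨_, Complex.isPrimitiveRoot_exp N hN⟩
  have hsm : ∀ β ∈ f.support, ∀ i, β i < N := by
    intro β hβ i
    have := le_totalDegree hβ
    rw [wl_sum_eq_univ] at this
    have := (Finset.single_le_sum (f := fun i => β i) (fun _ _ => Nat.zero_le _) (Finset.mem_univ i)).trans this
    simp only [N]; omega
  let z : (Fin m → Fin N) → Fin m → ℂ := fun k i => ω ^ (k i : ℕ)
  have hz1 : ∀ k i, ‖z k i‖ = 1 := fun k i => by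
    simp only [z, norm_pow, hω.norm'_eq_one hN, one_pow]
  have hsum : ∑ k, eval (z k) f * ∏ i, (z k i ^ α i)⁻¹ = (N : ℂ) ^ m * coeff α f := by
    simp only [eval_eq', Finset.sum_mul]
    rw [Finset.sum_comm]
    have h1 : ∀ β ∈ f.support, ∑ k, coeff β f * (∏ i, z k i ^ β i) * ∏ i, (z k i ^ α i)⁻¹ = if β = α then (N : ℂ) ^ m * coeff α f else 0 := by
      intro β hβ
      have h2 : ∀ k, coeff β f * (∏ i, z k i ^ β i) * ∏ i, (z k i ^ α i)⁻¹ = coeff β f * ∏ i, ((ω ^ (k i : ℕ)) ^ β i * ((ω ^ (k i : ℕ)) ^ α i)⁻¹) := by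
        intro k
        rw [Finset.prod_mul_distrib, mul_assoc]
      simp only [h2]
      rw [← Finset.mul_sum]
      have h3 := Finset.prod_univ_sum (fun _ : Fin m => (Finset.univ : Finset (Fin N))) (fun i k => (ω ^ (k : ℕ)) ^ β i * ((ω ^ (k : ℕ)) ^ α i)⁻¹)
      rw [Fintype.piFinset_univ] at h3
      rw [← h3]
      simp only [wl_root_sum hω _ _ (hsm β hβ _) (hsm α hα _)]
      split_ifs with h
      · subst h
        simp [mul_comm]
      · obtain ⟨i, hi⟩ := Finsupp.ne_iff.mp h
        rw [Finset.prod_eq_zero (Finset.mem_univ i) (if_neg hi), mul_zero]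
    rw [Finset.sum_congr rfl h1, Finset.sum_ite_eq' , if_pos hα]
  by_contra hcon
  push Not at hcon
  have hcon' : ∀ k, ‖eval (z k) f‖ < ‖coeff α f‖ := fun k => hcon (z k) (hz1 k)
  have hN0 : (0 : ℝ) < N := by positivity
  have : ‖(N : ℂ) ^ m * coeff α f‖ < N ^ m * ‖coeff α f‖ := by
    rw [← hsum]
    calc _ ≤ ∑ k, ‖eval (z k) f * ∏ i, (z k i ^ α i)⁻¹‖ := norm_sum_le _ _
      _ = ∑ k, ‖eval (z k) f‖ := by
        refine Finset.sum_congr rfl fun k _ => ?_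
        rw [norm_mul, norm_prod]
        simp [hz1]
      _ < ∑ k : Fin m → Fin N, ‖coeff α f‖ := by
        apply Finset.sum_lt_sum_of_nonempty ⟨fun _ => ⟨0, by omega⟩, Finset.mem_univ _⟩
        exact fun k _ => hcon' k
      _ = _ := by simp
  rw [norm_mul, norm_pow, Complex.norm_natCast] at this
  exact lt_irrefl _ this

theorem wl_block_det {ι R : Type*} [Fintype ι] [DecidableEq ι] [CommRing R] (M : Matrix ι ι R) (b : ι → ℕ) (c : R)
    (h1 : ∀ i j, b i < b j → M i j = 0) (h2 : ∀ i j, b i = b j → M i j = if i = j then c else 0) :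
    M.det = c ^ Fintype.card ι := by
  classical
  rw [← Matrix.det_transpose]
  have hb : M.transpose.BlockTriangular b := by
    intro i j hij
    exact h1 j i hij
  rw [hb.det]
  have h3 : ∀ a, (M.transpose.toSquareBlock b a).det = c ^ Fintype.card {i // b i = a} := by
    intro a
    have : M.transpose.toSquareBlock b a = c • (1 : Matrix {i // b i = a} {i // b i = a} R) := by
      ext ⟨i, hi⟩ ⟨j, hj⟩
      rw [Matrix.toSquareBlock_def, Matrix.of_apply, Matrix.transpose_apply, h2 _ _ (hj.trans hi.symm), Matrix.smul_apply,
        Matrix.one_apply]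
      simp only [Subtype.mk.injEq, smul_eq_mul, mul_ite, mul_one, mul_zero, eq_comm]
    rw [this, Matrix.det_smul, Matrix.det_one, mul_one]
  simp only [h3, Finset.prod_pow_eq_pow_sum]
  congr 1
  rw [← Finset.card_univ, Finset.card_eq_sum_card_image b]
  refine Finset.sum_congr rfl fun a _ => ?_
  rw [Fintype.card_subtype]


/-- Exponents of total degree `k` in `m` variables. -/
noncomputable def wlMon (m k : ℕ) : Finset (Fin m →₀ ℕ) := Finset.finsuppAntidiag Finset.univ k

theorem wl_mem_mon {m k : ℕ} {a : Fin m →₀ ℕ} : a ∈ wlMon m k ↔ ∑ i, a i = k := by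
  simp [wlMon, Finset.mem_finsuppAntidiag]

theorem wl_homog_iff {R : Type*} [CommRing R] {m k : ℕ} (G : MvPolynomial (Fin m) R) :
    G.IsHomogeneous k ↔ ∀ a, coeff a G ≠ 0 → a ∈ wlMon m k := by
  unfold IsHomogeneous IsWeightedHomogeneous
  constructor
  · intro h a ha
    have := h ha
    rw [wl_mem_mon, ← this, Finsupp.weight_apply, ← wl_sum_eq_univ]; simp
  · intro h a ha
    have := wl_mem_mon.mp (h a ha)
    rw [← this, Finsupp.weight_apply, ← wl_sum_eq_univ]; simp

/-- Polynomial with given coefficients. -/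
noncomputable def wlP (R : Type*) [CommRing R] (m k : ℕ) :
    (wlMon m k → R) →ₗ[R] MvPolynomial (Fin m) R :=
  ∑ β : wlMon m k, (monomial β.1).comp (LinearMap.proj β)

theorem wlP_apply {R : Type*} [CommRing R] {m k : ℕ} (x : wlMon m k → R) :
    wlP R m k x = ∑ β : wlMon m k, monomial β.1 (x β) := by
  simp [wlP]

theorem wlP_coeff {R : Type*} [CommRing R] {m k : ℕ} (x : wlMon m k → R) (β : wlMon m k) :
    coeff β.1 (wlP R m k x) = x β := by
  rw [wlP_apply, coeff_sum, Finset.sum_eq_single β]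
  · simp
  · intro b _ hb
    rw [coeff_monomial, if_neg]
    exact fun h => hb (Subtype.ext h)
  · simp

theorem wlP_homog {R : Type*} [CommRing R] {m k : ℕ} (x : wlMon m k → R) :
    (wlP R m k x).IsHomogeneous k := by
  rw [wlP_apply]
  apply IsHomogeneous.sum
  intro β _
  apply isHomogeneous_monomial
  have := wl_mem_mon.mp β.2
  rw [Finsupp.degree_eq_sum, this]

/-- Coefficient vector. -/
noncomputable def wlCo (R : Type*) [CommRing R] (m k : ℕ) :
    MvPolynomial (Fin m) R →ₗ[R] (wlMon m k → R) :=
  LinearMap.pi fun β => lcoeff R β.1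

theorem wlCo_apply {R : Type*} [CommRing R] {m k : ℕ} (G : MvPolynomial (Fin m) R) (β : wlMon m k) :
    wlCo R m k G β = coeff β.1 G := rfl

theorem wlCo_P {R : Type*} [CommRing R] {m k : ℕ} (x : wlMon m k → R) :
    wlCo R m k (wlP R m k x) = x := by
  ext β; rw [wlCo_apply, wlP_coeff]

theorem wlP_Co {R : Type*} [CommRing R] {m k : ℕ} (G : MvPolynomial (Fin m) R)
    (hG : G.IsHomogeneous k) : wlP R m k (wlCo R m k G) = G := by
  ext a
  by_cases ha : a ∈ wlMon m k
  · rw [wlP_coeff _ ⟨a, ha⟩]; rfl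
  · have h1 : coeff a G = 0 := by
      by_contra h
      exact ha ((wl_homog_iff G).mp hG a h)
    have h2 : coeff a (wlP R m k (wlCo R m k G)) = 0 := by
      by_contra h
      exact ha ((wl_homog_iff _).mp (wlP_homog _) a h)
    rw [h1, h2]

theorem wl_homog_dvd {R : Type*} [CommRing R] {m d D : ℕ} (hdD : d ≤ D)
    {f G : MvPolynomial (Fin m) R} (hf : f.IsHomogeneous d) (hG : G.IsHomogeneous D)
    (h : f ∣ G) : ∃ H : MvPolynomial (Fin m) R, H.IsHomogeneous (D - d) ∧ G = f * H := by
  obtain ⟨H, rfl⟩ := h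
  refine ⟨homogeneousComponent (D - d) H, homogeneousComponent_isHomogeneous _ _, ?_⟩
  have h1 : homogeneousComponent D (f * H) = f * H := by
    rw [homogeneousComponent_of_mem (n := D) hG]; simp
  rw [← h1]
  conv_lhs => rw [← sum_homogeneousComponent H, Finset.mul_sum, map_sum]
  have : ∀ i ∈ Finset.range (H.totalDegree + 1),
      homogeneousComponent D (f * homogeneousComponent i H)
        = if i = D - d then f * homogeneousComponent i H else 0 := by
    intro i _
    rw [homogeneousComponent_of_mem (hf.mul (homogeneousComponent_isHomogeneous i H))]
    congr 1
    apply propext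
    omega
  rw [Finset.sum_congr rfl this, Finset.sum_ite_eq']
  split_ifs with hi
  · rfl
  · simp only [Finset.mem_range, not_lt] at hi
    rw [homogeneousComponent_eq_zero _ _ (by omega), mul_zero]

theorem wl_const_dvd {m d : ℕ} {f : MvPolynomial (Fin m) ℤ}
    (hprim : Finset.gcd f.support f.coeff = 1) {k : ℤ} (hk : k ≠ 0) {H : MvPolynomial (Fin m) ℤ}
    (h : C k ∣ f * H) : C k ∣ H := by
  have hr : IsRelPrime (C k : MvPolynomial (Fin m) ℤ) f := by
    intro c hc hcf
    obtain ⟨c', hc'⟩ := hc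
    have hne : (C k : MvPolynomial (Fin m) ℤ) ≠ 0 := by simpa using hk
    have h0 : c ≠ 0 ∧ c' ≠ 0 := by
      constructor <;> (rintro rfl; simp at hc'; exact hk hc')
    have h1 := congrArg totalDegree hc'
    rw [totalDegree_C, totalDegree_mul_of_isDomain h0.1 h0.2] at h1
    obtain ⟨u, hu⟩ : ∃ u, c = C u := ⟨_, totalDegree_eq_zero_iff_eq_C.mp (by omega)⟩
    rw [hu, C_dvd_iff_dvd_coeff] at hcf
    have : u ∣ 1 := by
      rw [← hprim]
      exact Finset.dvd_gcd fun b _ => hcf b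
    rw [hu]
    exact (isUnit_of_dvd_one this).map C
  exact hr.dvd_of_dvd_mul_left h

theorem wl_lattice {m d D : ℕ} (f : MvPolynomial (Fin m) ℤ) (hf : f.IsHomogeneous d)
    (hprim : Finset.gcd f.support f.coeff = 1) (hf0 : f ≠ 0) (hdD : d ≤ D) (s : ℕ)
    (hs : s + (wlMon m (D - d)).card = (wlMon m D).card) :
    ∃ q : Fin s → MvPolynomial (Fin m) ℤ, (∀ j, (q j).IsHomogeneous D) ∧
      (∀ x : Fin s → ℤ, f ∣ ∑ j, C (x j) * q j → x = 0) ∧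
      ∀ e : Fin s ⊕ wlMon m (D - d) ≃ wlMon m D,
        IsUnit (Matrix.of fun k j => coeff (e k).1
          (Sum.elim q (fun γ : wlMon m (D - d) => f * monomial γ.1 1) j)).det := by
  classical
  let L : (wlMon m (D - d) → ℤ) →ₗ[ℤ] (wlMon m D → ℤ) :=
    (wlCo ℤ m D).comp ((LinearMap.mulLeft ℤ f).comp (wlP ℤ m (D - d)))
  have hLa : ∀ x, L x = wlCo ℤ m D (f * wlP ℤ m (D - d) x) := fun x => rfl
  have hhom : ∀ x, (f * wlP ℤ m (D - d) x).IsHomogeneous D := fun x => by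
    have := hf.mul (wlP_homog (R := ℤ) (m := m) (k := D - d) x)
    rwa [Nat.add_sub_cancel' hdD] at this
  have hLP : ∀ x, wlP ℤ m D (L x) = f * wlP ℤ m (D - d) x := fun x => by
    rw [hLa, wlP_Co _ (hhom x)]
  have hL : Function.Injective L := by
    intro x y hxy
    have h := congrArg (wlP ℤ m D) hxy
    rw [hLP, hLP] at h
    have := congrArg (wlCo ℤ m (D - d)) (mul_left_cancel₀ hf0 h)
    rwa [wlCo_P, wlCo_P] at this
  let N := LinearMap.range L
  have hmemN : ∀ y, y ∈ N ↔ f ∣ wlP ℤ m D y := by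
    intro y
    constructor
    · rintro ⟨x, rfl⟩
      rw [hLP]; exact dvd_mul_right _ _
    · intro h
      obtain ⟨H, hH, hy⟩ := wl_homog_dvd hdD hf (wlP_homog y) h
      refine ⟨wlCo ℤ m (D - d) H, ?_⟩
      rw [hLa, wlP_Co _ hH, ← hy, wlCo_P]
  have htf : Module.IsTorsionFree ℤ ((wlMon m D → ℤ) ⧸ N) := by
    rw [Module.isTorsionFree_iff_smul_eq_zero]
    intro k q hq
    induction q using Submodule.Quotient.induction_on with
    | _ y =>
    by_cases hk : k = 0
    · exact Or.inl hk
    right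
    rw [← Submodule.Quotient.mk_smul, Submodule.Quotient.mk_eq_zero, hmemN] at hq
    rw [Submodule.Quotient.mk_eq_zero, hmemN]
    obtain ⟨H, hH⟩ := hq
    rw [map_smul, smul_eq_C_mul] at hH
    obtain ⟨H', rfl⟩ := wl_const_dvd (d := d) hprim hk ⟨_, hH.symm⟩
    refine ⟨H', ?_⟩
    have hne : (C k : MvPolynomial (Fin m) ℤ) ≠ 0 := by simpa using hk
    apply mul_left_cancel₀ hne
    rw [hH]; ring
  let bW : Module.Basis (wlMon m (D - d)) ℤ N :=
    (Pi.basisFun ℤ (wlMon m (D - d))).map (LinearEquiv.ofInjective L hL)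
  have hfr : Module.finrank ℤ ((wlMon m D → ℤ) ⧸ N) = s := by
    have h1 := Submodule.finrank_quotient_add_finrank N
    have h2 : Module.finrank ℤ N = (wlMon m (D - d)).card := by
      rw [Module.finrank_eq_card_basis bW]; simp
    have h3 : Module.finrank ℤ (wlMon m D → ℤ) = (wlMon m D).card := by
      rw [Module.finrank_fintype_fun_eq_card]; simp
    omega
  let bQ : Module.Basis (Fin s) ℤ ((wlMon m D → ℤ) ⧸ N) := Module.finBasisOfFinrankEq _ _ hfr
  let b := Module.Basis.sumQuot bW bQ
  have hbl : ∀ γ, b (Sum.inl γ) = L (Pi.single γ 1) := fun γ => by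
    simp [b, bW]
    rfl
  have hbr : ∀ j, Submodule.Quotient.mk (b (Sum.inr j)) = bQ j := fun j =>
    Module.Basis.sumQuot_inr bW bQ j
  refine ⟨fun j => wlP ℤ m D (b (Sum.inr j)), fun j => wlP_homog _, ?_, ?_⟩
  · intro x hx
    have h1 : ∑ j, C (x j) * wlP ℤ m D (b (Sum.inr j))
        = wlP ℤ m D (∑ j, x j • b (Sum.inr j)) := by
      rw [map_sum]; simp only [map_smul, smul_eq_C_mul]
    rw [h1, ← hmemN, ← Submodule.Quotient.mk_eq_zero, ← Submodule.mkQ_apply, map_sum] at hx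
    simp only [map_smul, Submodule.mkQ_apply, hbr] at hx
    exact funext (Fintype.linearIndependent_iff.mp bQ.linearIndependent x hx)
  · intro e
    have hu := (Pi.basisFun ℤ (wlMon m D)).reindex e.symm |>.isUnit_det
      (b.reindex (Equiv.sumComm _ _))
    rw [Module.Basis.det_apply] at hu
    refine (congrArg IsUnit (congrArg Matrix.det ?_)).mpr hu
    ext k j
    rw [Module.Basis.toMatrix_apply]
    rcases j with j | γ
    · simp [wlP_coeff]
    · simp only [Matrix.of_apply, Sum.elim_inr, Module.Basis.reindex_apply, Equiv.sumComm_symm,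
        Equiv.sumComm_apply, Sum.swap_inr, Module.Basis.repr_reindex, Equiv.symm_symm,
        Finsupp.mapDomain_equiv_apply, Pi.basisFun_repr, hbl]
      rw [hLa, wlCo_apply]
      congr 2
      rw [wlP_apply, Finset.sum_eq_single γ]
      · simp
      · intro c _ hc
        simp [Pi.single_apply, hc]
      · simp


/-- Shear substitution. -/
noncomputable def wlSh {m : ℕ} (v : Fin m → ℂ) :
    MvPolynomial (Fin (m + 1)) ℂ →ₐ[ℂ] MvPolynomial (Fin (m + 1)) ℂ :=
  aeval (Fin.cons (X 0) (fun j => X j.succ + C (v j) * X 0) : Fin (m + 1) → _)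

theorem wlSh_homog {m d : ℕ} (v : Fin m → ℂ) {G : MvPolynomial (Fin (m + 1)) ℂ}
    (hG : G.IsHomogeneous d) : (wlSh v G).IsHomogeneous d := by
  have := hG.aeval (Fin.cons (X 0) (fun j => X j.succ + C (v j) * X 0) : Fin (m + 1) → MvPolynomial (Fin (m + 1)) ℂ) (n := 1) (fun i => by
    refine Fin.cases ?_ (fun j => ?_) i
    · simpa using isHomogeneous_X ℂ (0 : Fin (m+1))
    · simp only [Fin.cons_succ]
      apply IsHomogeneous.add
      · exact isHomogeneous_X ℂ _
      · simpa using (isHomogeneous_C (Fin (m+1)) (v j)).mul (isHomogeneous_X ℂ (0 : Fin (m+1))))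
  simpa [wlSh] using this

theorem wlSh_eval {m : ℕ} (v : Fin m → ℂ) (ξ : Fin (m + 1) → ℂ) (G : MvPolynomial (Fin (m + 1)) ℂ) :
    eval (Fin.cons (ξ 0) (fun j => ξ j.succ - v j * ξ 0) : Fin (m + 1) → ℂ) (wlSh v G) = eval ξ G := by
  rw [← coe_aeval_eq_eval, ← coe_aeval_eq_eval]
  change ((aeval (Fin.cons (ξ 0) (fun j => ξ j.succ - v j * ξ 0) : Fin (m + 1) → ℂ)).comp (wlSh v)) G = aeval ξ G
  congr 1
  apply MvPolynomial.algHom_ext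
  intro i
  refine Fin.cases ?_ (fun j => ?_) i
  · simp [wlSh]
  · simp [wlSh]

theorem wlSh_dvd {m : ℕ} (v : Fin m → ℂ) (β : Fin (m + 1) →₀ ℕ) :
    (X 0 : MvPolynomial (Fin (m + 1)) ℂ) ^ (β 0 + 1) ∣ wlSh v (monomial β 1) - monomial β 1 := by
  have h1 : (monomial β (1:ℂ)) = X 0 ^ β 0 * ∏ j : Fin m, X j.succ ^ β j.succ := by
    rw [monomial_eq, C_1, one_mul, Finsupp.prod_fintype _ _ (fun i => pow_zero _), Fin.prod_univ_succ]
  rw [h1, map_mul, map_prod]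
  simp only [map_pow]
  have h0 : wlSh v (X 0) = X 0 := by simp [wlSh]
  have hs : ∀ j : Fin m, wlSh v (X j.succ) = X j.succ + C (v j) * X 0 := by simp [wlSh]
  simp only [h0, hs]
  rw [← mul_sub, pow_succ]
  apply mul_dvd_mul_left
  rw [← Ideal.mem_span_singleton, ← Ideal.Quotient.eq_zero_iff_mem, map_sub, sub_eq_zero, map_prod, map_prod]
  apply Finset.prod_congr rfl
  intro j _
  rw [map_pow, map_pow]
  congr 1
  rw [Ideal.Quotient.eq, Ideal.mem_span_singleton]
  exact ⟨C (v j), by ring⟩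

theorem wl_coeff_X_pow {m : ℕ} {k : ℕ} {P : MvPolynomial (Fin (m + 1)) ℂ} (h : X 0 ^ k ∣ P)
    (α : Fin (m + 1) →₀ ℕ) (hα : α 0 < k) : coeff α P = 0 := by
  obtain ⟨Q, rfl⟩ := h
  rw [X_pow_eq_monomial, coeff_monomial_mul', if_neg]
  intro hle
  have := hle 0
  simp at this
  omega

theorem wlU_det {m D : ℕ} (v : Fin m → ℂ) {J : Type*} [Fintype J] [DecidableEq J]
    (e : J ≃ wlMon (m + 1) D) :
    (Matrix.of fun k l : J => coeff (e k).1 (wlSh v (monomial (e l).1 1))).det = 1 := by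
  rw [wl_block_det _ (fun k => (e k).1 0) 1, one_pow]
  · intro i j hij
    have h := wl_coeff_X_pow (wlSh_dvd v (e j).1) (e i).1 (by omega)
    rw [coeff_sub, sub_eq_zero] at h
    rw [Matrix.of_apply, h, coeff_monomial, if_neg]
    intro h'
    rw [h'] at hij; exact lt_irrefl _ hij
  · intro i j hij
    have h := wl_coeff_X_pow (wlSh_dvd v (e j).1) (e i).1 (by omega)
    rw [coeff_sub, sub_eq_zero] at h
    rw [Matrix.of_apply, h, coeff_monomial]
    have : (e j).1 = (e i).1 ↔ i = j := by
      rw [← Subtype.ext_iff, e.injective.eq_iff, eq_comm]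
    simp [this]

theorem wlTri_det {m r d : ℕ} (F : MvPolynomial (Fin (m + 1)) ℂ) (hF : F.IsHomogeneous d) :
    (Matrix.of fun γ δ : wlMon (m + 1) r =>
      coeff (γ.1 + Finsupp.single 0 d) (F * monomial δ.1 1)).det
      = (coeff (Finsupp.single 0 d) F) ^ (wlMon (m + 1) r).card := by
  classical
  rw [wl_block_det _ (fun γ => r - γ.1 0) (coeff (Finsupp.single 0 d) F)]
  · simp
  · intro i j hij
    rw [Matrix.of_apply, coeff_mul_monomial', mul_one]
    split_ifs with hle
    · by_contra hne
      have h1 := wl_mem_mon.mp ((wl_homog_iff F).mp hF _ hne)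
      have h2 : (i.1 + Finsupp.single 0 d - j.1 : Fin (m+1) →₀ ℕ) 0 ≤ d := by
        exact (Finset.single_le_sum (f := fun k => (i.1 + Finsupp.single 0 d - j.1 : Fin (m+1) →₀ ℕ) k) (fun _ _ => Nat.zero_le _) (Finset.mem_univ 0)).trans h1.le
      simp at h2
      omega
    · rfl
  · intro i j hij
    have hi : i.1 0 ≤ r := by
      exact (Finset.single_le_sum (f := fun k => i.1 k) (fun _ _ => Nat.zero_le _) (Finset.mem_univ 0)).trans (wl_mem_mon.mp i.2).le
    have hj : j.1 0 ≤ r := by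
      exact (Finset.single_le_sum (f := fun k => j.1 k) (fun _ _ => Nat.zero_le _) (Finset.mem_univ 0)).trans (wl_mem_mon.mp j.2).le
    have hij' : i.1 0 = j.1 0 := by omega
    rw [Matrix.of_apply, coeff_mul_monomial', mul_one]
    by_cases he : i = j
    · subst he
      rw [if_pos rfl, if_pos (by simp)]
      simp
    · rw [if_neg he]
      split_ifs with hle
      · by_contra hne
        apply he
        have h1 := wl_mem_mon.mp ((wl_homog_iff F).mp hF _ hne)
        rw [Fin.sum_univ_succ] at h1
        have h3 : ∑ k : Fin m, (i.1 + Finsupp.single 0 d - j.1 : Fin (m+1) →₀ ℕ) k.succ = 0 := by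
          have : (i.1 + Finsupp.single 0 d - j.1 : Fin (m+1) →₀ ℕ) 0 = d := by
            simp; omega
          omega
        rw [Finset.sum_eq_zero_iff] at h3
        have h4 : ∀ k, i.1 k ≤ j.1 k := by
          intro k
          refine Fin.cases (le_of_eq hij') (fun l => ?_) k
          have := h3 l (Finset.mem_univ _)
          simp [Finsupp.single_apply, Fin.succ_ne_zero, (Fin.succ_ne_zero l).symm] at this
          omega
        have h5 : ∑ k, i.1 k = ∑ k, j.1 k := by
          rw [wl_mem_mon.mp i.2, wl_mem_mon.mp j.2]
        rw [Finset.sum_eq_sum_iff_of_le (fun k _ => h4 k)] at h5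
        exact Subtype.ext (Finsupp.ext fun k => h5 k (Finset.mem_univ k))
      · rfl

theorem wl_theta {R : Type*} [CommRing R] {m D : ℕ} {J : Type*} [Fintype J]
    (e : J ≃ wlMon m D) (θ : MvPolynomial (Fin m) R →ₗ[R] R) (G : MvPolynomial (Fin m) R)
    (hG : G.IsHomogeneous D) : ∑ l, θ (monomial (e l).1 1) * coeff (e l).1 G = θ G := by
  conv_rhs => rw [← wlP_Co G hG, wlP_apply, map_sum]
  rw [← e.sum_comp]
  apply Finset.sum_congr rfl
  intro l _
  have : monomial (e l).1 (wlCo R m D G (e l)) = (coeff (e l).1 G) • monomial (e l).1 (1:R) := by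
    rw [smul_monomial, smul_eq_mul, mul_one]; rfl
  rw [this, map_smul, smul_eq_mul, mul_comm]

theorem wl_exists_equiv {m d D s : ℕ} (hdD : d ≤ D)
    (hs : s + (wlMon (m + 1) (D - d)).card = (wlMon (m + 1) D).card) :
    ∃ e : Fin s ⊕ wlMon (m + 1) (D - d) ≃ wlMon (m + 1) D,
      ∀ γ, (e (Sum.inr γ)).1 = γ.1 + Finsupp.single 0 d := by
  classical
  let ι : wlMon (m + 1) (D - d) → wlMon (m + 1) D := fun γ => ⟨γ.1 + Finsupp.single 0 d, by
    have := wl_mem_mon.mp γ.2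
    rw [wl_mem_mon]
    simp only [Finsupp.add_apply, Finset.sum_add_distrib]
    rw [this]
    have h2 : ∑ i : Fin (m + 1), (Finsupp.single (0 : Fin (m+1)) d) i = d := by
      simp [Finsupp.single_apply]
    omega⟩
  have hι : Function.Injective ι := by
    intro a b hab
    have := congrArg Subtype.val hab
    exact Subtype.ext (add_right_cancel this)
  have hc : Fintype.card ((Set.range ι)ᶜ : Set (wlMon (m + 1) D)) = s := by
    rw [Fintype.card_compl_set, Set.card_range_of_injective hι]
    simp; omega
  let e1 : Fin s ≃ ((Set.range ι)ᶜ : Set (wlMon (m + 1) D)) := (Fintype.equivFinOfCardEq hc).symm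
  refine ⟨((Equiv.sumCongr e1 (Equiv.ofInjective ι hι)).trans (Equiv.sumComm _ _)).trans (Equiv.Set.sumCompl (Set.range ι)), ?_⟩
  intro γ
  simp [ι]

set_option maxHeartbeats 1000000 in
theorem wl_arch {m d D s : ℕ} (f : MvPolynomial (Fin (m + 1)) ℤ) (hf : f.IsHomogeneous d)
    (hdD : d ≤ D)
    (e : Fin s ⊕ wlMon (m + 1) (D - d) ≃ wlMon (m + 1) D)
    (he : ∀ γ, (e (Sum.inr γ)).1 = γ.1 + Finsupp.single 0 d)
    (q : Fin s → MvPolynomial (Fin (m + 1)) ℤ) (hq : ∀ j, (q j).IsHomogeneous D)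
    (hu : IsUnit (Matrix.of fun k j => coeff (e k).1
          (Sum.elim q (fun γ : wlMon (m + 1) (D - d) => f * monomial γ.1 1) j)).det)
    (ξ : Fin s → Fin (m + 1) → ℤ) (hξ : ∀ i, eval (ξ i) f = 0) (B : ℝ)
    (hB : ∀ i k, |(ξ i k : ℝ)| ≤ B)
    (z : Fin (m + 1) → ℂ) (hz : ∀ i, ‖z i‖ = 1) :
    |((Matrix.of fun i j => eval (ξ i) (q j)).det : ℝ)| *
      ‖eval z (map (Int.castRingHom ℂ) f)‖ ^ (wlMon (m + 1) (D - d)).card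
      ≤ s.factorial * (2 * B) ^ (D * s) := by
  classical
  set F := map (Int.castRingHom ℂ) f with hFdef
  have hF : F.IsHomogeneous d := hf.map _
  let v : Fin m → ℂ := fun j => z j.succ / z 0
  have hz0 : z 0 ≠ 0 := by
    intro h; have := hz 0; rw [h] at this; simp at this
  have hv : ∀ j, ‖v j‖ = 1 := fun j => by simp [v, hz]
  let η : Fin s → Fin (m + 1) → ℂ := fun i => Fin.cons (ξ i 0 : ℂ) (fun j => (ξ i j.succ : ℂ) - v j * (ξ i 0 : ℂ))
  have hηe : ∀ i G, eval (η i) (wlSh v G) = eval (fun k => (ξ i k : ℂ)) G := fun i G =>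
    wlSh_eval v (fun k => (ξ i k : ℂ)) G
  have hev : ∀ i (G : MvPolynomial (Fin (m + 1)) ℤ), eval (fun k => (ξ i k : ℂ)) (map (Int.castRingHom ℂ) G) = ((eval (ξ i) G : ℤ) : ℂ) := by
    intro i G
    have := map_eval (Int.castRingHom ℂ) (ξ i) G
    simpa [Function.comp_def] using this.symm
  -- the coefficient
  have ha : coeff (Finsupp.single 0 d) (wlSh v F) * (z 0) ^ d = eval z F := by
    have h1 := wlSh_eval v z F
    rw [← h1]
    have h2 : (Fin.cons (z 0) (fun j => z j.succ - v j * z 0) : Fin (m + 1) → ℂ) = Pi.single 0 (z 0) := by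
      ext i
      refine Fin.cases ?_ (fun j => ?_) i
      · simp
      · simp [v, hz0]
    rw [h2, eval_eq']
    rw [Finset.sum_eq_single (Finsupp.single 0 d)]
    · rw [Fin.prod_univ_succ]; simp [Finsupp.single_apply, (Fin.succ_ne_zero _).symm]
    · intro b hb hne
      have h3 := wl_mem_mon.mp ((wl_homog_iff _).mp (wlSh_homog v hF) b (mem_support_iff.mp hb))
      rw [Fin.prod_univ_succ]
      have : ∃ j : Fin m, b j.succ ≠ 0 := by
        by_contra hcon
        push Not at hcon
        apply hne
        rw [Fin.sum_univ_succ] at h3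
        simp only [hcon, Finset.sum_const_zero, add_zero] at h3
        ext i
        refine Fin.cases ?_ (fun j => ?_) i
        · simp [h3]
        · simp [hcon, Finsupp.single_apply, (Fin.succ_ne_zero _).symm]
      obtain ⟨j, hj⟩ := this
      rw [Finset.prod_eq_zero (Finset.mem_univ j) (by simp [hj])]
      simp
    · intro h
      rw [notMem_support_iff] at h
      rw [h, zero_mul]
  set a := coeff (Finsupp.single 0 d) (wlSh v F) with hadef
  have hna : ‖a‖ = ‖eval z F‖ := by rw [← ha]; simp [hz]
  -- functionals
  let θ : (Fin s ⊕ wlMon (m + 1) (D - d)) → MvPolynomial (Fin (m + 1)) ℂ →ₗ[ℂ] ℂ :=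
    Sum.elim (fun i => (aeval (η i)).toLinearMap) (fun γ => lcoeff ℂ (γ.1 + Finsupp.single 0 d))
  have hθl : ∀ i G, θ (Sum.inl i) G = eval (η i) G := fun i G => by
    rw [← coe_aeval_eq_eval]; rfl
  have hθr : ∀ γ G, θ (Sum.inr γ) G = coeff (γ.1 + Finsupp.single 0 d) G := fun i G => rfl
  let bb : (Fin s ⊕ wlMon (m + 1) (D - d)) → MvPolynomial (Fin (m + 1)) ℤ :=
    Sum.elim q (fun γ => f * monomial γ.1 1)
  have hbb : ∀ j, (bb j).IsHomogeneous D := by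
    rintro (j | γ)
    · exact hq j
    · have h1 : (monomial γ.1 (1:ℤ)).IsHomogeneous (D - d) := by
        apply isHomogeneous_monomial
        rw [Finsupp.degree_eq_sum, wl_mem_mon.mp γ.2]
      have := hf.mul h1
      rwa [Nat.add_sub_cancel' hdD] at this
  have hmon : ∀ l, (monomial (e l).1 (1:ℂ)).IsHomogeneous D := fun l => by
    apply isHomogeneous_monomial
    rw [Finsupp.degree_eq_sum, wl_mem_mon.mp (e l).2]
  let Bm : Matrix (Fin s ⊕ wlMon (m + 1) (D - d)) (Fin s ⊕ wlMon (m + 1) (D - d)) ℂ :=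
    Matrix.of fun k j => coeff (e k).1 (map (Int.castRingHom ℂ) (bb j))
  let U : Matrix (Fin s ⊕ wlMon (m + 1) (D - d)) (Fin s ⊕ wlMon (m + 1) (D - d)) ℂ :=
    Matrix.of fun k l => coeff (e k).1 (wlSh v (monomial (e l).1 1))
  let Θ : Matrix (Fin s ⊕ wlMon (m + 1) (D - d)) (Fin s ⊕ wlMon (m + 1) (D - d)) ℂ :=
    Matrix.of fun k l => θ k (monomial (e l).1 1)
  let E : Matrix (Fin s) (Fin s) ℂ := Matrix.of fun i l => eval (η i) (monomial (e (Sum.inl l)).1 1)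
  have hprod : Θ * U * Bm = Matrix.of fun k j => θ k (wlSh v (map (Int.castRingHom ℂ) (bb j))) := by
    have h1 : Θ * U = Matrix.of fun k l => θ k (wlSh v (monomial (e l).1 1)) := by
      ext k l
      rw [Matrix.mul_apply]
      exact wl_theta e (θ k) _ (wlSh_homog v (hmon l))
    rw [h1]
    ext k j
    rw [Matrix.mul_apply]
    exact wl_theta e ((θ k).comp (wlSh v).toLinearMap) (map (Int.castRingHom ℂ) (bb j)) ((hbb j).map (Int.castRingHom ℂ))
  have hBdet : ‖Bm.det‖ = 1 := by
    have h1 : Bm = (Int.castRingHom ℂ).mapMatrix (Matrix.of fun k j => coeff (e k).1 (bb j)) := by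
      ext k j; simp [Bm, coeff_map]
    rw [h1, ← RingHom.map_det]
    rcases Int.isUnit_iff.mp hu with h | h
    · have h' : (Matrix.of fun k j => coeff (e k).1 (bb j)).det = 1 := h
      rw [h']; simp
    · have h' : (Matrix.of fun k j => coeff (e k).1 (bb j)).det = -1 := h
      rw [h']; simp
  have hUdet : U.det = 1 := wlU_det v e
  have hΘ : Θ = Matrix.fromBlocks E (Matrix.of fun i γ => eval (η i) (monomial (e (Sum.inr γ)).1 1)) 0 1 := by
    ext (i | γ) (j | δ)
    · simp only [Θ, Matrix.of_apply, hθl, Matrix.fromBlocks_apply₁₁, E]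
    · simp only [Θ, Matrix.of_apply, hθl, Matrix.fromBlocks_apply₁₂]
    · simp only [Θ, Matrix.of_apply, hθr, Matrix.fromBlocks_apply₂₁, Matrix.zero_apply]
      rw [← he, coeff_monomial, if_neg]
      intro h
      have := e.injective (Subtype.ext h)
      simp at this
    · simp only [Θ, Matrix.of_apply, hθr, Matrix.fromBlocks_apply₂₂]
      rw [← he, coeff_monomial, Matrix.one_apply]
      have : (e (Sum.inr δ)).1 = (e (Sum.inr γ)).1 ↔ γ = δ := by
        rw [← Subtype.ext_iff, e.injective.eq_iff, Sum.inr.injEq, eq_comm]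
      simp [this]
  have hΘdet : Θ.det = E.det := by
    rw [hΘ, Matrix.det_fromBlocks_zero₂₁, Matrix.det_one, mul_one]
  let T : Matrix (wlMon (m + 1) (D - d)) (wlMon (m + 1) (D - d)) ℂ :=
    Matrix.of fun γ δ => coeff (γ.1 + Finsupp.single 0 d) (wlSh v F * wlSh v (monomial δ.1 1))
  have hTdet : T.det = a ^ (wlMon (m + 1) (D - d)).card := by
    have h1 : T = (Matrix.of fun γ δ : wlMon (m + 1) (D - d) =>
        coeff (γ.1 + Finsupp.single 0 d) (wlSh v F * monomial δ.1 1)) *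
        (Matrix.of fun k l : wlMon (m + 1) (D - d) => coeff (Equiv.refl _ k).1 (wlSh v (monomial (Equiv.refl _ l).1 1))) := by
      ext γ δ
      rw [Matrix.mul_apply]
      have hm : (monomial δ.1 (1:ℂ)).IsHomogeneous (D - d) := by
        apply isHomogeneous_monomial
        rw [Finsupp.degree_eq_sum, wl_mem_mon.mp δ.2]
      exact (wl_theta (Equiv.refl _) ((lcoeff ℂ (γ.1 + Finsupp.single 0 d)).comp (LinearMap.mulLeft ℂ (wlSh v F))) _ (wlSh_homog v hm)).symm
    rw [h1, Matrix.det_mul, wlU_det, mul_one, wlTri_det _ (wlSh_homog v hF)]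
  have hR : (Matrix.of fun k j => θ k (wlSh v (map (Int.castRingHom ℂ) (bb j)))) =
      Matrix.fromBlocks ((Int.castRingHom ℂ).mapMatrix (Matrix.of fun i j => eval (ξ i) (q j))) 0
        (Matrix.of fun γ j => coeff (γ.1 + Finsupp.single 0 d) (wlSh v (map (Int.castRingHom ℂ) (q j)))) T := by
    ext (i | γ) (j | δ)
    · simp only [Matrix.of_apply, hθl, Matrix.fromBlocks_apply₁₁, hηe, hev, bb, Sum.elim_inl]
      simp
    · simp only [Matrix.of_apply, hθl, Matrix.fromBlocks_apply₁₂, hηe, hev, bb, Sum.elim_inr]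
      simp [hξ]
    · simp only [Matrix.of_apply, hθr, Matrix.fromBlocks_apply₂₁, bb, Sum.elim_inl]
    · simp only [Matrix.of_apply, hθr, Matrix.fromBlocks_apply₂₂, bb, Sum.elim_inr, T]
      rw [map_mul, map_mul, map_monomial]; simp [hFdef]
  have hdet := congrArg Matrix.det hprod
  rw [Matrix.det_mul, Matrix.det_mul, hUdet, hΘdet, mul_one, hR, Matrix.det_fromBlocks_zero₁₂, hTdet, ← RingHom.map_det] at hdet
  have hnorm := congrArg norm hdet
  rw [norm_mul, hBdet, mul_one, norm_mul, norm_pow, hna] at hnorm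
  have hcast : ‖(Int.castRingHom ℂ) (Matrix.of fun i j => eval (ξ i) (q j)).det‖ =
      |((Matrix.of fun i j => eval (ξ i) (q j)).det : ℝ)| := by
    rw [eq_intCast, Complex.norm_intCast]
  rw [hcast] at hnorm
  rw [← hnorm]
  have hη : ∀ i k, ‖η i k‖ ≤ 2 * B := by
    intro i k
    have h0 := hB i 0
    have h00 := abs_nonneg (ξ i 0 : ℝ)
    refine Fin.cases ?_ (fun j => ?_) k
    · simp only [η, Fin.cons_zero, Complex.norm_intCast]
      linarith
    · simp only [η, Fin.cons_succ]
      refine (norm_sub_le _ _).trans ?_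
      rw [norm_mul, hv, one_mul, Complex.norm_intCast, Complex.norm_intCast]
      linarith [hB i j.succ]
  have hE : ∀ i l, ‖E i l‖ ≤ (2 * B) ^ D := by
    intro i l
    have hsum := wl_mem_mon.mp (e (Sum.inl l)).2
    simp only [E, Matrix.of_apply, eval_monomial, one_mul]
    rw [Finsupp.prod_fintype _ _ (fun i => pow_zero _), norm_prod]
    have hpw : (2 * B) ^ D = ∏ k, (2 * B) ^ ((e (Sum.inl l)).1 k) := by
      rw [Finset.prod_pow_eq_pow_sum, hsum]
    rw [hpw]
    apply Finset.prod_le_prod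
    · intro k _; positivity
    · intro k _
      rw [norm_pow]
      exact pow_le_pow_left₀ (norm_nonneg _) (hη i k) _
  have := Matrix.det_le (A := E) (abv := NormedField.toAbsoluteValue ℂ) (x := (2 * B) ^ D) hE
  rw [Fintype.card_fin, nsmul_eq_mul, ← pow_mul] at this
  exact this

theorem wl_normMax_fourier {m : ℕ} (f : MvPolynomial (Fin m) ℤ) (hf0 : f ≠ 0) :
    ∃ z : Fin m → ℂ, (∀ i, ‖z i‖ = 1) ∧ normMax f ≤ ‖eval z (map (Int.castRingHom ℂ) f)‖ := by
  obtain ⟨α, hα, h⟩ := Finset.exists_mem_eq_sup f.support (support_nonempty.mpr hf0) (fun m => (f.coeff m).natAbs)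
  obtain ⟨z, hz, hz2⟩ := wl_fourier (map (Int.castRingHom ℂ) f) α
  refine ⟨z, hz, le_trans (le_of_eq ?_) hz2⟩
  unfold normMax
  rw [h, coeff_map, eq_intCast, Complex.norm_intCast, Nat.cast_natAbs, Int.cast_abs]

theorem wl_one_le_normMax {m : ℕ} (f : MvPolynomial (Fin m) ℤ) (hf0 : f ≠ 0) : 1 ≤ normMax f := by
  obtain ⟨α, hα⟩ := support_nonempty.mpr hf0
  unfold normMax
  have h1 : (f.coeff α).natAbs ≤ f.support.sup fun m => (f.coeff m).natAbs :=
    Finset.le_sup (f := fun m => (f.coeff m).natAbs) hα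
  have h2 : 1 ≤ (f.coeff α).natAbs := by
    rw [Nat.one_le_iff_ne_zero, Int.natAbs_ne_zero]
    exact mem_support_iff.mp hα
  exact_mod_cast h2.trans h1

theorem wl_global {n d D s : ℕ} (f : MvPolynomial (Fin (n + 2)) ℤ) (hf : f.IsHomogeneous d)
    (hprim : Finset.gcd f.support f.coeff = 1) (hf0 : f ≠ 0) (hdD : d ≤ D) (B : ℝ) (hB : 1 ≤ B)
    (H : ∀ g : MvPolynomial (Fin (n + 2)) ℤ, g.IsHomogeneous D →
      (∀ v : Fin (n + 2) → ℤ, Finset.univ.gcd v = 1 →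
            MvPolynomial.eval v f = 0 → (∀ i, |(v i : ℝ)| ≤ B) → MvPolynomial.eval v g = 0) → f ∣ g)
    (hs : s + (n + 1 + (D - d)).choose (n + 1) = (n + 1 + D).choose (n + 1)) :
    ∃ (q : Fin s → MvPolynomial (Fin (n + 2)) ℤ) (ξ : Fin s → Fin (n + 2) → ℤ),
      (∀ j, (q j).IsHomogeneous D) ∧ (∀ i, Finset.univ.gcd (ξ i) = 1) ∧ (∀ i, eval (ξ i) f = 0) ∧
      (Matrix.of fun i j => eval (ξ i) (q j)).det ≠ 0 ∧
      |((Matrix.of fun i j => eval (ξ i) (q j)).det : ℝ)| *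
        normMax f ^ (n + 1 + (D - d)).choose (n + 1) ≤ s.factorial * (2 * B) ^ (D * s) := by
  have hc : ∀ k, (wlMon (n + 2) k).card = (n + 1 + k).choose (n + 1) := fun k => wl_card_mon_eq (n + 1) k
  obtain ⟨q, hq, hqi, hqu⟩ := wl_lattice f hf hprim hf0 hdD s (by rw [hc, hc]; exact hs)
  obtain ⟨e, he⟩ := wl_exists_equiv (m := n + 1) (d := d) (D := D) (s := s) hdD (by rw [hc, hc]; exact hs)
  let ι := {v : Fin (n + 2) → ℤ // Finset.univ.gcd v = 1 ∧ eval v f = 0 ∧ ∀ i, |(v i : ℝ)| ≤ B}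
  obtain ⟨ξ, hξ⟩ := wl_exists_minor_domain (ι := ι) (κ := Fin s) (R := ℤ)
    (Matrix.of fun v j => eval v.1 (q j)) (by
      intro x hx
      apply hqi
      apply H
      · apply IsHomogeneous.sum
        intro j _
        simpa using (isHomogeneous_C (Fin (n + 2)) (x j)).mul (hq j)
      · intro v h1 h2 h3
        have := hx ⟨v, h1, h2, h3⟩
        simp only [Matrix.of_apply] at this
        rw [map_sum, ← this]
        apply Finset.sum_congr rfl
        intro j _
        rw [map_mul, eval_C, mul_comm])
  obtain ⟨z, hz, hz2⟩ := wl_normMax_fourier f hf0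
  refine ⟨q, fun i => (ξ i).1, hq, fun i => (ξ i).2.1, fun i => (ξ i).2.2.1, hξ, ?_⟩
  refine le_trans ?_ (wl_arch f hf hdD e he q hq (hqu e) (fun i => (ξ i).1) (fun i => (ξ i).2.2.1) B (fun i => (ξ i).2.2.2) z hz)
  rw [hc]
  apply mul_le_mul_of_nonneg_left _ (abs_nonneg _)
  exact pow_le_pow_left₀ (by linarith [wl_one_le_normMax f hf0]) hz2 _


/-- Apply a linear functional to the coefficients. -/
noncomputable def wlFun {σ K : Type*} [Field K] [Algebra ℚ K] (ℓ : K →ₗ[ℚ] ℚ) (g : MvPolynomial σ K) :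
    MvPolynomial σ ℚ := ∑ a ∈ g.support, monomial a (ℓ (coeff a g))

theorem wlFun_coeff {σ K : Type*} [Field K] [Algebra ℚ K] (ℓ : K →ₗ[ℚ] ℚ) (g : MvPolynomial σ K)
    (a : σ →₀ ℕ) : coeff a (wlFun ℓ g) = ℓ (coeff a g) := by
  classical
  rw [wlFun, coeff_sum]
  simp only [coeff_monomial]
  rw [Finset.sum_ite_eq']
  split_ifs with h
  · rfl
  · rw [notMem_support_iff] at h
    rw [h, map_zero]

theorem wlFun_eval {m : ℕ} {K : Type*} [Field K] [Algebra ℚ K] (ℓ : K →ₗ[ℚ] ℚ)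
    (g : MvPolynomial (Fin m) K) (v : Fin m → ℚ) :
    eval v (wlFun ℓ g) = ℓ (eval (fun i => algebraMap ℚ K (v i)) g) := by
  rw [wlFun, map_sum, eval_eq', map_sum]
  apply Finset.sum_congr rfl
  intro a _
  rw [eval_monomial, Finsupp.prod_fintype _ _ (fun i => pow_zero _)]
  simp only [← map_pow, ← map_prod]
  rw [mul_comm (coeff a g), ← Algebra.smul_def, map_smul, smul_eq_mul, mul_comm]

theorem wlFun_degree {m : ℕ} {K : Type*} [Field K] [Algebra ℚ K] (ℓ : K →ₗ[ℚ] ℚ)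
    (g : MvPolynomial (Fin m) K) : (wlFun ℓ g).totalDegree ≤ g.totalDegree := by
  apply Finset.sup_mono
  intro a ha
  rw [mem_support_iff, wlFun_coeff] at ha
  rw [mem_support_iff]
  intro h; rw [h, map_zero] at ha; exact ha rfl

theorem wlFun_ne_zero {m : ℕ} {K : Type*} [Field K] [Algebra ℚ K]
    (g : MvPolynomial (Fin m) K) (hg : g ≠ 0) : ∃ ℓ : K →ₗ[ℚ] ℚ, wlFun ℓ g ≠ 0 := by
  obtain ⟨a, ha⟩ := ne_zero_iff.mp hg
  have : ∃ ℓ : Module.Dual ℚ K, ℓ (coeff a g) ≠ 0 := by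
    by_contra h
    push Not at h
    exact ha ((Module.forall_dual_apply_eq_zero_iff ℚ _).mp h)
  obtain ⟨ℓ, hℓ⟩ := this
  refine ⟨ℓ, fun h => hℓ ?_⟩
  have := wlFun_coeff ℓ g a
  rw [← this, h, coeff_zero]

theorem wl_clear {σ : Type*} (G : MvPolynomial σ ℚ) :
    ∃ (N : ℤ) (g : MvPolynomial σ ℤ), N ≠ 0 ∧ map (Int.castRingHom ℚ) g = C (N : ℚ) * G := by
  obtain ⟨b, hb⟩ := IsLocalization.exist_integer_multiples (nonZeroDivisors ℤ) G.support (fun a => coeff a G)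
  have hb' : ∀ a, ∃ y : ℤ, (y : ℚ) = (b : ℤ) * coeff a G := by
    intro a
    by_cases ha : a ∈ G.support
    · obtain ⟨y, hy⟩ := hb a ha
      refine ⟨y, ?_⟩
      rw [zsmul_eq_mul] at hy
      simpa using hy
    · rw [notMem_support_iff] at ha
      exact ⟨0, by simp [ha]⟩
  choose y hy using hb'
  refine ⟨b, ∑ a ∈ G.support, monomial a (y a), nonZeroDivisors.coe_ne_zero b, ?_⟩
  ext a
  rw [coeff_map, coeff_C_mul, coeff_sum]
  classical
  simp only [coeff_monomial]
  rw [Finset.sum_ite_eq', ← hy]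
  split_ifs with h
  · rfl
  · rw [notMem_support_iff] at h
    have := hy a
    rw [h, mul_zero] at this
    rw [this]; simp

theorem wl_component_zero {m : ℕ} (G : MvPolynomial (Fin m) ℚ) (v : Fin m → ℚ)
    (h : ∀ t : ℚ, eval (fun i => t * v i) G = 0) (k : ℕ) :
    eval v (homogeneousComponent k G) = 0 := by
  let P : Polynomial ℚ := ∑ i ∈ Finset.range (G.totalDegree + 1),
    Polynomial.monomial i (eval v (homogeneousComponent i G))
  have hP : P = 0 := by
    apply Polynomial.funext
    intro t
    rw [Polynomial.eval_zero, ← h t]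
    conv_rhs => rw [← sum_homogeneousComponent G, map_sum]
    simp only [P, Polynomial.eval_finset_sum, Polynomial.eval_monomial]
    apply Finset.sum_congr rfl
    intro i _
    have hh := (homogeneousComponent_isHomogeneous i G)
    rw [eval_eq', eval_eq', Finset.sum_mul]
    apply Finset.sum_congr rfl
    intro a ha
    have := wl_mem_mon.mp ((wl_homog_iff _).mp hh a (mem_support_iff.mp ha))
    simp only [mul_pow, Finset.prod_mul_distrib]
    rw [Finset.prod_pow_eq_pow_sum, this]; ring
  by_cases hk : k ∈ Finset.range (G.totalDegree + 1)
  · have := congrArg (fun Q => Polynomial.coeff Q k) hP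
    simp only [P, Polynomial.finset_sum_coeff, Polynomial.coeff_monomial, Polynomial.coeff_zero] at this
    rw [Finset.sum_ite_eq', if_pos hk] at this
    exact this
  · simp only [Finset.mem_range, not_lt] at hk
    rw [homogeneousComponent_eq_zero _ _ (by omega), map_zero]

theorem wl_reducible {m d : ℕ} (f : MvPolynomial (Fin m) ℤ) (hf : f.IsHomogeneous d)
    (hirr : Irreducible (map (Int.castRingHom ℚ) f))
    (hnot : ¬ Irreducible (map (Int.castRingHom (AlgebraicClosure ℚ)) f)) :
    ∃ (g : MvPolynomial (Fin m) ℤ) (M : ℕ), g.IsHomogeneous M ∧ M ≤ d ∧ ¬ f ∣ g ∧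
      ∀ v : Fin m → ℤ, eval v f = 0 → eval v g = 0 := by
  set F := map (Int.castRingHom (AlgebraicClosure ℚ)) f with hF
  set fq := map (Int.castRingHom ℚ) f with hfq
  have hf0 : f ≠ 0 := by rintro rfl; simp [hfq] at hirr
  have hinj : Function.Injective (Int.castRingHom (AlgebraicClosure ℚ)) := Int.cast_injective
  have hF0 : F ≠ 0 := by
    intro h; exact hf0 ((map_eq_zero_iff _ (map_injective _ hinj)).mp h)
  have hfd : f.totalDegree = d := hf.totalDegree hf0
  have hFd : F.totalDegree = d := (hf.map _).totalDegree hF0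
  have hfqd : fq.totalDegree = d := (hf.map _).totalDegree hirr.ne_zero
  have hd : 1 ≤ d := by rw [← hfqd]; exact wl_pos_of_irreducible hirr
  have hFu : ¬ IsUnit F := by
    intro h
    have := (isUnit_iff_totalDegree_of_isReduced.mp h).2
    omega
  have : ∃ g h, F = g * h ∧ ¬ IsUnit g ∧ ¬ IsUnit h := by
    by_contra hcon
    push Not at hcon
    exact hnot ⟨hFu, fun {a b} hab => by
      by_cases ha : IsUnit a
      · exact Or.inl ha
      · exact Or.inr (hcon a b hab ha)⟩
  obtain ⟨g, h, hgh, hg, hh⟩ := this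
  have hg0 : g ≠ 0 := by rintro rfl; simp at hgh; exact hF0 hgh
  have hh0 : h ≠ 0 := by rintro rfl; simp at hgh; exact hF0 hgh
  have hpos : ∀ g : MvPolynomial (Fin m) (AlgebraicClosure ℚ), g ≠ 0 → ¬ IsUnit g → 1 ≤ g.totalDegree := by
    intro g hg0 hg
    by_contra hlt
    apply hg
    have h1 := totalDegree_eq_zero_iff_eq_C.mp (show g.totalDegree = 0 by omega)
    rw [h1]
    apply IsUnit.map
    rw [isUnit_iff_ne_zero]
    intro h2; rw [h2, C_0] at h1; exact hg0 h1
  have hdeg : g.totalDegree + h.totalDegree = d := by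
    rw [← totalDegree_mul_of_isDomain hg0 hh0, ← hgh, hFd]
  have hg1 := hpos g hg0 hg
  have hh1 := hpos h hh0 hh
  obtain ⟨ℓ, hℓ⟩ := wlFun_ne_zero g hg0
  obtain ⟨ℓ', hℓ'⟩ := wlFun_ne_zero h hh0
  set G := wlFun ℓ g * wlFun ℓ' h with hG
  have hGd : G.totalDegree ≤ d := by
    have h1 := wlFun_degree ℓ g
    have h2 := wlFun_degree ℓ' h
    have := totalDegree_mul (wlFun ℓ g) (wlFun ℓ' h)
    rw [hG]; omega
  have hndvd : ∀ P : MvPolynomial (Fin m) ℚ, P ≠ 0 → P.totalDegree < d → ¬ fq ∣ P := by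
    rintro P hP0 hPd ⟨Q, rfl⟩
    rw [totalDegree_mul_of_isDomain hirr.ne_zero (right_ne_zero_of_mul hP0)] at hPd
    omega
  have hGn : ¬ fq ∣ G := by
    intro hdvd
    rcases hirr.prime.dvd_or_dvd hdvd with h1 | h1
    · exact hndvd _ hℓ (by have := wlFun_degree ℓ g; omega) h1
    · exact hndvd _ hℓ' (by have := wlFun_degree ℓ' h; omega) h1
  have hGz : ∀ v : Fin m → ℚ, eval v fq = 0 → eval v G = 0 := by
    intro v hv
    have h1 : eval (fun i => algebraMap ℚ (AlgebraicClosure ℚ) (v i)) F = 0 := by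
      have h2 : F = map (algebraMap ℚ (AlgebraicClosure ℚ)) fq := by
        rw [hfq, map_map, hF]
        congr 2
      rw [h2]
      have := map_eval (algebraMap ℚ (AlgebraicClosure ℚ)) v fq
      rw [hv, map_zero] at this
      exact this.symm
    rw [hgh, map_mul] at h1
    rw [hG, map_mul, wlFun_eval, wlFun_eval]
    rcases mul_eq_zero.mp h1 with h2 | h2
    · rw [h2, map_zero, zero_mul]
    · rw [h2, map_zero, mul_zero]
  have : ∃ k ∈ Finset.range (G.totalDegree + 1), ¬ fq ∣ homogeneousComponent k G := by
    by_contra hcon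
    push Not at hcon
    apply hGn
    rw [← sum_homogeneousComponent G]
    exact Finset.dvd_sum hcon
  obtain ⟨k, hk, hkn⟩ := this
  obtain ⟨N, g', hN, hg'⟩ := wl_clear (homogeneousComponent k G)
  have hQinj : Function.Injective (Int.castRingHom ℚ) := Int.cast_injective
  refine ⟨g', k, ?_, ?_, ?_, ?_⟩
  · have h1 : (map (Int.castRingHom ℚ) g').IsHomogeneous k := by
      rw [hg']
      simpa using (isHomogeneous_C (Fin m) (N : ℚ)).mul (homogeneousComponent_isHomogeneous k G)
    exact h1.of_map hQinj
  · simp only [Finset.mem_range] at hk; omega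
  · intro hdvd
    apply hkn
    have h1 : fq ∣ map (Int.castRingHom ℚ) g' := map_dvd _ hdvd
    rw [hg'] at h1
    have hu : IsUnit (C (N : ℚ) : MvPolynomial (Fin m) ℚ) := by
      apply IsUnit.map; rw [isUnit_iff_ne_zero]; exact_mod_cast hN
    exact (hu.dvd_mul_left).mp h1
  · intro v hv
    have hcast : ∀ P : MvPolynomial (Fin m) ℤ, eval (fun i => (v i : ℚ)) (map (Int.castRingHom ℚ) P) = ((eval v P : ℤ) : ℚ) := by
      intro P
      have := map_eval (Int.castRingHom ℚ) v P
      simpa [Function.comp_def] using this.symm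
    have h2 : ∀ t : ℚ, eval (fun i => t * (v i : ℚ)) G = 0 := by
      intro t
      apply hGz
      have h3 : eval (fun i => (v i : ℚ)) fq = 0 := by rw [hfq, hcast, hv]; simp
      rw [eval_eq'] at h3 ⊢
      have : ∑ a ∈ fq.support, coeff a fq * ∏ i, (t * (v i : ℚ)) ^ a i = t ^ d * ∑ a ∈ fq.support, coeff a fq * ∏ i, (v i : ℚ) ^ a i := by
        rw [Finset.mul_sum]
        apply Finset.sum_congr rfl
        intro a ha
        have := wl_mem_mon.mp ((wl_homog_iff _).mp (hf.map (Int.castRingHom ℚ)) a (mem_support_iff.mp ha))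
        simp only [mul_pow, Finset.prod_mul_distrib]
        rw [Finset.prod_pow_eq_pow_sum, this]; ring
      rw [this, h3, mul_zero]
    have h3 := wl_component_zero G (fun i => (v i : ℚ)) h2 k
    have h4 := hcast g'
    rw [hg', map_mul, h3, mul_zero] at h4
    exact_mod_cast h4.symm


/-- Generic polynomial of degree at most `e`, specialised at `x`. -/
noncomputable def wlGen {R : Type*} [CommRing R] {m e : ℕ} (x : wlMonLE m e → R) :
    MvPolynomial (Fin m) R := ∑ α : wlMonLE m e, monomial α.1 (x α)

theorem wlGen_map {R S : Type*} [CommRing R] [CommRing S] {m e : ℕ} (ψ : R →+* S) (x : wlMonLE m e → R) :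
    map ψ (wlGen x) = wlGen (fun α => ψ (x α)) := by
  simp [wlGen, map_sum, map_monomial]

theorem wlGen_deg {R : Type*} [CommRing R] {m e : ℕ} (x : wlMonLE m e → R) :
    (wlGen x).totalDegree ≤ e := by
  unfold wlGen
  apply totalDegree_finsetSum_le
  intro α _
  refine (totalDegree_monomial_le _ _).trans ?_
  have := wl_mem_monLE.mp α.2
  rwa [← wl_sum_eq_univ] at this

theorem wlGen_surj {R : Type*} [CommRing R] {m e : ℕ} (G : MvPolynomial (Fin m) R)
    (hG : G.totalDegree ≤ e) : wlGen (fun α : wlMonLE m e => coeff α.1 G) = G := by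
  classical
  ext a
  rw [wlGen, coeff_sum]
  simp only [coeff_monomial]
  by_cases ha : a ∈ wlMonLE m e
  · rw [Finset.sum_eq_single ⟨a, ha⟩]
    · simp
    · intro b _ hb
      rw [if_neg]
      intro h; exact hb (Subtype.ext h)
    · simp
  · rw [Finset.sum_eq_zero]
    · symm
      by_contra h
      apply ha
      rw [wl_mem_monLE]
      have := le_totalDegree (mem_support_iff.mpr h)
      rw [wl_sum_eq_univ] at this
      omega
    · intro b _
      rw [if_neg]
      intro h; apply ha; rw [← h]; exact b.2

/-- Equation for the coefficient of index `γ` in a factorisation. -/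
noncomputable def wlEqn {m : ℕ} (f : MvPolynomial (Fin m) ℤ) (e e' : ℕ) (γ : Fin m →₀ ℕ) :
    MvPolynomial (wlMonLE m e ⊕ wlMonLE m e') ℤ :=
  coeff γ (wlGen (fun α : wlMonLE m e => X (R := ℤ) (Sum.inl α : wlMonLE m e ⊕ wlMonLE m e')) *
    wlGen (fun α : wlMonLE m e' => X (R := ℤ) (Sum.inr α : wlMonLE m e ⊕ wlMonLE m e'))) - C (coeff γ f)

theorem wlEqn_spec {K : Type*} [CommRing K] {m : ℕ} (f : MvPolynomial (Fin m) ℤ) (e e' : ℕ)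
    (ψ : MvPolynomial (wlMonLE m e ⊕ wlMonLE m e') ℤ →+* K) :
    (∀ γ, ψ (wlEqn f e e' γ) = 0) ↔
      wlGen (fun α => ψ (X (Sum.inl α))) * wlGen (fun α => ψ (X (Sum.inr α)))
        = map (Int.castRingHom K) f := by
  rw [← wlGen_map ψ (fun α => X (Sum.inl α)), ← wlGen_map ψ (fun α => X (Sum.inr α)), ← map_mul, MvPolynomial.ext_iff]
  apply forall_congr'
  intro γ
  rw [coeff_map, coeff_map, wlEqn, map_sub, sub_eq_zero]
  have : ψ (C (coeff γ f)) = Int.castRingHom K (coeff γ f) := by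
    have h := RingHom.ext_int (ψ.comp C) (Int.castRingHom K)
    exact congrArg (fun r => r (coeff γ f)) h
  rw [this]

theorem wl_nullst {V : Type} [Finite V] {ι : Type*} (P : ι → MvPolynomial V ℤ)
    (h : ∀ ψ : MvPolynomial V ℤ →+* AlgebraicClosure ℚ, ¬ ∀ i, ψ (P i) = 0) :
    ∃ N : ℤ, N ≠ 0 ∧ C N ∈ Ideal.span (Set.range P) := by
  have h1 : ∀ Q ∈ Ideal.span (Set.range fun i => map (Int.castRingHom ℚ) (P i)),
      ∃ (N : ℤ) (g : MvPolynomial V ℤ), N ≠ 0 ∧ g ∈ Ideal.span (Set.range P) ∧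
        map (Int.castRingHom ℚ) g = C (N : ℚ) * Q := by
    intro Q hQ
    induction hQ using Submodule.span_induction with
    | mem Q hQ =>
      obtain ⟨i, rfl⟩ := hQ
      exact ⟨1, P i, one_ne_zero, Ideal.subset_span ⟨i, rfl⟩, by simp⟩
    | zero => exact ⟨1, 0, one_ne_zero, Ideal.zero_mem _, by simp⟩
    | add a b _ _ ha hb =>
      obtain ⟨N, g, hN, hg, hgm⟩ := ha
      obtain ⟨N', g', hN', hg', hgm'⟩ := hb
      refine ⟨N * N', C N' * g + C N * g', mul_ne_zero hN hN', Ideal.add_mem _ (Ideal.mul_mem_left _ _ hg) (Ideal.mul_mem_left _ _ hg'), ?_⟩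
      rw [map_add, map_mul, map_mul, hgm, hgm', map_C, map_C]
      push_cast
      rw [C_mul]
      simp only [eq_intCast]
      ring
    | smul c x _ hx =>
      obtain ⟨N, g, hN, hg, hgm⟩ := hx
      obtain ⟨N', g', hN', hg'⟩ := wl_clear c
      refine ⟨N * N', g' * g, mul_ne_zero hN hN', Ideal.mul_mem_left _ _ hg, ?_⟩
      rw [map_mul, hgm, hg', smul_eq_mul]
      push_cast
      rw [C_mul]
      ring
  have h2 : Ideal.span (Set.range fun i => map (Int.castRingHom ℚ) (P i)) = ⊤ := by
    by_contra hne
    obtain ⟨M, hM, hle⟩ := Ideal.exists_le_maximal _ hne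
    letI : Field (MvPolynomial V ℚ ⧸ M) := Ideal.Quotient.field M
    have hfin : Module.Finite ℚ (MvPolynomial V ℚ ⧸ M) := finite_of_finite_type_of_isJacobsonRing ℚ _
    let φ : (MvPolynomial V ℚ ⧸ M) →ₐ[ℚ] AlgebraicClosure ℚ := IsAlgClosed.lift
    apply h ((φ : (MvPolynomial V ℚ ⧸ M) →+* AlgebraicClosure ℚ).comp ((Ideal.Quotient.mk M).comp (map (Int.castRingHom ℚ))))
    intro i
    have : map (Int.castRingHom ℚ) (P i) ∈ M := hle (Ideal.subset_span ⟨i, rfl⟩)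
    simp only [RingHom.comp_apply]
    rw [Ideal.Quotient.eq_zero_iff_mem.mpr this, map_zero]
  obtain ⟨N, g, hN, hg, hgm⟩ := h1 1 (by rw [h2]; trivial)
  refine ⟨N, hN, ?_⟩
  have : g = C N := by
    apply map_injective (Int.castRingHom ℚ) Int.cast_injective
    rw [hgm, map_C, mul_one]; rfl
  rwa [← this]

theorem wl_bad_one {m d : ℕ} (f : MvPolynomial (Fin m) ℤ) (hf : f.IsHomogeneous d)
    (hirr : Irreducible (map (Int.castRingHom (AlgebraicClosure ℚ)) f)) (e e' : ℕ)
    (he : e + e' = d) (h1 : 1 ≤ e) (h1' : 1 ≤ e') :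
    ∃ N : ℤ, N ≠ 0 ∧ ∀ (p : ℕ) (_ : Fact p.Prime)
      (g h : MvPolynomial (Fin m) (AlgebraicClosure (ZMod p))),
      g.totalDegree ≤ e → h.totalDegree ≤ e' →
      map (Int.castRingHom (AlgebraicClosure (ZMod p))) f = g * h → (p : ℤ) ∣ N := by
  obtain ⟨N, hN, hmem⟩ := wl_nullst (wlEqn f e e') (by
    intro ψ hψ
    rw [wlEqn_spec] at hψ
    have hd : (map (Int.castRingHom (AlgebraicClosure ℚ)) f).totalDegree = d := (hf.map _).totalDegree hirr.ne_zero
    have hd1 := wlGen_deg (fun α : wlMonLE m e => ψ (X (Sum.inl α)))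
    have hd2 := wlGen_deg (fun α : wlMonLE m e' => ψ (X (Sum.inr α)))
    have hd3 := totalDegree_mul (wlGen (fun α : wlMonLE m e => ψ (X (Sum.inl α)))) (wlGen (fun α : wlMonLE m e' => ψ (X (Sum.inr α))))
    rw [hψ, hd] at hd3
    rcases hirr.isUnit_or_isUnit hψ.symm with hu | hu
    · have := (isUnit_iff_totalDegree_of_isReduced.mp hu).2
      omega
    · have := (isUnit_iff_totalDegree_of_isReduced.mp hu).2
      omega)
  refine ⟨N, hN, ?_⟩
  intro p hp g h hg hh hfgh
  let x : wlMonLE m e ⊕ wlMonLE m e' → AlgebraicClosure (ZMod p) :=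
    Sum.elim (fun α => coeff α.1 g) (fun α => coeff α.1 h)
  let ψ : MvPolynomial (wlMonLE m e ⊕ wlMonLE m e') ℤ →+* AlgebraicClosure (ZMod p) :=
    eval₂Hom (Int.castRingHom _) x
  have hψ : ∀ γ, ψ (wlEqn f e e' γ) = 0 := by
    rw [wlEqn_spec, hfgh]
    simp only [ψ, eval₂Hom_X', x, Sum.elim_inl, Sum.elim_inr]
    rw [wlGen_surj g hg, wlGen_surj h hh]
  have h0 : ψ (C N) = 0 := by
    have : Ideal.span (Set.range (wlEqn f e e')) ≤ RingHom.ker ψ := by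
      rw [Ideal.span_le]
      rintro _ ⟨γ, rfl⟩
      exact hψ γ
    exact this hmem
  have h2 : ((N : ℤ) : AlgebraicClosure (ZMod p)) = 0 := by
    simpa [ψ] using h0
  rwa [CharP.intCast_eq_zero_iff (AlgebraicClosure (ZMod p)) p] at h2

theorem wl_bad_finite {m d : ℕ} (f : MvPolynomial (Fin m) ℤ) (hf : f.IsHomogeneous d)
    (hprim : Finset.gcd f.support f.coeff = 1)
    (hirr : Irreducible (map (Int.castRingHom (AlgebraicClosure ℚ)) f)) :
    ∃ N : ℤ, N ≠ 0 ∧ ∀ (p : ℕ) (_ : Fact p.Prime),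
      ¬ Irreducible (map (Int.castRingHom (AlgebraicClosure (ZMod p))) f) → (p : ℤ) ∣ N := by
  have hF0 := hirr.ne_zero
  have hd : 1 ≤ d := by
    rw [← (hf.map _).totalDegree hirr.ne_zero]; exact wl_pos_of_irreducible hirr
  have hall : ∀ e ∈ Finset.Ico 1 d, ∃ N : ℤ, N ≠ 0 ∧ ∀ (p : ℕ) (_ : Fact p.Prime)
      (g h : MvPolynomial (Fin m) (AlgebraicClosure (ZMod p))),
      g.totalDegree ≤ e → h.totalDegree ≤ d - e →
      map (Int.castRingHom (AlgebraicClosure (ZMod p))) f = g * h → (p : ℤ) ∣ N := by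
    intro e he
    rw [Finset.mem_Ico] at he
    exact wl_bad_one f hf hirr e (d - e) (by omega) (by omega) (by omega)
  choose! N hN hNp using hall
  refine ⟨∏ e ∈ Finset.Ico 1 d, N e, Finset.prod_ne_zero_iff.mpr hN, ?_⟩
  intro p hp hnot
  set F := map (Int.castRingHom (AlgebraicClosure (ZMod p))) f with hF
  have hF0 : F ≠ 0 := by
    intro h0
    have : (p : ℤ) ∣ 1 := by
      rw [← hprim]
      apply Finset.dvd_gcd
      intro a _
      have := congrArg (coeff a) h0
      rw [hF, coeff_map, coeff_zero, eq_intCast, CharP.intCast_eq_zero_iff (AlgebraicClosure (ZMod p)) p] at this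
      exact this
    have h2 := Int.natAbs_dvd_natAbs.mpr this
    simp at h2
    exact hp.out.one_lt.ne' h2
  have hFd : F.totalDegree = d := (hf.map _).totalDegree hF0
  have hFu : ¬ IsUnit F := by
    intro h
    have := (isUnit_iff_totalDegree_of_isReduced.mp h).2
    omega
  have : ∃ g h, F = g * h ∧ ¬ IsUnit g ∧ ¬ IsUnit h := by
    by_contra hcon
    push Not at hcon
    exact hnot ⟨hFu, fun {a b} hab => by
      by_cases ha : IsUnit a
      · exact Or.inl ha
      · exact Or.inr (hcon a b hab ha)⟩
  obtain ⟨g, h, hgh, hg, hh⟩ := this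
  have hg0 : g ≠ 0 := by rintro rfl; simp at hgh; exact hF0 hgh
  have hh0 : h ≠ 0 := by rintro rfl; simp at hgh; exact hF0 hgh
  have hpos : ∀ g : MvPolynomial (Fin m) (AlgebraicClosure (ZMod p)), g ≠ 0 → ¬ IsUnit g → 1 ≤ g.totalDegree := by
    intro g hg0 hg
    by_contra hlt
    apply hg
    have h1 := totalDegree_eq_zero_iff_eq_C.mp (show g.totalDegree = 0 by omega)
    rw [h1]
    apply IsUnit.map
    rw [isUnit_iff_ne_zero]
    intro h2; rw [h2, C_0] at h1; exact hg0 h1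
  have hdeg : g.totalDegree + h.totalDegree = d := by
    rw [← totalDegree_mul_of_isDomain hg0 hh0, ← hgh, hFd]
  have hg1 := hpos g hg0 hg
  have hh1 := hpos h hh0 hh
  have hmem : g.totalDegree ∈ Finset.Ico 1 d := by rw [Finset.mem_Ico]; omega
  exact (hNp _ hmem p hp g h le_rfl (by omega) hgh).trans (Finset.dvd_prod_of_mem _ hmem)

theorem wl_badness_eq {m d : ℕ} (f : MvPolynomial (Fin m) ℤ) (hf : f.IsHomogeneous d)
    (hprim : Finset.gcd f.support f.coeff = 1)
    (hirr : Irreducible (map (Int.castRingHom (AlgebraicClosure ℚ)) f)) :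
    ∃ S : Finset ℕ, badness f = Real.exp (∑ p ∈ S, Real.log p / p) ∧
      ∀ (p : ℕ) (_ : Fact p.Prime), 27 * d ^ 4 < p → p ∉ S →
        Irreducible (map (Int.castRingHom (AlgebraicClosure (ZMod p))) f) := by
  obtain ⟨N, hN, hNp⟩ := wl_bad_finite f hf hprim hirr
  have hf0 : f ≠ 0 := by rintro rfl; simp at hirr
  have hfd : f.totalDegree = d := hf.totalDegree hf0
  set T := {p : ℕ | ∃ hp : Nat.Prime p,
        27 * f.totalDegree ^ 4 < p ∧
        ¬ Irreducible (letI : Fact (Nat.Prime p) := ⟨hp⟩;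
          MvPolynomial.map (Int.castRingHom (AlgebraicClosure (ZMod p))) f)} with hT
  have hfin : T.Finite := by
    apply (Set.finite_le_nat N.natAbs).subset
    rintro p ⟨hp, _, hpn⟩
    have := hNp p ⟨hp⟩ hpn
    have h2 := Int.natAbs_dvd_natAbs.mpr this
    simp only [Int.natAbs_natCast] at h2
    exact Nat.le_of_dvd (Int.natAbs_pos.mpr hN) h2
  refine ⟨hfin.toFinset, ?_, ?_⟩
  · rw [badness, if_pos hirr, Real.exp_sum, finprod_mem_eq_finite_toFinset_prod _ hfin]
  · intro p hp hpd hpS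
    by_contra hcon
    apply hpS
    rw [Set.Finite.mem_toFinset]
    exact ⟨hp.out, by rw [hfd]; exact hpd, hcon⟩


/-- Primes up to `N`. -/
def wlPr (N : ℕ) : Finset ℕ := (Finset.Ioc 0 N).filter Nat.Prime

theorem wl_mem_Pr {N p : ℕ} : p ∈ wlPr N ↔ p ≤ N ∧ p.Prime := by
  simp only [wlPr, Finset.mem_filter, Finset.mem_Ioc]
  constructor
  · rintro ⟨⟨_, h⟩, h2⟩; exact ⟨h, h2⟩
  · rintro ⟨h, h2⟩; exact ⟨⟨h2.pos, h⟩, h2⟩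

theorem wl_theta_le (N : ℕ) : ∑ p ∈ wlPr N, Real.log p ≤ Real.log 4 * N := by
  have h := Chebyshev.theta_le_log4_mul_x (x := (N : ℝ)) (Nat.cast_nonneg N)
  have h2 : Chebyshev.theta (N : ℝ) = ∑ p ∈ wlPr N, Real.log p := by
    unfold Chebyshev.theta wlPr
    rw [Nat.floor_natCast]
  rwa [h2] at h

theorem wlPr_succ (Y : ℕ) (F : ℕ → ℝ) :
    ∑ p ∈ wlPr (Y + 1), F p = ∑ p ∈ wlPr Y, F p + (if (Y + 1).Prime then F (Y + 1) else 0) := by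
  have : Finset.Ioc 0 (Y + 1) = insert (Y + 1) (Finset.Ioc 0 Y) := by
    ext k; simp only [Finset.mem_Ioc, Finset.mem_insert]; omega
  rw [wlPr, wlPr, this, Finset.filter_insert]
  split_ifs with h
  · rw [Finset.sum_insert (by simp)]; ring
  · simp

theorem wl_sqrt_step (Y : ℕ) (hY : 1 ≤ Y) :
    1 / (((Y + 1 : ℕ) : ℝ) * √((Y + 1 : ℕ) : ℝ)) ≤ 2 / √(Y : ℝ) - 2 / √((Y + 1 : ℕ) : ℝ) := by
  have hy : (1 : ℝ) ≤ Y := by exact_mod_cast hY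
  set a := √(Y : ℝ) with ha
  set b := √((Y + 1 : ℕ) : ℝ) with hb
  have ha2 : a ^ 2 = Y := Real.sq_sqrt (by positivity)
  have hb2 : b ^ 2 = ((Y + 1 : ℕ) : ℝ) := Real.sq_sqrt (by positivity)
  have ha0 : 0 < a := Real.sqrt_pos.mpr (by linarith)
  have hb0 : 0 < b := Real.sqrt_pos.mpr (by positivity)
  have hab : a ≤ b := Real.sqrt_le_sqrt (by push_cast; linarith)
  have hd : b ^ 2 - a ^ 2 = 1 := by rw [ha2, hb2]; push_cast; ring
  rw [← hb2]
  have h1 : 2 / a - 2 / b = 2 / (a * b * (a + b)) := by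
    have : a + b ≠ 0 := by positivity
    field_simp
    nlinarith
  rw [h1, div_le_div_iff₀ (by positivity) (by positivity)]
  have h2 : a * b * (a + b) ≤ b * b * (b + b) := by gcongr
  nlinarith

theorem wl_M3_aux (N : ℕ) (hN : 1 ≤ N) (k : ℕ) :
    ∑ p ∈ (wlPr (N + k)).filter (fun p => N < p), Real.log p / (p * √(p : ℝ)) +
      (Real.log 4 * (N + k : ℕ) - ∑ p ∈ wlPr (N + k), Real.log p) / ((N + k : ℕ) * √((N + k : ℕ) : ℝ))
      ≤ Real.log 4 * (3 / √(N : ℝ) - 2 / √((N + k : ℕ) : ℝ)) := by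
  have hl4 : 0 ≤ Real.log 4 := Real.log_nonneg (by norm_num)
  induction k with
  | zero =>
    simp only [add_zero]
    have h1 : (wlPr N).filter (fun p => N < p) = ∅ := by
      ext p; simp only [Finset.mem_filter, wl_mem_Pr, Finset.notMem_empty, iff_false]; omega
    rw [h1, Finset.sum_empty, zero_add]
    have hn : (1 : ℝ) ≤ N := by exact_mod_cast hN
    have hs : 0 < √(N : ℝ) := Real.sqrt_pos.mpr (by linarith)
    have h2 : 0 ≤ ∑ p ∈ wlPr N, Real.log p := Finset.sum_nonneg fun p _ => Real.log_natCast_nonneg p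
    calc _ ≤ (Real.log 4 * N) / (N * √(N : ℝ)) := by gcongr; linarith
      _ = _ := by field_simp; ring
  | succ k ih =>
    set Y := N + k with hY
    have hY1 : 1 ≤ Y := by omega
    have hyr : (1 : ℝ) ≤ Y := by exact_mod_cast hY1
    have hstep := wl_sqrt_step Y hY1
    have e1 : N + (k + 1) = Y + 1 := by omega
    rw [e1]
    rw [Finset.sum_filter] at ih ⊢
    rw [wlPr_succ, wlPr_succ Y (fun p => Real.log p)]
    rw [if_pos (show N < Y + 1 by omega)]
    have hth := wl_theta_le Y
    set T := ∑ p ∈ wlPr Y, Real.log p with hT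
    set S := ∑ p ∈ wlPr Y, (if N < p then Real.log p / (p * √(p : ℝ)) else 0) with hS
    set L := (if (Y + 1).Prime then Real.log ((Y + 1 : ℕ) : ℝ) else 0) with hL
    have hLe : (if (Y + 1).Prime then Real.log ((Y + 1 : ℕ) : ℝ) / (((Y + 1 : ℕ) : ℝ) * √((Y + 1 : ℕ) : ℝ)) else 0)
        = L / (((Y + 1 : ℕ) : ℝ) * √((Y + 1 : ℕ) : ℝ)) := by
      rw [hL]; split_ifs <;> simp
    rw [hLe]
    set g' := ((Y + 1 : ℕ) : ℝ) * √((Y + 1 : ℕ) : ℝ) with hg'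
    set g := (Y : ℝ) * √(Y : ℝ) with hg
    have hgpos : 0 < g := by positivity
    have hgg : g ≤ g' := by
      rw [hg, hg']
      have : (Y : ℝ) ≤ ((Y + 1 : ℕ) : ℝ) := by push_cast; linarith
      gcongr
    have hg'pos : 0 < g' := by linarith
    have h3 : L / g' + (Real.log 4 * ((Y + 1 : ℕ) : ℝ) - (T + L)) / g' = Real.log 4 * (1 / g') + (Real.log 4 * Y - T) / g' := by
      push_cast; field_simp; ring
    have h4 : (Real.log 4 * Y - T) / g' ≤ (Real.log 4 * Y - T) / g := by
      apply div_le_div_of_nonneg_left _ hgpos hgg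
      linarith
    have h5 := mul_le_mul_of_nonneg_left hstep hl4
    have h6 : S + L / g' + (Real.log 4 * ((Y + 1 : ℕ) : ℝ) - (T + L)) / g' = S + (Real.log 4 * (1 / g') + (Real.log 4 * Y - T) / g') := by
      rw [← h3]; ring
    rw [h6]
    rw [mul_sub] at ih h5 ⊢
    linarith

theorem wl_M3 (N Y : ℕ) (hN : 1 ≤ N) :
    ∑ p ∈ (wlPr Y).filter (fun p => N < p), Real.log p / (p * √(p : ℝ)) ≤ 3 * Real.log 4 / √(N : ℝ) := by
  have hl4 : 0 ≤ Real.log 4 := Real.log_nonneg (by norm_num)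
  rcases le_or_gt N Y with h | h
  · obtain ⟨k, rfl⟩ := Nat.exists_eq_add_of_le h
    have h1 := wl_M3_aux N hN k
    have h2 : 0 ≤ (Real.log 4 * (N + k : ℕ) - ∑ p ∈ wlPr (N + k), Real.log p) / ((N + k : ℕ) * √((N + k : ℕ) : ℝ)) :=
      div_nonneg (by linarith [wl_theta_le (N + k)]) (by positivity)
    have h3 : 0 ≤ Real.log 4 * (2 / √((N + k : ℕ) : ℝ)) := by positivity
    have h4 : Real.log 4 * (3 / √(N : ℝ) - 2 / √((N + k : ℕ) : ℝ)) = 3 * Real.log 4 / √(N : ℝ) - Real.log 4 * (2 / √((N + k : ℕ) : ℝ)) := by ring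
    linarith
  · have h1 : (wlPr Y).filter (fun p => N < p) = ∅ := by
      ext p; simp only [Finset.mem_filter, wl_mem_Pr, Finset.notMem_empty, iff_false]; omega
    rw [h1, Finset.sum_empty]
    positivity

theorem wl_log_factorial (N : ℕ) :
    Real.log N.factorial = ∑ p ∈ wlPr N, (padicValNat p N.factorial : ℝ) * Real.log p := by
  have h := Nat.prod_factorization_pow_eq_self (Nat.factorial_ne_zero N)
  conv_lhs => rw [← h]
  rw [Finsupp.prod, Nat.cast_prod, Real.log_prod]
  · have hsub : N.factorial.factorization.support ⊆ wlPr N := by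
      intro p hp
      rw [Nat.support_factorization, Nat.mem_primeFactors] at hp
      rw [wl_mem_Pr]
      exact ⟨(Nat.Prime.dvd_factorial hp.1).mp hp.2.1, hp.1⟩
    rw [← Finset.sum_subset hsub]
    · apply Finset.sum_congr rfl
      intro p hp
      rw [Nat.support_factorization, Nat.mem_primeFactors] at hp
      rw [Nat.cast_pow, Real.log_pow, Nat.factorization_def _ hp.1]
    · intro p hp hn
      rw [wl_mem_Pr] at hp
      rw [Finsupp.notMem_support_iff, Nat.factorization_def _ hp.2] at hn
      rw [hn]; simp
  · intro p hp
    rw [Nat.support_factorization, Nat.mem_primeFactors] at hp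
    have := hp.1.pos
    positivity

theorem wl_val_le (N p : ℕ) (hp : p.Prime) :
    (padicValNat p N.factorial : ℝ) ≤ N / ((p : ℝ) - 1) := by
  haveI : Fact p.Prime := ⟨hp⟩
  have h := sub_one_mul_padicValNat_factorial (p := p) N
  have hp2 := hp.two_le
  have hpr : (2 : ℝ) ≤ p := by exact_mod_cast hp2
  rw [le_div_iff₀ (by linarith)]
  have h2 : (p - 1) * padicValNat p N.factorial ≤ N := by omega
  have h3 : (((p - 1) * padicValNat p N.factorial : ℕ) : ℝ) ≤ N := by exact_mod_cast h2
  push_cast [Nat.cast_sub hp.one_le] at h3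
  linarith

theorem wl_val_ge (N p : ℕ) (hp : p.Prime) :
    (N : ℝ) / p - 1 ≤ (padicValNat p N.factorial : ℝ) := by
  haveI : Fact p.Prime := ⟨hp⟩
  have h1 : N / p ≤ padicValNat p N.factorial := by
    have : p ^ (N / p) ∣ N.factorial := by
      have h2 : (p * (N / p)).factorial ∣ N.factorial := Nat.factorial_dvd_factorial (Nat.mul_div_le N p)
      refine dvd_trans ?_ h2
      have := padicValNat_factorial_mul (p := p) (N / p)
      rw [padicValNat_dvd_iff_le (Nat.factorial_ne_zero _), this]
      omega
    exact (padicValNat_dvd_iff_le (Nat.factorial_ne_zero _)).mp this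
  have h2 : (N : ℝ) / p ≤ ((N / p : ℕ) : ℝ) + 1 := by
    have := Nat.lt_floor_add_one ((N : ℝ) / p)
    rw [Nat.floor_div_eq_div] at this
    exact this.le
  have h3 : ((N / p : ℕ) : ℝ) ≤ padicValNat p N.factorial := by exact_mod_cast h1
  linarith

theorem wl_M2 (N : ℕ) (hN : 1 ≤ N) :
    ∑ p ∈ wlPr N, Real.log p / p ≤ Real.log N + Real.log 4 := by
  have hn : (1 : ℝ) ≤ N := by exact_mod_cast hN
  have h1 : ∑ p ∈ wlPr N, ((N : ℝ) / p - 1) * Real.log p ≤ Real.log N.factorial := by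
    rw [wl_log_factorial]
    apply Finset.sum_le_sum
    intro p hp
    exact mul_le_mul_of_nonneg_right (wl_val_ge N p (wl_mem_Pr.mp hp).2) (Real.log_natCast_nonneg p)
  have h2 : Real.log N.factorial ≤ N * Real.log N := by
    rw [← Real.log_pow]
    apply Real.log_le_log (by positivity)
    exact_mod_cast Nat.factorial_le_pow N
  have h3 : ∑ p ∈ wlPr N, ((N : ℝ) / p - 1) * Real.log p = N * ∑ p ∈ wlPr N, Real.log p / p - ∑ p ∈ wlPr N, Real.log p := by
    rw [Finset.mul_sum, ← Finset.sum_sub_distrib]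
    apply Finset.sum_congr rfl
    intro p _; ring
  have h4 := wl_theta_le N
  have h5 : N * ∑ p ∈ wlPr N, Real.log p / p ≤ N * (Real.log N + Real.log 4) := by linarith
  exact le_of_mul_le_mul_left h5 (by linarith)

theorem wl_M1 : ∃ C : ℝ, 0 ≤ C ∧ ∀ N : ℕ, 1 ≤ N → Real.log N - C ≤ ∑ p ∈ wlPr N, Real.log p / p := by
  have hsum : Summable (fun n : ℕ => 1 / (n : ℝ) ^ (3 / 2 : ℝ)) := Real.summable_one_div_nat_rpow.mpr (by norm_num)
  refine ⟨1 + 4 * ∑' n : ℕ, 1 / (n : ℝ) ^ (3 / 2 : ℝ), ?_, ?_⟩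
  · have : 0 ≤ ∑' n : ℕ, 1 / (n : ℝ) ^ (3 / 2 : ℝ) := tsum_nonneg fun n => by positivity
    linarith
  intro N hN
  have hn : (1 : ℝ) ≤ N := by exact_mod_cast hN
  have h1 : Real.log N.factorial ≤ ∑ p ∈ wlPr N, (N / ((p : ℝ) - 1)) * Real.log p := by
    rw [wl_log_factorial]
    apply Finset.sum_le_sum
    intro p hp
    exact mul_le_mul_of_nonneg_right (wl_val_le N p (wl_mem_Pr.mp hp).2) (Real.log_natCast_nonneg p)
  have h2 : N * Real.log N - N ≤ Real.log N.factorial := by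
    have := Stirling.le_log_factorial_stirling (n := N) (by omega)
    have hl : 0 ≤ Real.log N := Real.log_nonneg hn
    have hpi : 0 ≤ Real.log (2 * Real.pi) := Real.log_nonneg (by linarith [Real.pi_gt_three])
    linarith
  have h3 : ∑ p ∈ wlPr N, (N / ((p : ℝ) - 1)) * Real.log p ≤
      N * (∑ p ∈ wlPr N, Real.log p / p + 4 * ∑ p ∈ wlPr N, 1 / (p : ℝ) ^ (3 / 2 : ℝ)) := by
    rw [Finset.mul_sum, ← Finset.sum_add_distrib, Finset.mul_sum]
    apply Finset.sum_le_sum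
    intro p hp
    have hp2 : (2 : ℝ) ≤ p := by exact_mod_cast (wl_mem_Pr.mp hp).2.two_le
    have hp0 : (0 : ℝ) < p := by linarith
    rw [div_mul_eq_mul_div, mul_div_assoc]
    apply mul_le_mul_of_nonneg_left _ (by linarith)
    have hlog : Real.log p ≤ 2 * √(p : ℝ) := by
      have h := Real.log_le_sub_one_of_pos (Real.sqrt_pos.mpr hp0)
      rw [Real.log_sqrt hp0.le] at h
      linarith
    have hpow : (p : ℝ) ^ (3 / 2 : ℝ) = p * √(p : ℝ) := by
      rw [Real.sqrt_eq_rpow, ← Real.rpow_one_add' hp0.le (by norm_num)]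
      norm_num
    rw [hpow]
    have hs2 : √(p : ℝ) ^ 2 = p := Real.sq_sqrt hp0.le
    have hs0 : 0 < √(p : ℝ) := Real.sqrt_pos.mpr hp0
    have hA : Real.log p / (p - 1) = Real.log p / p + Real.log p / (p * (p - 1)) := by
      have : (p : ℝ) - 1 ≠ 0 := by linarith
      field_simp; ring
    rw [hA]
    have hB : Real.log p / (p * (p - 1)) ≤ 4 * (1 / (p * √(p : ℝ))) := by
      calc Real.log p / (p * (p - 1)) ≤ 2 * √(p : ℝ) / (p * (p / 2)) := by
            apply div_le_div₀ (by positivity) hlog (by positivity)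
            apply mul_le_mul_of_nonneg_left _ hp0.le
            linarith
        _ = 4 * (1 / (p * √(p : ℝ))) := by
            field_simp
            rw [hs2]; ring
    linarith
  have h4 : ∑ p ∈ wlPr N, 1 / (p : ℝ) ^ (3 / 2 : ℝ) ≤ ∑' n : ℕ, 1 / (n : ℝ) ^ (3 / 2 : ℝ) :=
    hsum.sum_le_tsum _ (fun n _ => by positivity)
  have h5 : N * (Real.log N - 1) ≤ N * (∑ p ∈ wlPr N, Real.log p / p + 4 * ∑ p ∈ wlPr N, 1 / (p : ℝ) ^ (3 / 2 : ℝ)) := by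
    linarith
  have h6 := le_of_mul_le_mul_left h5 (by linarith)
  linarith


theorem wl_local_exp (p : ℕ) [Fact p.Prime] {n d s D : ℕ} (hn : 1 ≤ n)
    (f : MvPolynomial (Fin (n + 2)) ℤ)
    (hf : f.IsHomogeneous d)
    (hirr : Irreducible (map (Int.castRingHom (AlgebraicClosure (ZMod p))) f))
    (hp : 27 * d ^ 4 < p)
    (h : Fin s → MvPolynomial (Fin (n + 2)) ℤ) (hh : ∀ j, (h j).IsHomogeneous D)
    (ξ : Fin s → Fin (n + 2) → ℤ) (hξ : ∀ i, eval (ξ i) f = 0)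
    (hprim : ∀ i, Finset.univ.gcd (ξ i) = 1) (Z : ℝ) (hZ0 : 0 ≤ Z)
    (hZ : Z ^ n = (n.factorial : ℝ) * s) :
    ∃ e : ℕ, (p : ℤ) ^ e ∣ (Matrix.of fun i j => eval (ξ i) (h j)).det ∧
      (s : ℝ) * ((n : ℝ) / (n + 1) * (Z / p) * (1 - 40 * d ^ 2 / √(p : ℝ)) - (n + 1)) ≤ e := by
  have hpp : p.Prime := Fact.out
  have hp0 : (0 : ℝ) < p := by exact_mod_cast hpp.pos
  have hprim' : ∀ i, ∃ k, ¬ (p : ℤ) ∣ ξ i k := by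
    intro i
    by_contra hcon
    push Not at hcon
    have : (p : ℤ) ∣ 1 := by
      rw [← hprim i]
      exact Finset.dvd_gcd fun b _ => hcon b
    have h2 := Int.natAbs_dvd_natAbs.mpr this
    simp at h2
    exact hpp.one_lt.ne' h2
  have hW := wl_W_bound p f hf hirr (by omega)
  set ε : ℝ := 40 * d ^ 2 / √(p : ℝ) with hε
  have hε0 : 0 ≤ ε := by positivity
  set W' : ℝ := (p : ℝ) ^ n * (1 + ε) with hW'
  have hW'0 : 0 < W' := by positivity
  set X : ℝ := ((n.factorial : ℝ) * s / W') ^ ((1 : ℝ) / n) with hX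
  have hn0 : (n : ℝ) ≠ 0 := by exact_mod_cast (by omega : n ≠ 0)
  have hX0 : 0 ≤ X := by positivity
  have hXn : X ^ n = (n.factorial : ℝ) * s / W' := by
    rw [hX, ← Real.rpow_natCast, ← Real.rpow_mul (by positivity), one_div, inv_mul_cancel₀ hn0, Real.rpow_one]
  have hXZ : Z / p * (1 - ε) ≤ X := by
    rcases le_or_gt (1 - ε) 0 with h1 | h1
    · exact le_trans (mul_nonpos_of_nonneg_of_nonpos (by positivity) h1) hX0
    · rw [← pow_le_pow_iff_left₀ (by positivity) hX0 (show n ≠ 0 by omega), hXn, mul_pow, div_pow, hZ, hW']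
      have h2 : (1 - ε) ^ n ≤ 1 - ε := by
        calc (1 - ε) ^ n ≤ (1 - ε) ^ 1 := pow_le_pow_of_le_one h1.le (by linarith) hn
          _ = 1 - ε := pow_one _
      rw [div_mul_eq_mul_div, div_le_div_iff₀ (by positivity) (by positivity)]
      have h3 : (1 - ε) ^ n * (1 + ε) ≤ 1 := by nlinarith
      have h4 : 0 ≤ (n.factorial : ℝ) * s * p ^ n := by positivity
      nlinarith
  have hmain : ∃ e : ℕ, (p : ℤ) ^ e ∣ (Matrix.of fun i j => eval (ξ i) (h j)).det ∧
      (s : ℝ) * ((n : ℝ) / (n + 1) * X - (n + 1)) ≤ e := by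
    rcases lt_or_ge ⌊X⌋₊ n with hlt | hge
    · refine ⟨0, by simp, ?_⟩
      have h1 : X < n := (Nat.floor_lt hX0).mp hlt
      have h2 : (n : ℝ) / (n + 1) * X ≤ 1 * X := by
        apply mul_le_mul_of_nonneg_right _ hX0
        rw [div_le_one (by positivity)]; linarith
      simp only [Nat.cast_zero]
      apply mul_nonpos_of_nonneg_of_nonpos (by positivity)
      linarith
    · obtain ⟨K, hK⟩ := Nat.exists_eq_add_of_le hge
      obtain ⟨e, he, hdvd⟩ := wl_local p f hf hirr.ne_zero h hh ξ hξ hprim' K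
      refine ⟨e, hdvd, ?_⟩
      have hKX : ((n + K : ℕ) : ℝ) ≤ X := by rw [← hK]; exact Nat.floor_le hX0
      have hKX2 : X ≤ ((n + K : ℕ) : ℝ) + 1 := by rw [← hK]; exact (Nat.lt_floor_add_one X).le
      have hch : (((n + K).choose (n + 1) : ℕ) : ℝ) ≤ X ^ (n + 1) / ((n + 1).factorial : ℝ) := by
        refine (Nat.choose_le_pow_div (α := ℝ) (n + 1) (n + K)).trans ?_
        gcongr
      have hWc : (wlW p f : ℝ) * ((n + K).choose (n + 1) : ℕ) ≤ s * X / (n + 1) := by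
        calc (wlW p f : ℝ) * ((n + K).choose (n + 1) : ℕ) ≤ W' * (X ^ (n + 1) / ((n + 1).factorial : ℝ)) := by
              apply mul_le_mul hW hch (by positivity) hW'0.le
          _ = s * X / (n + 1) := by
              rw [pow_succ, hXn, Nat.factorial_succ]
              push_cast
              have : (n.factorial : ℝ) ≠ 0 := by positivity
              field_simp
      have he' : (K : ℝ) * s ≤ e + (wlW p f : ℝ) * ((n + K).choose (n + 1) : ℕ) := by exact_mod_cast he
      push_cast at hKX2
      have h5 : (s : ℝ) * (X - 1 - n) ≤ K * s := by
        rw [mul_comm]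
        apply mul_le_mul_of_nonneg_right _ (by positivity)
        linarith
      have h6 : (s : ℝ) * ((n : ℝ) / (n + 1) * X - (n + 1)) = s * (X - 1 - n) - s * X / (n + 1) := by
        have : (n : ℝ) + 1 ≠ 0 := by positivity
        field_simp; ring
      linarith
  obtain ⟨e, he, he2⟩ := hmain
  refine ⟨e, he, le_trans ?_ he2⟩
  have h7 : (n : ℝ) / (n + 1) * (Z / p) * (1 - ε) ≤ (n : ℝ) / (n + 1) * X := by
    rw [mul_assoc]
    exact mul_le_mul_of_nonneg_left hXZ (by positivity)
  gcongr

theorem wl_sum_dvd (P : Finset ℕ) (hP : ∀ p ∈ P, p.Prime) (lam : ℤ) (hl : lam ≠ 0) (e : ℕ → ℕ)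
    (he : ∀ p ∈ P, (p : ℤ) ^ e p ∣ lam) :
    ∑ p ∈ P, (e p : ℝ) * Real.log p ≤ Real.log |(lam : ℝ)| := by
  have h1 : ∏ p ∈ P, p ^ e p ∣ lam.natAbs := by
    apply Finset.prod_dvd_of_isRelPrime
    · intro p hp q hq hpq
      apply Nat.coprime_iff_isRelPrime.mp
      exact Nat.Coprime.pow _ _ ((Nat.coprime_primes (hP p hp) (hP q hq)).mpr hpq)
    · intro p hp
      have := Int.natAbs_dvd_natAbs.mpr (he p hp)
      rwa [Int.natAbs_pow, Int.natAbs_natCast] at this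
  have h2 := Nat.le_of_dvd (Int.natAbs_pos.mpr hl) h1
  have h3 : |(lam : ℝ)| = (lam.natAbs : ℝ) := by rw [Nat.cast_natAbs, Int.cast_abs]
  rw [h3]
  have h4 : ∑ p ∈ P, (e p : ℝ) * Real.log p = Real.log ((∏ p ∈ P, p ^ e p : ℕ) : ℝ) := by
    rw [Nat.cast_prod, Real.log_prod]
    · apply Finset.sum_congr rfl
      intro p _
      rw [Nat.cast_pow, Real.log_pow]
    · intro p hp
      have := (hP p hp).pos
      positivity
  rw [h4]
  apply Real.log_le_log
  · have : 0 < ∏ p ∈ P, p ^ e p := Finset.prod_pos fun p hp => pow_pos (hP p hp).pos _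
    exact_mod_cast this
  · exact_mod_cast h2

theorem wl_lower (n : ℕ) (hn : 1 ≤ n) : ∃ C : ℝ, 0 ≤ C ∧
    ∀ {d s D : ℕ} (f : MvPolynomial (Fin (n + 2)) ℤ) (_ : f.IsHomogeneous d) (_ : 1 ≤ d)
    (S : Finset ℕ) (_ : ∀ (p : ℕ) (_ : Fact p.Prime), 27 * d ^ 4 < p → p ∉ S →
        Irreducible (map (Int.castRingHom (AlgebraicClosure (ZMod p))) f))
    (h : Fin s → MvPolynomial (Fin (n + 2)) ℤ) (_ : ∀ j, (h j).IsHomogeneous D)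
    (ξ : Fin s → Fin (n + 2) → ℤ) (_ : ∀ i, eval (ξ i) f = 0)
    (_ : ∀ i, Finset.univ.gcd (ξ i) = 1) (Z : ℝ) (_ : 1 ≤ Z)
    (_ : Z ^ n = (n.factorial : ℝ) * s) (_ : (Matrix.of fun i j => eval (ξ i) (h j)).det ≠ 0),
    (s : ℝ) * ((n : ℝ) / (n + 1)) * Z * (Real.log Z - 4 * Real.log d - ∑ p ∈ S, Real.log p / p - C)
      ≤ Real.log |((Matrix.of fun i j => eval (ξ i) (h j)).det : ℝ)| := by
  obtain ⟨C0, hC0, hM1⟩ := wl_M1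
  have hl4 : 0 ≤ Real.log 4 := Real.log_nonneg (by norm_num)
  have hl2 : 0 ≤ Real.log 2 := Real.log_nonneg (by norm_num)
  have hl27 : 0 ≤ Real.log 27 := Real.log_nonneg (by norm_num)
  refine ⟨Real.log 2 + C0 + Real.log 27 + Real.log 4 + 120 * Real.log 4 + (n + 1) ^ 2 * Real.log 4, by positivity, ?_⟩
  intro d s D f hf hd S hS h hh ξ hξ hprim Z hZ1 hZ hdet
  set lam := (Matrix.of fun i j => eval (ξ i) (h j)).det with hlam
  have hZ0 : 0 ≤ Z := by linarith
  set Y := ⌊Z⌋₊ with hY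
  have hY1 : 1 ≤ Y := by rw [hY]; exact Nat.one_le_floor_iff _ |>.mpr hZ1
  set P := (wlPr Y).filter (fun p => 27 * d ^ 4 < p ∧ p ∉ S) with hPdef
  have hPp : ∀ p ∈ P, p.Prime := fun p hp => (wl_mem_Pr.mp (Finset.mem_filter.mp hp).1).2
  have hex : ∀ p ∈ P, ∃ e : ℕ, (p : ℤ) ^ e ∣ lam ∧
      (s : ℝ) * ((n : ℝ) / (n + 1) * (Z / p) * (1 - 40 * d ^ 2 / √(p : ℝ)) - (n + 1)) ≤ e := by
    intro p hp
    haveI : Fact p.Prime := ⟨hPp p hp⟩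
    have hp2 := (Finset.mem_filter.mp hp).2
    exact wl_local_exp p hn f hf (hS p ⟨hPp p hp⟩ hp2.1 hp2.2) hp2.1 h hh ξ hξ hprim Z hZ0 hZ
  choose! e he he2 using hex
  have h1 := wl_sum_dvd P hPp lam hdet e he
  refine le_trans ?_ h1
  have h2 : ∑ p ∈ P, ((s : ℝ) * ((n : ℝ) / (n + 1) * (Z / p) * (1 - 40 * d ^ 2 / √(p : ℝ)) - (n + 1))) * Real.log p
      ≤ ∑ p ∈ P, (e p : ℝ) * Real.log p := by
    apply Finset.sum_le_sum
    intro p hp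
    exact mul_le_mul_of_nonneg_right (he2 p hp) (Real.log_natCast_nonneg p)
  refine le_trans ?_ h2
  have h3 : ∑ p ∈ P, ((s : ℝ) * ((n : ℝ) / (n + 1) * (Z / p) * (1 - 40 * d ^ 2 / √(p : ℝ)) - (n + 1))) * Real.log p
      = s * ((n : ℝ) / (n + 1) * Z * (∑ p ∈ P, Real.log p / p - 40 * d ^ 2 * ∑ p ∈ P, Real.log p / (p * √(p : ℝ)))
        - (n + 1) * ∑ p ∈ P, Real.log p) := by
    simp only [Finset.mul_sum, ← Finset.sum_sub_distrib]
    apply Finset.sum_congr rfl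
    intro p hp
    have hp0 : (0 : ℝ) < p := by exact_mod_cast (hPp p hp).pos
    have : 0 < √(p : ℝ) := Real.sqrt_pos.mpr hp0
    field_simp
  rw [h3]
  -- the three sums
  have hnn : ∀ p : ℕ, 0 ≤ Real.log p / p := fun p => div_nonneg (Real.log_natCast_nonneg p) (by positivity)
  have hA : ∑ p ∈ wlPr Y, Real.log p / p ≤ ∑ p ∈ P, Real.log p / p + (∑ p ∈ wlPr (27 * d ^ 4), Real.log p / p + ∑ p ∈ S, Real.log p / p) := by
    have hsub : wlPr Y ⊆ P ∪ (wlPr (27 * d ^ 4) ∪ S) := by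
      intro p hp
      simp only [Finset.mem_union, hPdef, Finset.mem_filter]
      by_cases h1 : p ∈ S
      · exact Or.inr (Or.inr h1)
      · by_cases h2 : 27 * d ^ 4 < p
        · exact Or.inl ⟨hp, h2, h1⟩
        · exact Or.inr (Or.inl (wl_mem_Pr.mpr ⟨by omega, (wl_mem_Pr.mp hp).2⟩))
    have hun : ∀ A B : Finset ℕ, ∑ p ∈ A ∪ B, Real.log p / p ≤ ∑ p ∈ A, Real.log p / p + ∑ p ∈ B, Real.log p / p := by
      intro A B
      rw [← Finset.sum_union_inter]
      have : 0 ≤ ∑ p ∈ A ∩ B, Real.log p / p := Finset.sum_nonneg fun p _ => hnn p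
      linarith
    have h1 := Finset.sum_le_sum_of_subset_of_nonneg hsub (f := fun p : ℕ => Real.log p / p) (fun p _ _ => hnn p)
    have h2 := hun P (wlPr (27 * d ^ 4) ∪ S)
    have h3 := hun (wlPr (27 * d ^ 4)) S
    linarith
  have hd1 : (1 : ℝ) ≤ d := by exact_mod_cast hd
  have hB : ∑ p ∈ wlPr (27 * d ^ 4), Real.log p / p ≤ Real.log 27 + 4 * Real.log d + Real.log 4 := by
    have := wl_M2 (27 * d ^ 4) (by have := Nat.one_le_pow 4 d hd; omega)
    push_cast at this
    rw [Real.log_mul (by norm_num) (by positivity), Real.log_pow] at this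
    push_cast at this
    linarith
  have hC : Real.log Z - Real.log 2 - C0 ≤ ∑ p ∈ wlPr Y, Real.log p / p := by
    have h1 := hM1 Y hY1
    have h2 : Real.log Z ≤ Real.log 2 + Real.log Y := by
      have hYr : (1 : ℝ) ≤ Y := by exact_mod_cast hY1
      rw [← Real.log_mul (by norm_num) (by positivity)]
      apply Real.log_le_log (by linarith)
      have := (Nat.lt_floor_add_one Z).le
      linarith
    linarith
  have hE : 40 * (d : ℝ) ^ 2 * ∑ p ∈ P, Real.log p / (p * √(p : ℝ)) ≤ 120 * Real.log 4 := by
    have h1 : ∑ p ∈ P, Real.log p / (p * √(p : ℝ)) ≤ ∑ p ∈ (wlPr Y).filter (fun p => 27 * d ^ 4 < p), Real.log p / (p * √(p : ℝ)) := by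
      apply Finset.sum_le_sum_of_subset_of_nonneg
      · intro p hp
        rw [hPdef, Finset.mem_filter] at hp
        rw [Finset.mem_filter]
        exact ⟨hp.1, hp.2.1⟩
      · intro p _ _
        exact div_nonneg (Real.log_natCast_nonneg p) (by positivity)
    have h2 := wl_M3 (27 * d ^ 4) Y (by have := Nat.one_le_pow 4 d hd; omega)
    have h3 : (d : ℝ) ^ 2 ≤ √((27 * d ^ 4 : ℕ) : ℝ) := by
      apply Real.le_sqrt_of_sq_le
      push_cast
      have : 0 ≤ (d : ℝ) ^ 4 := by positivity
      nlinarith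
    have h4 : 3 * Real.log 4 / √((27 * d ^ 4 : ℕ) : ℝ) ≤ 3 * Real.log 4 / (d : ℝ) ^ 2 := by
      gcongr
    calc 40 * (d : ℝ) ^ 2 * ∑ p ∈ P, Real.log p / (p * √(p : ℝ)) ≤ 40 * (d : ℝ) ^ 2 * (3 * Real.log 4 / (d : ℝ) ^ 2) := by
          gcongr; linarith
      _ = 120 * Real.log 4 := by field_simp; ring
  have hF : ∑ p ∈ P, Real.log p ≤ Real.log 4 * Z := by
    have h1 : ∑ p ∈ P, Real.log p ≤ ∑ p ∈ wlPr Y, Real.log p :=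
      Finset.sum_le_sum_of_subset_of_nonneg (Finset.filter_subset _ _) (fun p _ _ => Real.log_natCast_nonneg p)
    have h2 := wl_theta_le Y
    have h3 : (Y : ℝ) ≤ Z := Nat.floor_le hZ0
    have := mul_le_mul_of_nonneg_left h3 hl4
    linarith
  have hn1 : (1 : ℝ) ≤ n := by exact_mod_cast hn
  rw [mul_assoc, mul_assoc]
  apply mul_le_mul_of_nonneg_left _ (by positivity)
  have hG : (n + 1 : ℝ) * ∑ p ∈ P, Real.log p ≤ (n : ℝ) / (n + 1) * Z * ((n + 1) ^ 2 * Real.log 4) := by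
    calc (n + 1 : ℝ) * ∑ p ∈ P, Real.log p ≤ (n + 1 : ℝ) * (Real.log 4 * Z) := by gcongr
      _ = 1 * ((n + 1 : ℝ) * Real.log 4 * Z) := by ring
      _ ≤ n * ((n + 1 : ℝ) * Real.log 4 * Z) := by gcongr
      _ = (n : ℝ) / (n + 1) * Z * ((n + 1) ^ 2 * Real.log 4) := by field_simp
  have hH : (n : ℝ) / (n + 1) * Z * (Real.log Z - 4 * Real.log d - ∑ p ∈ S, Real.log p / p - (Real.log 2 + C0 + Real.log 27 + Real.log 4 + 120 * Real.log 4))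
      ≤ (n : ℝ) / (n + 1) * Z * (∑ p ∈ P, Real.log p / p - 40 * d ^ 2 * ∑ p ∈ P, Real.log p / (p * √(p : ℝ))) := by
    apply mul_le_mul_of_nonneg_left _ (by positivity)
    linarith
  linarith


theorem wl_comb (n E : ℕ) : ∀ d s : ℕ, s + (n + 1 + E).choose (n + 1) = (n + 1 + (E + d)).choose (n + 1) →
    d * E ^ n ≤ n.factorial * s ∧ n.factorial * s ≤ d * (E + d + n) ^ n := by
  intro d
  induction d with
  | zero =>
    intro s hs
    have : s = 0 := by simpa using hs
    subst this
    simp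
  | succ d ih =>
    intro s hs
    have h1 : (n + 1 + (E + (d + 1))).choose (n + 1) = (n + 1 + (E + d)).choose n + (n + 1 + (E + d)).choose (n + 1) := by
      rw [show n + 1 + (E + (d + 1)) = (n + 1 + (E + d)) + 1 by ring, Nat.choose_succ_succ]
    have hmono : (n + 1 + E).choose (n + 1) ≤ (n + 1 + (E + d)).choose (n + 1) :=
      Nat.choose_le_choose _ (by omega)
    obtain ⟨t, ht⟩ := Nat.exists_eq_add_of_le hmono
    obtain ⟨h2, h3⟩ := ih t (by omega)
    have hst : s = t + (n + 1 + (E + d)).choose n := by omega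
    have hdf : n.factorial * (n + 1 + (E + d)).choose n = (n + 1 + (E + d)).descFactorial n :=
      (Nat.descFactorial_eq_factorial_mul_choose _ _).symm
    have h4 : (n + 1 + (E + d)).descFactorial n ≤ (E + (d + 1) + n) ^ n :=
      (Nat.descFactorial_le_pow _ _).trans (Nat.pow_le_pow_left (by omega) _)
    have h5 : E ^ n ≤ (n + 1 + (E + d)).descFactorial n :=
      le_trans (Nat.pow_le_pow_left (by omega) _) (Nat.pow_sub_le_descFactorial _ _)
    have h6 : d * (E + d + n) ^ n ≤ d * (E + (d + 1) + n) ^ n :=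
      Nat.mul_le_mul_left _ (Nat.pow_le_pow_left (by omega) _)
    rw [hst, mul_add, hdf]
    constructor <;> linarith

theorem wl_comb2 (n E : ℕ) : E ^ (n + 1) ≤ (n + 1).factorial * (n + 1 + E).choose (n + 1) := by
  rw [← Nat.descFactorial_eq_factorial_mul_choose]
  exact le_trans (Nat.pow_le_pow_left (by omega) _) (Nat.pow_sub_le_descFactorial _ _)

set_option maxHeartbeats 1000000 in
/-- the pure real-number part of the second case -/
theorem wl_real (n : ℕ) (hn : 1 ≤ n) (d E D s r Z δ lB L A C : ℝ) (hd : 1 ≤ d) (hδ1 : 1 ≤ δ)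
    (hδ : δ ^ n = d) (hD : D = E + d) (hE : d ≤ E) (hs : 1 ≤ s) (hZ : 1 ≤ Z)
    (hZs : Z ^ n = (n.factorial : ℝ) * s) (h1 : d * E ^ n ≤ n.factorial * s)
    (h2 : n.factorial * s ≤ d * (D + n) ^ n) (h3 : E ^ (n + 1) ≤ (n + 1).factorial * r)
    (hlB : 0 ≤ lB) (hL : 0 ≤ L) (hC : 0 ≤ C) (hLC : L ≤ C * (d * (lB + 1)))
    (hDB : d * lB ≤ δ * D)
    (hmain : s * ((n : ℝ) / (n + 1)) * Z * (Real.log Z - A) ≤ s * Real.log s + D * s * (Real.log 2 + lB) - r * L) :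
    Real.log (δ * D / 2) ≤ A + ((n : ℝ) + 1) / n * (n + 4 + 2 * (n + 1) * C) + ((n : ℝ) + 1) / (n * δ) * lB
      - 1 / (n * (δ * d)) * L := by
  have hn1 : (1 : ℝ) ≤ n := by exact_mod_cast hn
  have hn0 : n ≠ 0 := by omega
  have hE0 : 0 < E := by linarith
  have hD0 : 0 < D := by linarith
  have hZ0 : 0 < Z := by linarith
  have hδ0 : 0 < δ := by linarith
  have hs0 : 0 < s := by linarith
  have hd0 : 0 < d := by linarith
  have hnf : (1 : ℝ) ≤ n.factorial := by exact_mod_cast Nat.factorial_pos n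
  have hZl : δ * E ≤ Z := by
    apply le_of_pow_le_pow_left₀ hn0 hZ0.le
    rw [mul_pow, hδ, hZs]; exact h1
  have hZu : Z ≤ δ * (D + n) := by
    apply le_of_pow_le_pow_left₀ hn0 (by positivity)
    rw [mul_pow, hδ, hZs]; exact h2
  -- log s
  have hls : Real.log s ≤ n * Z := by
    have h : s ≤ Z ^ n := by rw [hZs]; nlinarith
    have h' := Real.log_le_log hs0 h
    rw [Real.log_pow] at h'
    have h'' := Real.log_le_sub_one_of_pos hZ0
    nlinarith
  -- D / Z
  have hDZ : D / Z ≤ 1 / δ + 2 * d / (δ * D) := by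
    have e1 : 1 / δ + 2 * d / (δ * D) = (D + 2 * d) / (δ * D) := by field_simp
    rw [e1, div_le_div_iff₀ hZ0 (by positivity)]
    have : D * D ≤ (D + 2 * d) * E := by rw [hD]; nlinarith
    calc D * (δ * D) = δ * (D * D) := by ring
      _ ≤ δ * ((D + 2 * d) * E) := by gcongr
      _ = (D + 2 * d) * (δ * E) := by ring
      _ ≤ (D + 2 * d) * Z := by gcongr
  have hdD : 2 * d / (δ * D) ≤ 1 := by
    rw [div_le_one (by positivity)]
    nlinarith
  have hl2 : 0 ≤ Real.log 2 := Real.log_nonneg (by norm_num)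
  have hl2' : Real.log 2 ≤ 1 := by linarith [Real.log_two_lt_d9]
  have hδi : 1 / δ ≤ 1 := by rw [div_le_one hδ0]; exact hδ1
  have hT2 : D / Z * (Real.log 2 + lB) ≤ 4 + 1 / δ * lB := by
    have a1 : D / Z * (Real.log 2 + lB) ≤ (1 / δ + 2 * d / (δ * D)) * (Real.log 2 + lB) := by
      gcongr
    have a2 : 2 * d / (δ * D) * lB ≤ 2 := by
      rw [div_mul_eq_mul_div, div_le_iff₀ (by positivity)]
      linarith
    have a3 : (1 / δ + 2 * d / (δ * D)) * Real.log 2 ≤ 2 * 1 := by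
      gcongr; linarith
    nlinarith
  -- r
  have hr : 1 / ((n + 1) * (δ * d)) * (1 - (n + 1) * ((n + 1) * d / D)) ≤ r / (s * Z) := by
    have b1 : 1 - (n + 1) * ((n + 1) * d / D) ≤ (E / (D + n)) ^ (n + 1) := by
      have c1 : 1 - (n + 1) * d / D ≤ E / (D + n) := by
        rw [le_div_iff₀ (by positivity)]
        have : (1 - (n + 1) * d / D) * (D + n) = D + n - (n + 1) * d - (n + 1) * d * n / D := by
          field_simp
          ring
        rw [this]
        have q1 : 0 ≤ (n + 1) * d * n / D := by positivity
        have q2 : 0 ≤ (n : ℝ) * (d - 1) := mul_nonneg (by positivity) (by linarith)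
        linarith
      have c2 := one_add_mul_le_pow (a := E / (D + n) - 1) (by have : 0 ≤ E / (D + n) := by positivity
                                                               linarith) (n + 1)
      push_cast at c2
      rw [show 1 + (E / (D + n) - 1) = E / (D + n) by ring] at c2
      refine le_trans ?_ c2
      have c3 : ((n : ℝ) + 1) * (1 - (n + 1) * d / D) ≤ (n + 1) * (E / (D + n)) :=
        mul_le_mul_of_nonneg_left c1 (by positivity)
      linarith
    have b2 : 1 / ((n + 1) * (δ * d)) * (E / (D + n)) ^ (n + 1) ≤ r / (s * Z) := by
      rw [le_div_iff₀ (by positivity)]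
      have e1 : (n.factorial * s) * Z ≤ (δ * d) * (D + n) ^ (n + 1) := by
        calc (n.factorial * s) * Z ≤ (d * (D + n) ^ n) * (δ * (D + n)) := by gcongr
          _ = _ := by ring
      have e2 : E ^ (n + 1) ≤ (n + 1) * n.factorial * r := by
        rw [Nat.factorial_succ] at h3; push_cast at h3; exact h3
      rw [div_pow]
      have hq : 0 < (D + n) ^ (n + 1) := by positivity
      calc 1 / ((n + 1) * (δ * d)) * (E ^ (n + 1) / (D + n) ^ (n + 1)) * (s * Z)
          = E ^ (n + 1) * (n.factorial * s * Z) / ((n + 1) * n.factorial * (δ * d * (D + n) ^ (n + 1))) := by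
            field_simp
        _ ≤ E ^ (n + 1) * (δ * d * (D + n) ^ (n + 1)) / ((n + 1) * n.factorial * (δ * d * (D + n) ^ (n + 1))) := by
            gcongr
        _ = E ^ (n + 1) / ((n + 1) * n.factorial) := by field_simp
        _ ≤ r := by rw [div_le_iff₀ (by positivity)]; linarith
    refine le_trans ?_ b2
    gcongr
  have hT3 : 1 / ((n + 1) * (δ * d)) * L - 2 * (n + 1) * C ≤ r / (s * Z) * L := by
    have a1 := mul_le_mul_of_nonneg_right hr hL
    refine le_trans ?_ a1
    have e1 : 1 / ((n + 1) * (δ * d)) * (1 - (n + 1) * ((n + 1) * d / D)) * L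
        = 1 / ((n + 1) * (δ * d)) * L - (n + 1) * L / (δ * D) := by field_simp
    rw [e1]
    have : (n + 1) * L / (δ * D) ≤ 2 * (n + 1) * C := by
      rw [div_le_iff₀ (by positivity)]
      have k1 : d * (lB + 1) ≤ 2 * (δ * D) := by nlinarith
      calc (n + 1) * L ≤ (n + 1) * (C * (d * (lB + 1))) := by gcongr
        _ ≤ (n + 1) * (C * (2 * (δ * D))) := by gcongr
        _ = _ := by ring
    linarith
  have hlogZ : Real.log Z - A ≤ ((n : ℝ) + 1) / n * (Real.log s / Z + D / Z * (Real.log 2 + lB) - r / (s * Z) * L) := by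
    have e1 : ((n : ℝ) + 1) / n * (Real.log s / Z + D / Z * (Real.log 2 + lB) - r / (s * Z) * L)
        = (s * Real.log s + D * s * (Real.log 2 + lB) - r * L) / (s * ((n : ℝ) / (n + 1)) * Z) := by
      field_simp
    rw [e1, le_div_iff₀ (by positivity)]
    linarith
  have hlsZ : Real.log s / Z ≤ n := by rw [div_le_iff₀ hZ0]; exact hls
  have hfin : ((n : ℝ) + 1) / n * (Real.log s / Z + D / Z * (Real.log 2 + lB) - r / (s * Z) * L)
      ≤ ((n : ℝ) + 1) / n * (n + (4 + 1 / δ * lB) - (1 / ((n + 1) * (δ * d)) * L - 2 * (n + 1) * C)) := by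
    apply mul_le_mul_of_nonneg_left _ (by positivity)
    linarith
  have hfe : ((n : ℝ) + 1) / n * (n + (4 + 1 / δ * lB) - (1 / ((n + 1) * (δ * d)) * L - 2 * (n + 1) * C))
      = ((n : ℝ) + 1) / n * (n + 4 + 2 * (n + 1) * C) + ((n : ℝ) + 1) / (n * δ) * lB
      - 1 / (n * (δ * d)) * L := by
    field_simp
    ring
  have hfl : Real.log (δ * D / 2) ≤ Real.log Z := by
    apply Real.log_le_log (by positivity)
    refine le_trans ?_ hZl
    nlinarith
  linarith

/-- the pure real-number part of the first case -/
theorem wl_real1 (n : ℕ) (d s r lB L : ℝ) (hd : 1 ≤ d) (hs : 1 ≤ s)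
    (h2 : n.factorial * s ≤ d * (d + d + n) ^ n) (h3 : d ^ (n + 1) ≤ (n + 1).factorial * r)
    (hlB : 0 ≤ lB)
    (hmain : 0 ≤ s * Real.log s + 2 * d * s * (Real.log 2 + lB) - r * L) :
    L ≤ ((n + 2) ^ n * (n + 1) * ((n + 1) * (n + 2) + 2)) * (d * (lB + 1)) := by
  have hd0 : 0 < d := by linarith
  have hnf : (1 : ℝ) ≤ n.factorial := by exact_mod_cast Nat.factorial_pos n
  have hr0 : 0 < r := by
    have : 0 < (n + 1).factorial * r := lt_of_lt_of_le (by positivity) h3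
    exact pos_of_mul_pos_right this (by positivity)
  have hk : n.factorial * s ≤ (n + 2) ^ n * d ^ (n + 1) := by
    refine h2.trans ?_
    calc d * (d + d + n) ^ n ≤ d * ((n + 2) * d) ^ n := by
          gcongr
          nlinarith [(Nat.cast_nonneg n : (0:ℝ) ≤ n)]
      _ = _ := by rw [mul_pow]; ring
  have hsr : s ≤ (n + 2) ^ n * (n + 1) * r := by
    rw [Nat.factorial_succ] at h3; push_cast at h3
    have : n.factorial * s ≤ n.factorial * ((n + 2) ^ n * (n + 1) * r) := by
      calc n.factorial * s ≤ (n + 2) ^ n * d ^ (n + 1) := hk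
        _ ≤ (n + 2) ^ n * ((n + 1) * n.factorial * r) := by gcongr
        _ = _ := by ring
    exact le_of_mul_le_mul_left this (by positivity)
  have hls : Real.log s ≤ (n + 1) * (n + 2) * d := by
    have k1 : s ≤ ((n + 2) * d) ^ (n + 1) := by
      calc s ≤ n.factorial * s := by nlinarith
        _ ≤ (n + 2) ^ n * d ^ (n + 1) := hk
        _ ≤ (n + 2) ^ (n + 1) * d ^ (n + 1) := by
            gcongr
            · linarith [(Nat.cast_nonneg n : (0:ℝ) ≤ n)]
            · omega
        _ = _ := by rw [mul_pow]
    have k2 := Real.log_le_log (by linarith) k1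
    rw [Real.log_pow] at k2
    have k3 := Real.log_le_sub_one_of_pos (show 0 < ((n : ℝ) + 2) * d by positivity)
    push_cast at k2
    calc Real.log s ≤ (n + 1) * Real.log ((n + 2) * d) := k2
      _ ≤ (n + 1) * ((n + 2) * d) := by gcongr; linarith
      _ = _ := by ring
  have hl2' : Real.log 2 ≤ 1 := by linarith [Real.log_two_lt_d9]
  have hfin : r * L ≤ r * (((n + 2) ^ n * (n + 1) * ((n + 1) * (n + 2) + 2)) * (d * (lB + 1))) := by
    calc r * L ≤ s * (Real.log s + 2 * d * (Real.log 2 + lB)) := by linarith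
      _ ≤ s * ((n + 1) * (n + 2) * d * (lB + 1) + 2 * d * (1 + lB)) := by
          gcongr
          · refine hls.trans ?_
            have : 0 ≤ ((n : ℝ) + 1) * (n + 2) * d := by positivity
            nlinarith
      _ ≤ ((n + 2) ^ n * (n + 1) * r) * ((n + 1) * (n + 2) * d * (lB + 1) + 2 * d * (1 + lB)) := by
          gcongr
      _ = _ := by ring
  exact le_of_mul_le_mul_left hfin hr0


theorem wl_dich (n : ℕ) (hn : 1 ≤ n) : ∃ C : ℝ, 0 ≤ C ∧
    ∀ (d E : ℕ) (f : MvPolynomial (Fin (n + 2)) ℤ) (B : ℝ) (_ : 1 ≤ d) (_ : 1 ≤ E) (_ : f.IsHomogeneous d)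
    (_ : Finset.gcd f.support f.coeff = 1) (_ : f ≠ 0) (_ : 1 ≤ B)
    (S : Finset ℕ) (_ : ∀ (p : ℕ) (_ : Fact p.Prime), 27 * d ^ 4 < p → p ∉ S →
        Irreducible (map (Int.castRingHom (AlgebraicClosure (ZMod p))) f)),
    (∃ g : MvPolynomial (Fin (n + 2)) ℤ, g.IsHomogeneous (E + d) ∧ ¬ f ∣ g ∧
      ∀ v : Fin (n + 2) → ℤ, Finset.univ.gcd v = 1 →
            eval v f = 0 → (∀ i, |(v i : ℝ)| ≤ B) → eval v g = 0) ∨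
    ∃ s : ℕ, 1 ≤ s ∧ d * E ^ n ≤ n.factorial * s ∧ n.factorial * s ≤ d * (E + d + n) ^ n ∧
      0 ≤ (s : ℝ) * Real.log s + ((E : ℝ) + d) * s * (Real.log 2 + Real.log B)
        - ((n + 1 + E).choose (n + 1) : ℕ) * Real.log (normMax f) ∧
      ∀ Z : ℝ, 1 ≤ Z → Z ^ n = (n.factorial : ℝ) * s →
        (s : ℝ) * ((n : ℝ) / (n + 1)) * Z *
          (Real.log Z - (4 * Real.log d + ∑ p ∈ S, Real.log p / p + C)) ≤
        (s : ℝ) * Real.log s + ((E : ℝ) + d) * s * (Real.log 2 + Real.log B)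
        - ((n + 1 + E).choose (n + 1) : ℕ) * Real.log (normMax f) := by
  obtain ⟨C, hC, hlow⟩ := wl_lower n hn
  refine ⟨C, hC, ?_⟩
  intro d E f B hd hE hf hprim hf0 hB S hS
  by_cases hg : ∃ g : MvPolynomial (Fin (n + 2)) ℤ, g.IsHomogeneous (E + d) ∧ ¬ f ∣ g ∧
      ∀ v : Fin (n + 2) → ℤ, Finset.univ.gcd v = 1 →
            eval v f = 0 → (∀ i, |(v i : ℝ)| ≤ B) → eval v g = 0
  · exact Or.inl hg
  right
  have H : ∀ g : MvPolynomial (Fin (n + 2)) ℤ, g.IsHomogeneous (E + d) →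
      (∀ v : Fin (n + 2) → ℤ, Finset.univ.gcd v = 1 → eval v f = 0 → (∀ i, |(v i : ℝ)| ≤ B) → eval v g = 0) → f ∣ g := by
    intro g h1 h2
    by_contra h3
    exact hg ⟨g, h1, h3, h2⟩
  have hmono : (n + 1 + E).choose (n + 1) ≤ (n + 1 + (E + d)).choose (n + 1) :=
      Nat.choose_le_choose _ (by omega)
  obtain ⟨s, hs⟩ := Nat.exists_eq_add_of_le' hmono
  obtain ⟨c1, c2⟩ := wl_comb n E d s hs.symm
  have hs1 : 1 ≤ s := by
    have : 0 < d * E ^ n := by positivity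
    by_contra h
    have : s = 0 := by omega
    subst this
    omega
  obtain ⟨q, ξ, hq, hξ, hξf, hdet, hup⟩ := wl_global (n := n) (d := d) (D := E + d) (s := s) f hf hprim hf0 (by omega) B hB H
    (by rw [Nat.add_sub_cancel]; exact hs.symm)
  rw [Nat.add_sub_cancel] at hup
  have hN := wl_one_le_normMax f hf0
  set lam := (Matrix.of fun i j => eval (ξ i) (q j)).det with hlam
  have hlam1 : (1 : ℝ) ≤ |(lam : ℝ)| := by
    have := Int.one_le_abs hdet
    exact_mod_cast this
  have hsr : (1 : ℝ) ≤ s := by exact_mod_cast hs1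
  have hU : Real.log |(lam : ℝ)| ≤ (s : ℝ) * Real.log s + ((E : ℝ) + d) * s * (Real.log 2 + Real.log B)
        - ((n + 1 + E).choose (n + 1) : ℕ) * Real.log (normMax f) := by
    have h1 : |(lam : ℝ)| * normMax f ^ (n + 1 + E).choose (n + 1) ≤ (s : ℝ) ^ s * (2 * B) ^ ((E + d) * s) := by
      refine hup.trans ?_
      gcongr
      exact_mod_cast Nat.factorial_le_pow s
    have h2 := Real.log_le_log (by positivity) h1
    rw [Real.log_mul (by positivity) (by positivity), Real.log_mul (by positivity) (by positivity),
      Real.log_pow, Real.log_pow, Real.log_pow, Real.log_mul (by norm_num) (by positivity)] at h2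
    push_cast at h2 ⊢
    linarith
  refine ⟨s, hs1, c1, c2, (Real.log_nonneg hlam1).trans hU, ?_⟩
  intro Z hZ hZs
  have := hlow f hf hd S hS q hq ξ hξf hξ Z hZ hZs hdet
  refine le_trans ?_ (this.trans hU)
  apply le_of_eq
  ring

set_option maxHeartbeats 1000000 in
/-- the main theorem -/
theorem wl_main (n : ℕ) (hn : 1 ≤ n) :
    ∃ c : ℝ, 0 < c ∧
      ∀ (d : ℕ) (f : MvPolynomial (Fin (n + 2)) ℤ) (B : ℝ),
        1 ≤ d → f.IsHomogeneous d →
        Finset.gcd f.support f.coeff = 1 →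
        Irreducible (MvPolynomial.map (Int.castRingHom ℚ) f) →
        1 ≤ B →
        ∃ g : MvPolynomial (Fin (n + 2)) ℤ,
          (∃ M : ℕ, g.IsHomogeneous M) ∧
          ¬ f ∣ g ∧
          (∀ v : Fin (n + 2) → ℤ, Finset.univ.gcd v = 1 →
            MvPolynomial.eval v f = 0 → (∀ i, |(v i : ℝ)| ≤ B) →
            MvPolynomial.eval v g = 0) ∧
          (g.totalDegree : ℝ) ≤
            c * B ^ (((n : ℝ) + 1) / ((n : ℝ) * (d : ℝ) ^ ((1 : ℝ) / n))) *
                (d : ℝ) ^ ((4 : ℝ) - 1 / n) * badness f /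
                (normMax f) ^ ((1 : ℝ) / ((n : ℝ) * (d : ℝ) ^ (1 + 1 / (n : ℝ))))
              + c * (d : ℝ) ^ ((1 : ℝ) - 1 / n) * Real.log B
              + c * (d : ℝ) ^ ((4 : ℝ) - 1 / n) := by
  obtain ⟨C, hC, hdich⟩ := wl_dich n hn
  have hn1 : (1 : ℝ) ≤ n := by exact_mod_cast hn
  have hn0 : (0 : ℝ) < n := by linarith
  set C1 : ℝ := (n + 2) ^ n * (n + 1) * ((n + 1) * (n + 2) + 2) with hC1
  have hC1' : 0 ≤ C1 := by positivity
  set C3 : ℝ := C + ((n : ℝ) + 1) / n * (n + 4 + 2 * (n + 1) * C1) with hC3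
  have hC3' : 0 ≤ C3 := by positivity
  have hexp : 1 ≤ Real.exp C3 := Real.one_le_exp hC3'
  refine ⟨2 * Real.exp C3 + 4, by positivity, ?_⟩
  intro d f B hd hf hprim hirr hB
  set c := 2 * Real.exp C3 + 4 with hc
  have hf0 : f ≠ 0 := by
    rintro rfl
    rw [map_zero] at hirr
    exact hirr.ne_zero rfl
  have hN := wl_one_le_normMax f hf0
  have hN0 : 0 < normMax f := by linarith
  have hB0 : 0 < B := by linarith
  have hd1 : (1 : ℝ) ≤ d := by exact_mod_cast hd
  have hd0 : (0 : ℝ) < d := by linarith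
  have hlB : 0 ≤ Real.log B := Real.log_nonneg hB
  have hL : 0 ≤ Real.log (normMax f) := Real.log_nonneg hN
  have hninv : 1 / (n : ℝ) ≤ 1 := by rw [div_le_one hn0]; exact hn1
  have hninv0 : 0 ≤ 1 / (n : ℝ) := by positivity
  set δ : ℝ := (d : ℝ) ^ ((1 : ℝ) / n) with hδ
  have hδ1 : 1 ≤ δ := Real.one_le_rpow hd1 hninv0
  have hδ0 : 0 < δ := by linarith
  have hδn : δ ^ n = d := by
    rw [hδ, ← Real.rpow_natCast, ← Real.rpow_mul hd0.le, one_div, inv_mul_cancel₀ (by positivity), Real.rpow_one]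
  have e4 : (d : ℝ) ^ ((4 : ℝ) - 1 / n) = d ^ 4 / δ := by
    rw [Real.rpow_sub hd0, ← hδ]; norm_cast
  have e1 : (d : ℝ) ^ ((1 : ℝ) - 1 / n) = d / δ := by
    rw [Real.rpow_sub hd0, ← hδ, Real.rpow_one]
  have e1' : (d : ℝ) ^ (1 + 1 / (n : ℝ)) = δ * d := by
    rw [Real.rpow_add hd0, ← hδ, Real.rpow_one, mul_comm]
  have hd4 : (d : ℝ) ≤ d ^ 4 / δ := by
    rw [← e4]
    calc (d : ℝ) = (d : ℝ) ^ (1 : ℝ) := (Real.rpow_one _).symm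
      _ ≤ _ := Real.rpow_le_rpow_of_exponent_le hd1 (by linarith)
  have hbad0 : 0 ≤ badness f := by
    by_cases hirr' : Irreducible (map (Int.castRingHom (AlgebraicClosure ℚ)) f)
    · obtain ⟨S, h, -⟩ := wl_badness_eq f hf hprim hirr'
      rw [h]; positivity
    · unfold badness; rw [if_neg hirr']
  rw [e4, e1, e1']
  set T : ℝ := B ^ (((n : ℝ) + 1) / ((n : ℝ) * δ)) * (d ^ 4 / δ) * badness f / (normMax f) ^ ((1 : ℝ) / ((n : ℝ) * (δ * d))) with hT
  have hT0 : 0 ≤ T := by positivity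
  have hTe : c * B ^ (((n : ℝ) + 1) / ((n : ℝ) * δ)) * (d ^ 4 / δ) * badness f / (normMax f) ^ ((1 : ℝ) / ((n : ℝ) * (δ * d))) = c * T := by
    rw [hT]; ring
  rw [hTe]
  have hc4 : 4 ≤ c := by rw [hc]; linarith
  have hR0 : 0 ≤ d / δ * Real.log B := by positivity
  have hsmall : ∀ g : MvPolynomial (Fin (n + 2)) ℤ, (g.totalDegree : ℝ) ≤ 2 * d →
      (g.totalDegree : ℝ) ≤ c * T + c * (d / δ) * Real.log B + c * (d ^ 4 / δ) := by
    intro g hg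
    have : 0 ≤ c * T := by positivity
    have : 0 ≤ c * (d / δ) * Real.log B := by positivity
    nlinarith
  by_cases hirr' : Irreducible (map (Int.castRingHom (AlgebraicClosure ℚ)) f)
  swap
  · obtain ⟨g, M, hg, hM, hfg, hv⟩ := wl_reducible f hf hirr hirr'
    refine ⟨g, ⟨M, hg⟩, hfg, fun v _ h _ => hv v h, hsmall g ?_⟩
    have h1 := hg.totalDegree_le
    have : ((g.totalDegree : ℕ) : ℝ) ≤ d := by exact_mod_cast h1.trans hM
    linarith
  obtain ⟨S, hbS, hS⟩ := wl_badness_eq f hf hprim hirr'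
  by_cases hcase : Real.log (normMax f) ≤ C1 * (d * (Real.log B + 1))
  swap
  · rcases hdich d d f B hd hd hf hprim hf0 hB S hS with ⟨g, hg, hfg, hv⟩ | ⟨s, hs1, h1, h2, hU, -⟩
    · refine ⟨g, ⟨_, hg⟩, hfg, hv, hsmall g ?_⟩
      have h1 := hg.totalDegree_le
      have : ((g.totalDegree : ℕ) : ℝ) ≤ ((d + d : ℕ) : ℝ) := by exact_mod_cast h1
      push_cast at this
      linarith
    · exfalso
      apply hcase
      refine wl_real1 n d s ((n + 1 + d).choose (n + 1) : ℕ) (Real.log B) _ hd1 (by exact_mod_cast hs1)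
        (by exact_mod_cast h2) (by exact_mod_cast wl_comb2 n d) hlB ?_
      refine le_trans hU (le_of_eq ?_)
      ring
  set E : ℕ := ⌊2 * Real.exp C3 * T⌋₊ + 1 + d + ⌈(d / δ) * Real.log B⌉₊ with hE
  rcases hdich d E f B hd (by omega) hf hprim hf0 hB S hS with ⟨g, hg, hfg, hv⟩ | ⟨s, hs1, h1, h2, hU, hlow⟩
  · refine ⟨g, ⟨_, hg⟩, hfg, hv, ?_⟩
    have h1 := hg.totalDegree_le
    have h2 : ((g.totalDegree : ℕ) : ℝ) ≤ ((E + d : ℕ) : ℝ) := by exact_mod_cast h1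
    rw [hE] at h2
    push_cast at h2
    have h3 : (⌊2 * Real.exp C3 * T⌋₊ : ℝ) ≤ 2 * Real.exp C3 * T := Nat.floor_le (by positivity)
    have h4 := (Nat.ceil_lt_add_one hR0).le
    have h5 : 2 * Real.exp C3 * T ≤ c * T := by
      apply mul_le_mul_of_nonneg_right _ hT0
      rw [hc]; linarith
    have h6 : d / δ * Real.log B ≤ c * (d / δ) * Real.log B := by
      rw [mul_assoc]
      exact le_mul_of_one_le_left hR0 (by linarith)
    have h7 : 4 * (d : ℝ) ≤ c * (d ^ 4 / δ) := mul_le_mul hc4 hd4 hd0.le (by linarith)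
    linarith
  · exfalso
    have hsr : (1 : ℝ) ≤ s := by exact_mod_cast hs1
    have hnf : (1 : ℝ) ≤ n.factorial := by exact_mod_cast Nat.factorial_pos n
    have hns : 1 ≤ (n.factorial : ℝ) * s := by nlinarith
    set Z : ℝ := ((n.factorial : ℝ) * s) ^ ((1 : ℝ) / n) with hZ
    have hZ1 : 1 ≤ Z := Real.one_le_rpow hns hninv0
    have hZn : Z ^ n = (n.factorial : ℝ) * s := by
      rw [hZ, ← Real.rpow_natCast, ← Real.rpow_mul (by positivity), one_div, inv_mul_cancel₀ (by positivity), Real.rpow_one]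
    have hEd : (d : ℝ) ≤ E := by
      have : d ≤ E := by omega
      exact_mod_cast this
    have hER : (d / δ) * Real.log B ≤ E := by
      refine (Nat.le_ceil _).trans ?_
      have : ⌈(d / δ) * Real.log B⌉₊ ≤ E := by omega
      exact_mod_cast this
    have hET : 2 * Real.exp C3 * T < (E : ℝ) := by
      have k1 := Nat.lt_floor_add_one (2 * Real.exp C3 * T)
      have k2 : ⌊2 * Real.exp C3 * T⌋₊ + 1 ≤ E := by omega
      have k3 : ((⌊2 * Real.exp C3 * T⌋₊ + 1 : ℕ) : ℝ) ≤ E := by exact_mod_cast k2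
      push_cast at k3
      linarith
    have hkey := wl_real n hn d E (E + d) s ((n + 1 + E).choose (n + 1) : ℕ) Z δ (Real.log B)
      (Real.log (normMax f)) (4 * Real.log d + ∑ p ∈ S, Real.log p / p + C) C1 hd1 hδ1 hδn rfl hEd hsr hZ1 hZn
      (by exact_mod_cast h1) (by exact_mod_cast h2) (by exact_mod_cast wl_comb2 n E) hlB hL hC1' hcase
      (by
        have : d * Real.log B = δ * (d / δ * Real.log B) := by field_simp
        rw [this]
        gcongr
        linarith)
      (hlow Z hZ1 hZn)
    have hTpos : 0 < T := by rw [hT, hbS]; positivity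
    have hlT : Real.log T = ((n : ℝ) + 1) / (n * δ) * Real.log B + (4 * Real.log d - Real.log δ)
        + ∑ p ∈ S, Real.log p / p - 1 / (n * (δ * d)) * Real.log (normMax f) := by
      rw [hT, hbS, Real.log_div (by positivity) (by positivity), Real.log_mul (by positivity) (by positivity),
        Real.log_mul (by positivity) (by positivity), Real.log_rpow hB0, Real.log_rpow hN0, Real.log_exp,
        Real.log_div (by positivity) (by positivity), Real.log_pow]
      push_cast
      ring
    have hlD : Real.log (δ * (E + d) / 2) = Real.log δ + Real.log (((E : ℝ) + d) / 2) := by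
      rw [mul_div_assoc, Real.log_mul (by positivity) (by positivity)]
    have hle : Real.log (((E : ℝ) + d) / 2) ≤ Real.log (Real.exp C3 * T) := by
      rw [Real.log_mul (by positivity) (by positivity), Real.log_exp]
      linarith
    have := (Real.log_le_log_iff (by positivity) (by positivity)).mp hle
    linarith


end WalshHelpers

/-- **Walsh-type theorem for projective hypersurfaces.** Let `n ≥ 1`. There is a
constant `c = c(n) > 0` such that for every primitive homogeneous
`f ∈ ℤ[x_0,…,x_{n+1}]` of degree `d ≥ 1`, irreducible over `ℚ`, and every `B ≥ 1`,
there is a homogeneous `g ∈ ℤ[x_0,…,x_{n+1}]`, not divisible by `f`, vanishing at all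
rational points of height at most `B` on the hypersurface `f = 0`, and of degree at
most `c·B^((n+1)/(n·d^(1/n)))·d^(4-1/n)·b(f)/‖f‖^(1/(n·d^(1+1/n)))
+ c·d^(1-1/n)·log B + c·d^(4-1/n)`. -/
theorem walsh_hypersurfaces_precise (n : ℕ) (hn : 1 ≤ n) :
    ∃ c : ℝ, 0 < c ∧
      ∀ (d : ℕ) (f : MvPolynomial (Fin (n + 2)) ℤ) (B : ℝ),
        1 ≤ d → f.IsHomogeneous d →
        Finset.gcd f.support f.coeff = 1 →
        Irreducible (MvPolynomial.map (Int.castRingHom ℚ) f) →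
        1 ≤ B →
        ∃ g : MvPolynomial (Fin (n + 2)) ℤ,
          (∃ M : ℕ, g.IsHomogeneous M) ∧
          ¬ f ∣ g ∧
          (∀ v : Fin (n + 2) → ℤ, Finset.univ.gcd v = 1 →
            MvPolynomial.eval v f = 0 → (∀ i, |(v i : ℝ)| ≤ B) →
            MvPolynomial.eval v g = 0) ∧
          (g.totalDegree : ℝ) ≤
            c * B ^ (((n : ℝ) + 1) / ((n : ℝ) * (d : ℝ) ^ ((1 : ℝ) / n))) *
                (d : ℝ) ^ ((4 : ℝ) - 1 / n) * badness f /
                (normMax f) ^ ((1 : ℝ) / ((n : ℝ) * (d : ℝ) ^ (1 + 1 / (n : ℝ))))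
              + c * (d : ℝ) ^ ((1 : ℝ) - 1 / n) * Real.log B
              + c * (d : ℝ) ^ ((4 : ℝ) - 1 / n) := by
  exact wl_main n hn
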